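/- arXiv:2411.13246 — 18 statements merged into one kernel-verified Lean document; each statement's English description precedes it below -/
import Mathlib

section
/- For every integer d ≥ 2, the rational function z^{d-1}(y^{d-1}-x^{d-1}) / (y^{d-1}(x^{d-1}-z^{d-1})) is a rational first integral of the Fermat foliation F₀ᵈ: with a = yᵈz − yzᵈ, b = xzᵈ − xᵈz, c = xᵈy − xyᵈ, P = z^{d-1}(y^{d-1}−x^{d-1}) and Q = y^{d-1}(x^{d-1}−z^{d-1}), the three polynomials a·(Q·∂yP − P·∂yQ) − b·(Q·∂xP − P·∂xQ), a·(Q·∂zP − P·∂zQ) − c·(Q·∂xP − P·∂xQ) and b·(Q·∂zP − P·∂zQ) − c·(Q·∂yP − P·∂yQ) vanish identically in ℂ[x,y,z]. -/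
open MvPolynomial

noncomputable section

namespace Stmt0

abbrev P3 : Type := MvPolynomial (Fin 3) ℂ

def x : P3 := X 0
def y : P3 := X 1
def z : P3 := X 2

def Dx : P3 → P3 := pderiv (0 : Fin 3)
def Dy : P3 → P3 := pderiv (1 : Fin 3)
def Dz : P3 → P3 := pderiv (2 : Fin 3)

/-- The pair `(P, Q)` gives a rational first integral `P/Q` of the 1-form
`a·dx + b·dy + c·dz`, i.e. the three coefficients of `ω ∧ (Q·dP − P·dQ)` vanish. -/
def IsRatFirstIntegral (a b c P Q : P3) : Prop :=
  a * (Q * Dy P - P * Dy Q) - b * (Q * Dx P - P * Dx Q) = 0 ∧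
  a * (Q * Dz P - P * Dz Q) - c * (Q * Dx P - P * Dx Q) = 0 ∧
  b * (Q * Dz P - P * Dz Q) - c * (Q * Dy P - P * Dy Q) = 0

/-- The rational function `z^{d-1}(y^{d-1}-x^{d-1}) / (y^{d-1}(x^{d-1}-z^{d-1}))` is a
rational first integral of the Fermat foliation `F₀ᵈ`. -/
theorem fermat_first_integral (d : ℕ) (hd : 2 ≤ d) :
    IsRatFirstIntegral
      (y ^ d * z - y * z ^ d) (x * z ^ d - x ^ d * z) (x ^ d * y - x * y ^ d)
      (z ^ (d - 1) * (y ^ (d - 1) - x ^ (d - 1)))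
      (y ^ (d - 1) * (x ^ (d - 1) - z ^ (d - 1))) := by
  obtain ⟨n, rfl⟩ := Nat.exists_eq_add_of_le' hd
  have hn : n + 2 - 1 = n + 1 := rfl
  simp only [IsRatFirstIntegral, Dx, Dy, Dz, x, y, z, hn, map_sub, Derivation.leibniz,
    Derivation.leibniz_pow, pderiv_X, Pi.single_apply, smul_eq_mul, nsmul_eq_mul,
    Nat.add_sub_cancel]
  refine ⟨?_, ?_, ?_⟩ <;> simp <;> ring

end Stmt0
end
end

section
/- For every integer d ≥ 2, a nonzero linear form L = u·x + v·y + w·z ∈ ℂ[x,y,z] defines an invariant line of the Fermat foliation F₀ᵈ if and only if L is a nonzero scalar multiple of one of the following 3d linear forms: x, y, z, and y − ηx, y − ηz, x − ηz where η ranges over the (d−1)-st roots of unity. In particular F₀ᵈ has exactly 3d distinct invariant lines. -/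
open MvPolynomial

noncomputable section

namespace Stmt1

abbrev P3 : Type := MvPolynomial (Fin 3) ℂ

def x : P3 := X 0
def y : P3 := X 1
def z : P3 := X 2

def Dx : P3 → P3 := pderiv (0 : Fin 3)
def Dy : P3 → P3 := pderiv (1 : Fin 3)
def Dz : P3 → P3 := pderiv (2 : Fin 3)

/-- `P` defines an invariant curve of the 1-form `a·dx + b·dy + c·dz`:
`P` divides the three coefficients of `ω ∧ dP`. -/
def IsInvariant (a b c P : P3) : Prop :=
  P ∣ (a * Dy P - b * Dx P) ∧ P ∣ (a * Dz P - c * Dx P) ∧ P ∣ (b * Dz P - c * Dy P)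

/-- Coefficients of the Fermat 1-form `Ω_Fᵈ`. -/
def aF (d : ℕ) : P3 := y ^ d * z - y * z ^ d
def bF (d : ℕ) : P3 := x * z ^ d - x ^ d * z
def cF (d : ℕ) : P3 := x ^ d * y - x * y ^ d

/-- The linear form with coefficients `u`, `v`, `w`. -/
def lin (u v w : ℂ) : P3 := C u * x + C v * y + C w * z

theorem eval_lin (u v w : ℂ) (q : Fin 3 → ℂ) :
    eval q (lin u v w) = u * q 0 + v * q 1 + w * q 2 := by
  simp [lin, x, y, z]

theorem lin_inj {u v w u' v' w' : ℂ} :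
    lin u v w = lin u' v' w' ↔ u = u' ∧ v = v' ∧ w = w' := by
  constructor
  · intro h
    have key (q : Fin 3 → ℂ) := congrArg (eval q) h
    simp only [eval_lin] at key
    refine ⟨?_, ?_, ?_⟩
    · simpa using key ![1, 0, 0]
    · simpa using key ![0, 1, 0]
    · simpa using key ![0, 0, 1]
  · rintro ⟨rfl, rfl, rfl⟩
    rfl

theorem lin_ne_zero_iff {u v w : ℂ} : lin u v w ≠ 0 ↔ ¬(u = 0 ∧ v = 0 ∧ w = 0) := by
  have h : lin 0 0 0 = 0 := by simp [lin]
  rw [← h, Ne, lin_inj]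

theorem smul_lin (t u v w : ℂ) : t • lin u v w = lin (t * u) (t * v) (t * w) := by
  simp only [lin, smul_eq_C_mul, C_mul]
  ring

/-- The derivative of the form `u·x + v·y + w·z` along the vector field
`xᵈ ∂x + yᵈ ∂y + zᵈ ∂z`, which is tangent to the Fermat foliation. -/
def powForm (d : ℕ) (u v w : ℂ) : P3 := C u * x ^ d + C v * y ^ d + C w * z ^ d

theorem isInvariant_lin_iff (d : ℕ) (u v w : ℂ) :
    IsInvariant (aF d) (bF d) (cF d) (lin u v w) ↔
      lin u v w ∣ z * powForm d u v w ∧ lin u v w ∣ y * powForm d u v w ∧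
        lin u v w ∣ x * powForm d u v w := by
  have hx : Dx (lin u v w) = C u := by simp [Dx, lin, x, y, z, pderiv_X]
  have hy : Dy (lin u v w) = C v := by simp [Dy, lin, x, y, z, pderiv_X]
  have hz : Dz (lin u v w) = C w := by simp [Dz, lin, x, y, z, pderiv_X]
  have h1 : aF d * C v - bF d * C u = z * powForm d u v w - lin u v w * z ^ d := by
    simp only [aF, bF, powForm, lin]; ring
  have h2 : aF d * C w - cF d * C u = lin u v w * y ^ d - y * powForm d u v w := by
    simp only [aF, cF, powForm, lin]; ring
  have h3 : bF d * C w - cF d * C v = x * powForm d u v w - lin u v w * x ^ d := by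
    simp only [bF, cF, powForm, lin]; ring
  rw [IsInvariant, hx, hy, hz, h1, h2, h3, dvd_sub_left (dvd_mul_right _ _),
    dvd_sub_right (dvd_mul_right _ _), dvd_sub_left (dvd_mul_right _ _)]

theorem isInvariant_of_dvd_powForm {d : ℕ} {u v w : ℂ} (h : lin u v w ∣ powForm d u v w) :
    IsInvariant (aF d) (bF d) (cF d) (lin u v w) :=
  (isInvariant_lin_iff d u v w).2
    ⟨h.mul_left _, h.mul_left _, h.mul_left _⟩

/-- On the points of an invariant line the Fermat vector field is tangent to the line. -/
theorem IsInvariant.eval_powForm {d : ℕ} (hd : d ≠ 0) {u v w : ℂ}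
    (h : IsInvariant (aF d) (bF d) (cF d) (lin u v w)) {p q r : ℂ}
    (hq : u * p + v * q + w * r = 0) : u * p ^ d + v * q ^ d + w * r ^ d = 0 := by
  obtain ⟨⟨A, hA⟩, ⟨B, hB⟩, ⟨D, hD⟩⟩ := (isInvariant_lin_iff d u v w).1 h
  have hA' := congrArg (eval ![p, q, r]) hA
  have hB' := congrArg (eval ![p, q, r]) hB
  have hD' := congrArg (eval ![p, q, r]) hD
  simp [eval_lin, powForm, x, y, z, hq] at hA' hB' hD'
  rcases hA' with hr | hA'
  · rcases hB' with hq | hB'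
    · rcases hD' with hp | hD'
      · simp [hp, hq, hr, hd]
      · exact hD'
    · exact hB'
  · exact hA'

theorem neg_div_pow_eq_one {d : ℕ} (hd : 2 ≤ d) {u v : ℂ} (hu : u ≠ 0) (hv : v ≠ 0)
    (h : u + v * (-u / v) ^ d = 0) : (-u / v) ^ (d - 1) = 1 := by
  obtain ⟨n, rfl⟩ : ∃ n, d = n + 1 := ⟨d - 1, by omega⟩
  rw [pow_succ] at h
  have h' : u * (1 - (-u / v) ^ n) = 0 := by
    rw [← h]; field_simp; ring
  rcases mul_eq_zero.1 h' with h' | h'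
  · exact absurd h' hu
  · exact (sub_eq_zero.1 h').symm

theorem coe_rootsOfUnity_pow {n : ℕ} (η : rootsOfUnity n ℂ) : ((η : ℂˣ) : ℂ) ^ n = 1 := by
  rw [← Units.val_pow_eq_pow_val, (mem_rootsOfUnity _ _).1 η.2, Units.val_one]

theorem pow_eq_self_of_pow_sub_one {d : ℕ} (hd : d ≠ 0) {η : ℂ} (h : η ^ (d - 1) = 1) :
    η ^ d = η := by
  rw [← pow_sub_one_mul hd, h, one_mul]

/-- Indices for the `3d` invariant lines. -/
abbrev LineIndex (d : ℕ) : Type := Fin 3 ⊕ (Fin 3 × rootsOfUnity (d - 1) ℂ)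

/-- The `3d` linear forms defining the invariant lines of the Fermat foliation. -/
def line (d : ℕ) : LineIndex d → P3
  | .inl 0 => lin 1 0 0
  | .inl 1 => lin 0 1 0
  | .inl 2 => lin 0 0 1
  | .inr (0, η) => lin (-(η : ℂˣ)) 1 0
  | .inr (1, η) => lin 0 1 (-(η : ℂˣ))
  | .inr (2, η) => lin 1 0 (-(η : ℂˣ))

theorem exists_index_iff {d : ℕ} (hd : 2 ≤ d) (P : P3 → Prop) :
    (∃ i, P (line d i)) ↔ P x ∨ P y ∨ P z ∨ ∃ η : ℂ, η ^ (d - 1) = 1 ∧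
      (P (y - C η * x) ∨ P (y - C η * z) ∨ P (x - C η * z)) := by
  have hx : lin 1 0 0 = x := by simp [lin]
  have hy : lin 0 1 0 = y := by simp [lin]
  have hz : lin 0 0 1 = z := by simp [lin]
  have h0 (η : ℂ) : lin (-η) 1 0 = y - C η * x := by simp [lin]; ring
  have h1 (η : ℂ) : lin 0 1 (-η) = y - C η * z := by simp [lin]; ring
  have h2 (η : ℂ) : lin 1 0 (-η) = x - C η * z := by simp [lin]; ring
  constructor
  · rintro ⟨i | ⟨i, η⟩, h⟩
    · fin_cases i <;> simp only [line, hx, hy, hz] at h <;> simp [h]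
    · refine .inr (.inr (.inr ⟨_, coe_rootsOfUnity_pow η, ?_⟩))
      fin_cases i <;> simp only [line, h0, h1, h2] at h <;> simp [h]
  · rintro (h | h | h | ⟨η, hη, h⟩)
    · exact ⟨.inl 0, by simpa only [line, hx]⟩
    · exact ⟨.inl 1, by simpa only [line, hy]⟩
    · exact ⟨.inl 2, by simpa only [line, hz]⟩
    · have : NeZero (d - 1) := ⟨by omega⟩
      have hc : ((rootsOfUnity.mkOfPowEq η hη : ℂˣ) : ℂ) = η := rootsOfUnity.val_mkOfPowEq_coe η hη
      rcases h with h | h | h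
      · exact ⟨.inr (0, rootsOfUnity.mkOfPowEq η hη), by simpa only [line, hc, h0]⟩
      · exact ⟨.inr (1, rootsOfUnity.mkOfPowEq η hη), by simpa only [line, hc, h1]⟩
      · exact ⟨.inr (2, rootsOfUnity.mkOfPowEq η hη), by simpa only [line, hc, h2]⟩

theorem line_eq_lin_dvd_powForm {d : ℕ} (hd : 2 ≤ d) (i : LineIndex d) :
    ∃ u v w : ℂ, line d i = lin u v w ∧ lin u v w ≠ 0 ∧ lin u v w ∣ powForm d u v w := by
  have hd0 : d ≠ 0 := by omega
  rcases i with i | ⟨i, η⟩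
  · fin_cases i
    · exact ⟨1, 0, 0, rfl, by simp [lin_ne_zero_iff], by simp [lin, powForm, hd0]⟩
    · exact ⟨0, 1, 0, rfl, by simp [lin_ne_zero_iff], by simp [lin, powForm, hd0]⟩
    · exact ⟨0, 0, 1, rfl, by simp [lin_ne_zero_iff], by simp [lin, powForm, hd0]⟩
  · have hη : (C ((η : ℂˣ) : ℂ) : P3) ^ d = C ((η : ℂˣ) : ℂ) := by
      rw [← C_pow, pow_eq_self_of_pow_sub_one hd0 (coe_rootsOfUnity_pow η)]
    have key (X Y : P3) :
        Y - C ((η : ℂˣ) : ℂ) * X ∣ Y ^ d - C ((η : ℂˣ) : ℂ) * X ^ d := by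
      have h := sub_dvd_pow_sub_pow Y (C ((η : ℂˣ) : ℂ) * X) d
      rwa [mul_pow, hη] at h
    fin_cases i
    · refine ⟨_, _, _, rfl, by simp [lin_ne_zero_iff], ?_⟩
      convert key x y using 1 <;> simp [lin, powForm] <;> ring
    · refine ⟨_, _, _, rfl, by simp [lin_ne_zero_iff], ?_⟩
      convert key z y using 1 <;> simp [lin, powForm] <;> ring
    · refine ⟨_, _, _, rfl, by simp [lin_ne_zero_iff], ?_⟩
      convert key z x using 1 <;> simp [lin, powForm] <;> ring

theorem IsInvariant.coeff_eq_zero {d : ℕ} (hd : 2 ≤ d) {u v w : ℂ}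
    (h : IsInvariant (aF d) (bF d) (cF d) (lin u v w)) : u = 0 ∨ v = 0 ∨ w = 0 := by
  by_contra! hne
  obtain ⟨hu, hv, hw⟩ := hne
  have hd0 : d ≠ 0 := by omega
  have h1 := h.eval_powForm hd0 (p := 1) (q := 0) (r := -u / w) (by field_simp; ring)
  have h2 := h.eval_powForm hd0 (p := 0) (q := 1) (r := -v / w) (by field_simp; ring)
  have h3 := h.eval_powForm hd0 (p := -w / u) (q := -w / v) (r := 2) (by field_simp; ring)
  simp only [one_pow, zero_pow hd0, mul_one, mul_zero, add_zero, zero_add] at h1 h2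
  have e1 := neg_div_pow_eq_one hd hu hw h1
  have e2 := neg_div_pow_eq_one hd hv hw h2
  obtain ⟨n, rfl⟩ : ∃ n, d = n + 2 := ⟨d - 2, by omega⟩
  have i1 : -w / u = (-u / w)⁻¹ := by field_simp
  have i2 : -w / v = (-v / w)⁻¹ := by field_simp
  simp only [Nat.add_succ_sub_one] at e1 e2
  rw [i1, i2, inv_pow, inv_pow, pow_succ (-u / w), pow_succ (-v / w), e1, e2] at h3
  have h4 : w * ((2 : ℂ) ^ (n + 2) - 2) = 0 := by
    rw [← h3]; field_simp; ring
  have h5 : (2 : ℂ) ^ (n + 2) = 2 := sub_eq_zero.1 ((mul_eq_zero.1 h4).resolve_left hw)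
  have h6 : 2 ^ (n + 2) = 2 := by exact_mod_cast h5
  have := Nat.one_le_two_pow (n := n)
  rw [pow_add] at h6
  omega

theorem isInvariant_lin_iff_exists {d : ℕ} (hd : 2 ≤ d) {u v w : ℂ} (hL : lin u v w ≠ 0) :
    IsInvariant (aF d) (bF d) (cF d) (lin u v w) ↔
      ∃ t : ℂ, t ≠ 0 ∧ ∃ i, lin u v w = C t * line d i := by
  have hd0 : d ≠ 0 := by omega
  constructor
  · intro h
    have : NeZero (d - 1) := ⟨by omega⟩
    rw [lin_ne_zero_iff] at hL
    simp only [← smul_eq_C_mul]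
    have root {a b : ℂ} (ha : a ≠ 0) (hb : b ≠ 0) (hab : a + b * (-a / b) ^ d = 0) :
        ∃ η : rootsOfUnity (d - 1) ℂ, a = b * -((η : ℂˣ) : ℂ) := by
      refine ⟨rootsOfUnity.mkOfPowEq _ (neg_div_pow_eq_one hd ha hb hab), ?_⟩
      rw [rootsOfUnity.val_mkOfPowEq_coe]
      field_simp
    by_cases hu : u = 0 <;> by_cases hv : v = 0 <;> by_cases hw : w = 0
    · exact absurd ⟨hu, hv, hw⟩ hL
    · exact ⟨w, hw, .inl 2, by simp [line, smul_lin, hu, hv]⟩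
    · exact ⟨v, hv, .inl 1, by simp [line, smul_lin, hu, hw]⟩
    · obtain ⟨η, hη⟩ := root hw hv <| by
        simpa [hu, add_comm] using
          h.eval_powForm hd0 (p := 0) (q := -w / v) (r := 1) (by field_simp; ring)
      exact ⟨v, hv, .inr (1, η), by simp only [line, smul_lin, hu, ← hη, mul_zero, mul_one]⟩
    · exact ⟨u, hu, .inl 0, by simp [line, smul_lin, hv, hw]⟩
    · obtain ⟨η, hη⟩ := root hw hu <| by
        simpa [hv, add_comm] using
          h.eval_powForm hd0 (p := -w / u) (q := 0) (r := 1) (by field_simp; ring)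
      exact ⟨u, hu, .inr (2, η), by simp only [line, smul_lin, hv, ← hη, mul_zero, mul_one]⟩
    · obtain ⟨η, hη⟩ := root hu hv <| by
        simpa [hw] using
          h.eval_powForm hd0 (p := 1) (q := -u / v) (r := 0) (by field_simp; ring)
      exact ⟨v, hv, .inr (0, η), by simp only [line, smul_lin, hw, ← hη, mul_zero, mul_one]⟩
    · have := h.coeff_eq_zero hd
      tauto
  · rintro ⟨t, ht, i, h⟩
    obtain ⟨u', v', w', hi, -, k⟩ := line_eq_lin_dvd_powForm hd i
    rw [hi, ← smul_eq_C_mul, smul_lin, lin_inj] at h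
    obtain ⟨rfl, rfl, rfl⟩ := h
    apply isInvariant_of_dvd_powForm
    have e : powForm d (t * u') (t * v') (t * w') = C t * powForm d u' v' w' := by
      simp only [powForm, C_mul]; ring
    rw [e, ← smul_lin, smul_eq_C_mul]
    exact mul_dvd_mul_left _ k

theorem span_line_injective (d : ℕ) :
    Function.Injective fun i : LineIndex d => Submodule.span ℂ {line d i} := by
  intro i j h
  obtain ⟨t, ht⟩ := Submodule.span_singleton_eq_span_singleton.1 h
  rw [Units.smul_def] at ht
  generalize (t : ℂ) = s at ht
  rcases i with i | ⟨i, η⟩ <;> rcases j with j | ⟨j, ξ⟩ <;> fin_cases i <;> fin_cases j <;>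
    simp [line, smul_lin, lin_inj] at ht ⊢ <;>
    first
    | exact Subtype.ext (Units.ext (by grind))
    | grind

theorem setOf_invariant_lines {d : ℕ} (hd : 2 ≤ d) :
    {W : Submodule ℂ P3 | ∃ L : P3,
      (∃ u v w : ℂ, L = C u * x + C v * y + C w * z) ∧ L ≠ 0 ∧
      IsInvariant (aF d) (bF d) (cF d) L ∧ W = Submodule.span ℂ {L}} =
    Set.range fun i : LineIndex d => Submodule.span ℂ {line d i} := by
  ext W
  constructor
  · rintro ⟨_, ⟨u, v, w, rfl⟩, h0, h, rfl⟩
    obtain ⟨t, ht, i, hi⟩ := (isInvariant_lin_iff_exists hd h0).1 h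
    refine ⟨i, ?_⟩
    change _ = Submodule.span ℂ {lin u v w}
    rw [hi, ← smul_eq_C_mul, Submodule.span_singleton_smul_eq ht.isUnit]
  · rintro ⟨i, rfl⟩
    obtain ⟨u, v, w, hi, h0, k⟩ := line_eq_lin_dvd_powForm hd i
    exact ⟨lin u v w, ⟨u, v, w, rfl⟩, h0, isInvariant_of_dvd_powForm k, by simp only [hi]⟩

/-- A nonzero linear form `L = u·x + v·y + w·z` defines an invariant line of the Fermat
foliation `F₀ᵈ` iff it is a nonzero scalar multiple of one of `x`, `y`, `z`,
`y − ηx`, `y − ηz`, `x − ηz` with `η^{d-1} = 1`; and `F₀ᵈ` has exactly `3d` distinct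
invariant lines. -/
theorem fermat_invariant_lines (d : ℕ) (hd : 2 ≤ d) :
    (∀ u v w : ℂ, C u * x + C v * y + C w * z ≠ 0 →
      (IsInvariant (aF d) (bF d) (cF d) (C u * x + C v * y + C w * z) ↔
        ∃ t : ℂ, t ≠ 0 ∧
          (C u * x + C v * y + C w * z = C t * x ∨
           C u * x + C v * y + C w * z = C t * y ∨
           C u * x + C v * y + C w * z = C t * z ∨
           ∃ η : ℂ, η ^ (d - 1) = 1 ∧
             (C u * x + C v * y + C w * z = C t * (y - C η * x) ∨
              C u * x + C v * y + C w * z = C t * (y - C η * z) ∨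
              C u * x + C v * y + C w * z = C t * (x - C η * z))))) ∧
    Set.ncard {W : Submodule ℂ P3 | ∃ L : P3,
      (∃ u v w : ℂ, L = C u * x + C v * y + C w * z) ∧ L ≠ 0 ∧
      IsInvariant (aF d) (bF d) (cF d) L ∧ W = Submodule.span ℂ {L}} = 3 * d := by
  constructor
  · intro u v w hL
    exact (isInvariant_lin_iff_exists hd hL).trans <| exists_congr fun t =>
      and_congr_right fun _ => exists_index_iff hd fun Q => lin u v w = C t * Q
  · have : NeZero (d - 1) := ⟨by omega⟩
    rw [setOf_invariant_lines hd, ← Nat.card_coe_set_eq,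
      Nat.card_range_of_injective (span_line_injective d), Nat.card_sum,
      Nat.card_prod,
      Complex.card_rootsOfUnity, Nat.card_fin]
    omega

end Stmt1
end
end

section
/- For every integer d ≥ 2 and every λ ∈ ℂ, the algebraic curve of equation P_λ(x,y,z) = (xy)^{d-1} − λ(xz)^{d-1} + (λ−1)(yz)^{d-1} = 0 is invariant by the Fermat foliation F₀ᵈ: P_λ divides each of the three polynomials a·∂yP_λ − b·∂xP_λ, a·∂zP_λ − c·∂xP_λ and b·∂zP_λ − c·∂yP_λ, where a = yᵈz − yzᵈ, b = xzᵈ − xᵈz, c = xᵈy − xyᵈ. -/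
open MvPolynomial

noncomputable section

namespace Stmt2

abbrev P3 : Type := MvPolynomial (Fin 3) ℂ

def x : P3 := X 0
def y : P3 := X 1
def z : P3 := X 2

def Dx : P3 → P3 := pderiv (0 : Fin 3)
def Dy : P3 → P3 := pderiv (1 : Fin 3)
def Dz : P3 → P3 := pderiv (2 : Fin 3)

/-- `P` defines an invariant curve of the 1-form `a·dx + b·dy + c·dz`. -/
def IsInvariant (a b c P : P3) : Prop :=
  P ∣ (a * Dy P - b * Dx P) ∧ P ∣ (a * Dz P - c * Dx P) ∧ P ∣ (b * Dz P - c * Dy P)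

theorem Dx_leaf (n : ℕ) (lam : ℂ) :
    Dx ((x * y) ^ (n + 1) - C lam * (x * z) ^ (n + 1) + C (lam - 1) * (y * z) ^ (n + 1)) =
      ((n : P3) + 1) * x ^ n * (y ^ (n + 1) - C lam * z ^ (n + 1)) := by
  simp [Dx, x, y, z, Derivation.leibniz, Derivation.leibniz_pow, pderiv_X]
  ring

theorem Dy_leaf (n : ℕ) (lam : ℂ) :
    Dy ((x * y) ^ (n + 1) - C lam * (x * z) ^ (n + 1) + C (lam - 1) * (y * z) ^ (n + 1)) =
      ((n : P3) + 1) * y ^ n * (x ^ (n + 1) + C (lam - 1) * z ^ (n + 1)) := by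
  simp [Dy, x, y, z, Derivation.leibniz, Derivation.leibniz_pow, pderiv_X]
  ring

theorem Dz_leaf (n : ℕ) (lam : ℂ) :
    Dz ((x * y) ^ (n + 1) - C lam * (x * z) ^ (n + 1) + C (lam - 1) * (y * z) ^ (n + 1)) =
      ((n : P3) + 1) * z ^ n * (C (lam - 1) * y ^ (n + 1) - C lam * x ^ (n + 1)) := by
  simp [Dz, x, y, z, Derivation.leibniz, Derivation.leibniz_pow, pderiv_X]
  ring

/-- For every `d ≥ 2` and `λ ∈ ℂ`, the curve
`P_λ = (xy)^{d-1} − λ(xz)^{d-1} + (λ−1)(yz)^{d-1} = 0` is invariant by the Fermat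
foliation `F₀ᵈ`. -/
theorem fermat_invariant_leaves (d : ℕ) (hd : 2 ≤ d) (lam : ℂ) :
    IsInvariant
      (y ^ d * z - y * z ^ d) (x * z ^ d - x ^ d * z) (x ^ d * y - x * y ^ d)
      ((x * y) ^ (d - 1) - C lam * (x * z) ^ (d - 1) + C (lam - 1) * (y * z) ^ (d - 1)) := by
  obtain ⟨n, rfl⟩ := Nat.exists_eq_add_of_le' hd
  rw [IsInvariant, show n + 2 - 1 = n + 1 from rfl, Dx_leaf, Dy_leaf, Dz_leaf, C_sub, C_1]
  refine ⟨⟨((n : P3) + 1) * z * (x ^ (n + 1) + y ^ (n + 1) - z ^ (n + 1)), ?_⟩,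
    ⟨((n : P3) + 1) * y * (y ^ (n + 1) - x ^ (n + 1) - z ^ (n + 1)), ?_⟩,
    ⟨((n : P3) + 1) * x * (y ^ (n + 1) + z ^ (n + 1) - x ^ (n + 1)), ?_⟩⟩ <;> ring

end Stmt2
end
end

section
/- For every integer d ≥ 2, the rational function (y/z)·((y/x)^{d-1} − 1), i.e. P/Q with P = yᵈ − x^{d-1}y and Q = x^{d-1}z, is a rational first integral of the foliation H₀ᵈ: with a = yᵈz − d·yᵈz = (1−d)yᵈz, b = xzᵈ·0 − xᵈz + d·z·y^{d-1}·x (that is, the coefficients a, b, c of Ω(H₀ᵈ) = xᵈ(y·dz − z·dy) + yᵈ(z·dx − x·dz) + d·z·y^{d-1}(x·dy − y·dx)), the three polynomials a·(Q·∂yP − P·∂yQ) − b·(Q·∂xP − P·∂xQ), a·(Q·∂zP − P·∂zQ) − c·(Q·∂xP − P·∂xQ) and b·(Q·∂zP − P·∂zQ) − c·(Q·∂yP − P·∂yQ) vanish identically in ℂ[x,y,z]. -/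
open MvPolynomial

noncomputable section

namespace Stmt3

abbrev P3 : Type := MvPolynomial (Fin 3) ℂ

def x : P3 := X 0
def y : P3 := X 1
def z : P3 := X 2

def Dx : P3 → P3 := pderiv (0 : Fin 3)
def Dy : P3 → P3 := pderiv (1 : Fin 3)
def Dz : P3 → P3 := pderiv (2 : Fin 3)

/-- The pair `(P, Q)` gives a rational first integral `P/Q` of the 1-form
`a·dx + b·dy + c·dz`. -/
def IsRatFirstIntegral (a b c P Q : P3) : Prop :=
  a * (Q * Dy P - P * Dy Q) - b * (Q * Dx P - P * Dx Q) = 0 ∧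
  a * (Q * Dz P - P * Dz Q) - c * (Q * Dx P - P * Dx Q) = 0 ∧
  b * (Q * Dz P - P * Dz Q) - c * (Q * Dy P - P * Dy Q) = 0

/-- The rational function `(y/z)·((y/x)^{d-1} − 1)`, written as `P/Q` with
`P = yᵈ − x^{d-1}y` and `Q = x^{d-1}z`, is a rational first integral of the homogeneous
foliation `H₀ᵈ` defined by
`Ω(H₀ᵈ) = xᵈ(y·dz − z·dy) + yᵈ(z·dx − x·dz) + d·z·y^{d-1}(x·dy − y·dx)`,
whose coefficients are `a = (1−d)yᵈz`, `b = −xᵈz + d·x·z·y^{d-1}`, `c = xᵈy − xyᵈ`. -/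
theorem H0_first_integral (d : ℕ) (hd : 2 ≤ d) :
    IsRatFirstIntegral
      (C (1 - (d : ℂ)) * (y ^ d * z))
      (-(x ^ d * z) + C (d : ℂ) * (x * z * y ^ (d - 1)))
      (x ^ d * y - x * y ^ d)
      (y ^ d - x ^ (d - 1) * y)
      (x ^ (d - 1) * z) := by
  obtain ⟨n, rfl⟩ : ∃ n, d = n + 2 := ⟨d - 2, by omega⟩
  have hn : n + 2 - 1 = n + 1 := rfl
  have hC : (C (1 - ((n + 2 : ℕ) : ℂ)) : P3) = -((n : P3) + 1) := by
    simp only [map_sub, map_one, map_natCast]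
    push_cast
    ring
  have hC' : (C ((n + 2 : ℕ) : ℂ) : P3) = (n : P3) + 2 := by
    simp only [map_natCast]
    push_cast
    ring
  rw [hn, hC, hC']
  unfold IsRatFirstIntegral Dx Dy Dz x y z
  simp only [map_sub, Derivation.leibniz, Derivation.leibniz_pow, pderiv_X, smul_eq_mul,
    nsmul_eq_mul]
  simp
  refine ⟨?_, ?_, ?_⟩ <;> ring

end Stmt3
end
end

section
/- For every integer d ≥ 2, the rational function z^{d-1}(1/y^{d-1} − 1/x^{d-1}), i.e. P/Q with P = z^{d-1}(x^{d-1} − y^{d-1}) and Q = x^{d-1}y^{d-1}, is a rational first integral of the homogeneous foliation H₁ᵈ defined by Ω(H₁ᵈ) = xᵈ(y·dz − z·dy) + yᵈ(z·dx − x·dz): with a = yᵈz, b = −xᵈz, c = xᵈy − xyᵈ, the three polynomials a·(Q·∂yP − P·∂yQ) − b·(Q·∂xP − P·∂xQ), a·(Q·∂zP − P·∂zQ) − c·(Q·∂xP − P·∂xQ) and b·(Q·∂zP − P·∂zQ) − c·(Q·∂yP − P·∂yQ) vanish identically in ℂ[x,y,z]. -/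
open MvPolynomial

noncomputable section

namespace Stmt4

abbrev P3 : Type := MvPolynomial (Fin 3) ℂ

def x : P3 := X 0
def y : P3 := X 1
def z : P3 := X 2

def Dx : P3 → P3 := pderiv (0 : Fin 3)
def Dy : P3 → P3 := pderiv (1 : Fin 3)
def Dz : P3 → P3 := pderiv (2 : Fin 3)

/-- The pair `(P, Q)` gives a rational first integral `P/Q` of the 1-form
`a·dx + b·dy + c·dz`. -/
def IsRatFirstIntegral (a b c P Q : P3) : Prop :=
  a * (Q * Dy P - P * Dy Q) - b * (Q * Dx P - P * Dx Q) = 0 ∧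
  a * (Q * Dz P - P * Dz Q) - c * (Q * Dx P - P * Dx Q) = 0 ∧
  b * (Q * Dz P - P * Dz Q) - c * (Q * Dy P - P * Dy Q) = 0

/-- The rational function `z^{d-1}(1/y^{d-1} − 1/x^{d-1})`, written as `P/Q` with
`P = z^{d-1}(x^{d-1} − y^{d-1})` and `Q = x^{d-1}y^{d-1}`, is a rational first integral
of the homogeneous foliation `H₁ᵈ` with `a = yᵈz`, `b = −xᵈz`, `c = xᵈy − xyᵈ`. -/
theorem H1_first_integral (d : ℕ) (hd : 2 ≤ d) :
    IsRatFirstIntegral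
      (y ^ d * z) (-(x ^ d * z)) (x ^ d * y - x * y ^ d)
      (z ^ (d - 1) * (x ^ (d - 1) - y ^ (d - 1)))
      (x ^ (d - 1) * y ^ (d - 1)) := by
  obtain ⟨n, rfl⟩ := Nat.exists_eq_add_of_le' hd
  simp only [IsRatFirstIntegral, Dx, Dy, Dz, x, y, z, Nat.add_succ_sub_one, Derivation.leibniz,
    Derivation.leibniz_pow, map_sub, pderiv_X, Pi.single_apply, smul_eq_mul, nsmul_eq_mul,
    Fin.reduceEq, if_true, if_false]
  refine ⟨?_, ?_, ?_⟩ <;> · push_cast; ring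

end Stmt4
end
end

section
/- For every integer d ≥ 2, the rational function (x/y)^{d-1} + (d−1)z/x, i.e. P/Q with P = xᵈ + (d−1)z·y^{d-1} and Q = x·y^{d-1}, is a rational first integral of the foliation F₁ᵈ defined by Ω(F₁ᵈ) = yᵈ(z·dx − x·dz) + xᵈ(x·dy − y·dx): with a = yᵈz − xᵈy, b = x^{d+1}, c = −xyᵈ, the three polynomials a·(Q·∂yP − P·∂yQ) − b·(Q·∂xP − P·∂xQ), a·(Q·∂zP − P·∂zQ) − c·(Q·∂xP − P·∂xQ) and b·(Q·∂zP − P·∂zQ) − c·(Q·∂yP − P·∂yQ) vanish identically in ℂ[x,y,z]. -/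
open MvPolynomial

noncomputable section

namespace Stmt5

abbrev P3 : Type := MvPolynomial (Fin 3) ℂ

def x : P3 := X 0
def y : P3 := X 1
def z : P3 := X 2

def Dx : P3 → P3 := pderiv (0 : Fin 3)
def Dy : P3 → P3 := pderiv (1 : Fin 3)
def Dz : P3 → P3 := pderiv (2 : Fin 3)

/-- The pair `(P, Q)` gives a rational first integral `P/Q` of the 1-form
`a·dx + b·dy + c·dz`. -/
def IsRatFirstIntegral (a b c P Q : P3) : Prop :=
  a * (Q * Dy P - P * Dy Q) - b * (Q * Dx P - P * Dx Q) = 0 ∧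
  a * (Q * Dz P - P * Dz Q) - c * (Q * Dx P - P * Dx Q) = 0 ∧
  b * (Q * Dz P - P * Dz Q) - c * (Q * Dy P - P * Dy Q) = 0

/-- The rational function `(x/y)^{d-1} + (d−1)z/x`, written as `P/Q` with
`P = xᵈ + (d−1)z·y^{d-1}` and `Q = x·y^{d-1}`, is a rational first integral of the
foliation `F₁ᵈ` with `a = yᵈz − xᵈy`, `b = x^{d+1}`, `c = −xyᵈ`. -/
theorem F1_first_integral (d : ℕ) (hd : 2 ≤ d) :
    IsRatFirstIntegral
      (y ^ d * z - x ^ d * y) (x ^ (d + 1)) (-(x * y ^ d))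
      (x ^ d + C ((d : ℂ) - 1) * (z * y ^ (d - 1)))
      (x * y ^ (d - 1)) := by
  obtain ⟨n, rfl⟩ : ∃ n, d = n + 2 := ⟨d - 2, by omega⟩
  have hC : (C (((n + 2 : ℕ) : ℂ) - 1) : P3) = (n : P3) + 1 := by
    rw [show (((n + 2 : ℕ) : ℂ) - 1) = (n : ℂ) + 1 by push_cast; ring]
    simp
  rw [hC, show n + 2 - 1 = n + 1 by omega]
  refine ⟨?_, ?_, ?_⟩ <;>
  · simp [Dx, Dy, Dz, x, y, z, Derivation.leibniz, Derivation.leibniz_pow, pderiv_X]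
    ring

end Stmt5
end
end

section
/- For every integer d ≥ 2 and every λ ∈ ℂ*, the algebraic curve of equation Q_λ(x,y,z) = yᵈ − x^{d-1}(y + λz) = 0 is invariant by the foliation H₀ᵈ: Q_λ divides each of the three polynomials a·∂yQ_λ − b·∂xQ_λ, a·∂zQ_λ − c·∂xQ_λ and b·∂zQ_λ − c·∂yQ_λ, where a, b, c are the coefficients of Ω(H₀ᵈ). -/
open MvPolynomial

noncomputable section

namespace Stmt6

abbrev P3 : Type := MvPolynomial (Fin 3) ℂ

def x : P3 := X 0
def y : P3 := X 1
def z : P3 := X 2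

def Dx : P3 → P3 := pderiv (0 : Fin 3)
def Dy : P3 → P3 := pderiv (1 : Fin 3)
def Dz : P3 → P3 := pderiv (2 : Fin 3)

/-- `P` defines an invariant curve of the 1-form `a·dx + b·dy + c·dz`. -/
def IsInvariant (a b c P : P3) : Prop :=
  P ∣ (a * Dy P - b * Dx P) ∧ P ∣ (a * Dz P - c * Dx P) ∧ P ∣ (b * Dz P - c * Dy P)

theorem Dx_leaf (e : ℕ) (lam : ℂ) :
    Dx (y ^ (e + 2) - x ^ (e + 1) * (y + C lam * z)) =
      -((e + 1 : P3) * x ^ e * (y + C lam * z)) := by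
  simp [Dx, x, y, z, pderiv_X, Derivation.leibniz_pow]
  ring

theorem Dy_leaf (e : ℕ) (lam : ℂ) :
    Dy (y ^ (e + 2) - x ^ (e + 1) * (y + C lam * z)) =
      (e + 2 : P3) * y ^ (e + 1) - x ^ (e + 1) := by
  simp [Dy, x, y, z, pderiv_X, Derivation.leibniz_pow]

theorem Dz_leaf (e : ℕ) (lam : ℂ) :
    Dz (y ^ (e + 2) - x ^ (e + 1) * (y + C lam * z)) = -(C lam * x ^ (e + 1)) := by
  simp [Dz, x, y, z, pderiv_X, Derivation.leibniz_pow]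
  ring

/-- For every `d ≥ 2` and `λ ∈ ℂ*`, the curve `Q_λ = yᵈ − x^{d-1}(y + λz) = 0` is
invariant by the homogeneous foliation `H₀ᵈ`, whose 1-form `Ω(H₀ᵈ)` has coefficients
`a = (1−d)yᵈz`, `b = −xᵈz + d·x·z·y^{d-1}`, `c = xᵈy − xyᵈ`. -/
theorem H0_invariant_leaves (d : ℕ) (hd : 2 ≤ d) (lam : ℂ) (hlam : lam ≠ 0) :
    IsInvariant
      (C (1 - (d : ℂ)) * (y ^ d * z))
      (-(x ^ d * z) + C (d : ℂ) * (x * z * y ^ (d - 1)))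
      (x ^ d * y - x * y ^ d)
      (y ^ d - x ^ (d - 1) * (y + C lam * z)) := by
  obtain ⟨e, rfl⟩ := Nat.exists_eq_add_of_le' hd
  have hC : (C ((e + 2 : ℕ) : ℂ) : P3) = e + 2 := by
    rw [map_natCast]
    push_cast
    rfl
  rw [show e + 2 - 1 = e + 1 from rfl]
  unfold IsInvariant
  rw [Dx_leaf, Dy_leaf, Dz_leaf, C_sub, hC, C_1]
  refine ⟨⟨-((e + 1 : P3) * z * ((e + 2 : P3) * y ^ (e + 1) - x ^ (e + 1))), ?_⟩,
    ⟨-((e + 1 : P3) * x ^ (e + 1) * y), ?_⟩,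
    ⟨x * ((e + 2 : P3) * y ^ (e + 1) - x ^ (e + 1)), ?_⟩⟩ <;> ring

end Stmt6
end
end

section
/- For every integer d ≥ 2 and every λ ∈ ℂ*, the algebraic curve of equation R_λ(x,y,z) = x^{d-1}y^{d-1} + λ(y^{d-1} − x^{d-1})z^{d-1} = 0 is invariant by the foliation H₁ᵈ: R_λ divides each of the three polynomials a·∂yR_λ − b·∂xR_λ, a·∂zR_λ − c·∂xR_λ and b·∂zR_λ − c·∂yR_λ, where a = yᵈz, b = −xᵈz, c = xᵈy − xyᵈ. -/
open MvPolynomial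

noncomputable section

namespace Stmt7

abbrev P3 : Type := MvPolynomial (Fin 3) ℂ

def x : P3 := X 0
def y : P3 := X 1
def z : P3 := X 2

def Dx : P3 → P3 := pderiv (0 : Fin 3)
def Dy : P3 → P3 := pderiv (1 : Fin 3)
def Dz : P3 → P3 := pderiv (2 : Fin 3)

/-- `P` defines an invariant curve of the 1-form `a·dx + b·dy + c·dz`. -/
def IsInvariant (a b c P : P3) : Prop :=
  P ∣ (a * Dy P - b * Dx P) ∧ P ∣ (a * Dz P - c * Dx P) ∧ P ∣ (b * Dz P - c * Dy P)

/-- For every `d ≥ 2` and `λ ∈ ℂ*`, the curve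
`R_λ = x^{d-1}y^{d-1} + λ(y^{d-1} − x^{d-1})z^{d-1} = 0` is invariant by the
homogeneous foliation `H₁ᵈ` with `a = yᵈz`, `b = −xᵈz`, `c = xᵈy − xyᵈ`. -/
theorem H1_invariant_leaves (d : ℕ) (hd : 2 ≤ d) (lam : ℂ) (hlam : lam ≠ 0) :
    IsInvariant
      (y ^ d * z) (-(x ^ d * z)) (x ^ d * y - x * y ^ d)
      (x ^ (d - 1) * y ^ (d - 1) + C lam * (y ^ (d - 1) - x ^ (d - 1)) * z ^ (d - 1)) := by
  obtain ⟨n, rfl⟩ : ∃ n, d = n + 2 := ⟨d - 2, by omega⟩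
  have hn : n + 2 - 1 = n + 1 := by omega
  rw [hn]
  have hx : Dx (x ^ (n + 1) * y ^ (n + 1) + C lam * (y ^ (n + 1) - x ^ (n + 1)) * z ^ (n + 1))
      = ((n : P3) + 1) * x ^ n * (y ^ (n + 1) - C lam * z ^ (n + 1)) := by
    simp [Dx, x, y, z, Derivation.leibniz, Derivation.leibniz_pow, pderiv_X]
    ring
  have hy : Dy (x ^ (n + 1) * y ^ (n + 1) + C lam * (y ^ (n + 1) - x ^ (n + 1)) * z ^ (n + 1))
      = ((n : P3) + 1) * y ^ n * (x ^ (n + 1) + C lam * z ^ (n + 1)) := by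
    simp [Dy, x, y, z, Derivation.leibniz, Derivation.leibniz_pow, pderiv_X]
    ring
  have hz : Dz (x ^ (n + 1) * y ^ (n + 1) + C lam * (y ^ (n + 1) - x ^ (n + 1)) * z ^ (n + 1))
      = ((n : P3) + 1) * C lam * (y ^ (n + 1) - x ^ (n + 1)) * z ^ n := by
    simp [Dz, x, y, z, Derivation.leibniz, Derivation.leibniz_pow, pderiv_X]
    ring
  unfold IsInvariant
  rw [hx, hy, hz]
  refine ⟨⟨((n : P3) + 1) * z * (x ^ (n + 1) + y ^ (n + 1)), ?_⟩,
    ⟨((n : P3) + 1) * y * (y ^ (n + 1) - x ^ (n + 1)), ?_⟩,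
    ⟨((n : P3) + 1) * x * (y ^ (n + 1) - x ^ (n + 1)), ?_⟩⟩ <;> ring

end Stmt7
end
end

section
/- For every integer d ≥ 2 and every λ ∈ ℂ, the algebraic curve of equation S_λ(x,y,z) = xᵈ + (d−1)y^{d-1}(z + λx) = 0 is invariant by the foliation F₁ᵈ: S_λ divides each of the three polynomials a·∂yS_λ − b·∂xS_λ, a·∂zS_λ − c·∂xS_λ and b·∂zS_λ − c·∂yS_λ, where a = yᵈz − xᵈy, b = x^{d+1}, c = −xyᵈ. -/
open MvPolynomial

noncomputable section

namespace Stmt8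

abbrev P3 : Type := MvPolynomial (Fin 3) ℂ

def x : P3 := X 0
def y : P3 := X 1
def z : P3 := X 2

def Dx : P3 → P3 := pderiv (0 : Fin 3)
def Dy : P3 → P3 := pderiv (1 : Fin 3)
def Dz : P3 → P3 := pderiv (2 : Fin 3)

/-- `P` defines an invariant curve of the 1-form `a·dx + b·dy + c·dz`. -/
def IsInvariant (a b c P : P3) : Prop :=
  P ∣ (a * Dy P - b * Dx P) ∧ P ∣ (a * Dz P - c * Dx P) ∧ P ∣ (b * Dz P - c * Dy P)

theorem Dx_leaf (n : ℕ) (lam : ℂ) :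
    Dx (x ^ (n + 2) + ((n : P3) + 1) * y ^ (n + 1) * (z + C lam * x)) =
      ((n : P3) + 2) * x ^ (n + 1) + ((n : P3) + 1) * y ^ (n + 1) * C lam := by
  have h : pderiv (0 : Fin 3) (n : P3) = 0 := Derivation.map_natCast _ n
  simp [Dx, x, y, z, pderiv_X, Derivation.leibniz, Derivation.leibniz_pow, h]

theorem Dy_leaf (n : ℕ) (lam : ℂ) :
    Dy (x ^ (n + 2) + ((n : P3) + 1) * y ^ (n + 1) * (z + C lam * x)) =
      ((n : P3) + 1) ^ 2 * y ^ n * (z + C lam * x) := by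
  have h : pderiv (1 : Fin 3) (n : P3) = 0 := Derivation.map_natCast _ n
  simp [Dy, x, y, z, pderiv_X, Derivation.leibniz, Derivation.leibniz_pow, h]
  ring

theorem Dz_leaf (n : ℕ) (lam : ℂ) :
    Dz (x ^ (n + 2) + ((n : P3) + 1) * y ^ (n + 1) * (z + C lam * x)) =
      ((n : P3) + 1) * y ^ (n + 1) := by
  have h : pderiv (2 : Fin 3) (n : P3) = 0 := Derivation.map_natCast _ n
  simp [Dz, x, y, z, pderiv_X, Derivation.leibniz, Derivation.leibniz_pow, h]

/-- For every `d ≥ 2` and `λ ∈ ℂ`, the curve `S_λ = xᵈ + (d−1)y^{d-1}(z + λx) = 0` is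
invariant by the foliation `F₁ᵈ` with `a = yᵈz − xᵈy`, `b = x^{d+1}`, `c = −xyᵈ`. -/
theorem F1_invariant_leaves (d : ℕ) (hd : 2 ≤ d) (lam : ℂ) :
    IsInvariant
      (y ^ d * z - x ^ d * y) (x ^ (d + 1)) (-(x * y ^ d))
      (x ^ d + C ((d : ℂ) - 1) * y ^ (d - 1) * (z + C lam * x)) := by
  obtain ⟨n, rfl⟩ := Nat.exists_eq_add_of_le' hd
  have hC : C (((n + 2 : ℕ) : ℂ) - 1) = (n + 1 : P3) := by
    simp only [map_sub, map_natCast, map_one]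
    push_cast
    ring
  have hn : n + 2 - 1 = n + 1 := rfl
  rw [hC, hn, IsInvariant, Dx_leaf, Dy_leaf, Dz_leaf]
  refine ⟨⟨((n : P3) + 1) * y ^ (n + 1) * z - ((n : P3) + 2) * x ^ (n + 2), ?_⟩,
    ⟨y ^ (n + 2), ?_⟩, ⟨((n : P3) + 1) * x * y ^ (n + 1), ?_⟩⟩ <;> ring

end Stmt8
end
end

section
/- Let d ≥ 2, ζ = exp(2πi/(d−1)), n ∈ ℕ, δ₁, δ₂, δ₃ ∈ {0,1}, δ₄, …, δ_{d+2} ∈ {0,1}, and let λ₁, …, λ_n ∈ ℂ* be pairwise distinct. Set P_λ = (xy)^{d-1} − λ(xz)^{d-1} + (λ−1)(yz)^{d-1}, R_λ = x^{d-1}y^{d-1} + λ(y^{d-1}−x^{d-1})z^{d-1}, f₁ = x^{δ₁}y^{δ₂}z^{δ₃}·∏_{k=0}^{d-2}(y−ζᵏx)^{δ_{k+4}}·∏_{j=1}^{n}R_{λ_j}, and for ε ∈ ℂ* set F₁^ε = x^{δ₁}y^{δ₂}z^{δ₃}·∏_{k=0}^{d-2}(y−ζᵏx)^{δ_{k+4}}·∏_{j=1}^{n}P_{σ_j(ε)}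 with σ_j(ε) = λ_j/ε^{d-1}. Let φ₁ be the polynomial map (x,y,z) ↦ (x, y, εz). Then for every monomial xⁱyʲzᵏ, the function ε ↦ ε^{−(δ₃+1)}·(coefficient of xⁱyʲzᵏ in each of the three components of φ₁*(F₁^ε·Ω_Fᵈ)) tends, as ε → 0, to the corresponding coefficient of the 1-form f₁·Ω(H₁ᵈ). -/
open MvPolynomial Filter Topology

noncomputable section

namespace Stmt10

abbrev P3 : Type := MvPolynomial (Fin 3) ℂ

def x : P3 := X 0
def y : P3 := X 1
def z : P3 := X 2

/-- Coefficients of the Fermat 1-form `Ω_Fᵈ`. -/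
def aF (d : ℕ) : P3 := y ^ d * z - y * z ^ d
def bF (d : ℕ) : P3 := x * z ^ d - x ^ d * z
def cF (d : ℕ) : P3 := x ^ d * y - x * y ^ d

/-- Coefficients of `Ω(H₁ᵈ)`. -/
def aH1 (d : ℕ) : P3 := y ^ d * z
def bH1 (d : ℕ) : P3 := -(x ^ d * z)
def cH1 (d : ℕ) : P3 := x ^ d * y - x * y ^ d

/-- `P_λ = (xy)^{d-1} − λ(xz)^{d-1} + (λ−1)(yz)^{d-1}`. -/
def Ppoly (d : ℕ) (lam : ℂ) : P3 :=
  (x * y) ^ (d - 1) - C lam * (x * z) ^ (d - 1) + C (lam - 1) * (y * z) ^ (d - 1)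

/-- `R_λ = x^{d-1}y^{d-1} + λ(y^{d-1} − x^{d-1})z^{d-1}`. -/
def Rpoly (d : ℕ) (lam : ℂ) : P3 :=
  x ^ (d - 1) * y ^ (d - 1) + C lam * (y ^ (d - 1) - x ^ (d - 1)) * z ^ (d - 1)

/-- Substitution by the polynomial map `φ₁ : (x,y,z) ↦ (x, y, εz)`. -/
def phi1 (ε : ℂ) : P3 →ₐ[ℂ] P3 := aeval ![x, y, C ε * z]

/-- `ζ = exp(2πi/(d−1))`. -/
def zeta (d : ℕ) : ℂ := Complex.exp (2 * (Real.pi : ℂ) * Complex.I / ((d : ℂ) - 1))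

open scoped Polynomial

/-- The polynomial family `ε ↦ p - εᵉ q`, as a polynomial over `ℂ[ε]`. -/
def perturb (e : ℕ) (p q : P3) : MvPolynomial (Fin 3) ℂ[X] :=
  map Polynomial.C p - C (Polynomial.X ^ e) * map Polynomial.C q

lemma map_eval_map_C (ε : ℂ) (p : P3) :
    map (Polynomial.evalRingHom ε) (map Polynomial.C p) = p := by
  rw [MvPolynomial.map_map]
  have h : (Polynomial.evalRingHom ε).comp Polynomial.C = RingHom.id ℂ := by ext; simp
  rw [h, MvPolynomial.map_id]

lemma map_eval_perturb (ε : ℂ) (e : ℕ) (p q : P3) :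
    map (Polynomial.evalRingHom ε) (perturb e p q) = p - C (ε ^ e) * q := by
  simp only [perturb, map_sub, map_mul, map_eval_map_C, map_C, Polynomial.coe_evalRingHom,
    Polynomial.eval_pow, Polynomial.eval_X]

lemma map_eval_zero_perturb {e : ℕ} (he : e ≠ 0) (p q : P3) :
    map (Polynomial.evalRingHom 0) (perturb e p q) = p := by
  rw [map_eval_perturb, zero_pow he, C_0, zero_mul, sub_zero]

/-- The coefficients of a polynomial family are continuous in the parameter, so dividing by the
power of `ε` that factors out gives the special fibre in the limit. -/
lemma tendsto_coeff_of_eq_pow_mul (G : MvPolynomial (Fin 3) ℂ[X]) (k : ℕ) (f : ℂ → P3)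
    (hf : ∀ ε, ε ≠ 0 → f ε = C (ε ^ k) * map (Polynomial.evalRingHom ε) G) (m : Fin 3 →₀ ℕ) :
    Tendsto (fun ε : ℂ => (ε ^ k)⁻¹ * coeff m (f ε)) (𝓝[≠] 0)
      (𝓝 (coeff m (map (Polynomial.evalRingHom 0) G))) := by
  have hcont : Tendsto (fun ε : ℂ => (coeff m G).eval ε) (𝓝[≠] 0) (𝓝 ((coeff m G).eval 0)) :=
    ((coeff m G).continuous.tendsto 0).mono_left nhdsWithin_le_nhds
  rw [coeff_map, Polynomial.coe_evalRingHom]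
  refine hcont.congr' ?_
  filter_upwards [self_mem_nhdsWithin] with ε hε
  rw [hf ε hε, coeff_C_mul, coeff_map, Polynomial.coe_evalRingHom,
    inv_mul_cancel_left₀ (pow_ne_zero k hε)]

@[simp] lemma phi1_x (ε : ℂ) : phi1 ε x = x := by simp [phi1, x]

@[simp] lemma phi1_y (ε : ℂ) : phi1 ε y = y := by simp [phi1, y]

@[simp] lemma phi1_z (ε : ℂ) : phi1 ε z = C ε * z := by simp [phi1, z]

@[simp] lemma phi1_C (ε a : ℂ) : phi1 ε (C a) = C a := algHom_C _ a

lemma phi1_Ppoly (d : ℕ) (l : ℂ) {ε : ℂ} (hε : ε ≠ 0) :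
    phi1 ε (Ppoly d (l / ε ^ (d - 1))) =
      Rpoly d l - C (ε ^ (d - 1)) * (y * z) ^ (d - 1) := by
  have h : (C (l / ε ^ (d - 1)) : P3) * C ε ^ (d - 1) = C l := by
    rw [← C_pow, ← C_mul, div_mul_cancel₀ _ (pow_ne_zero _ hε)]
  simp only [Ppoly, Rpoly, map_add, map_sub, map_mul, map_pow, phi1_x, phi1_y, phi1_z, phi1_C,
    mul_pow, map_one]
  linear_combination (y ^ (d - 1) * z ^ (d - 1) - x ^ (d - 1) * z ^ (d - 1)) * h

lemma phi1_aF {d : ℕ} (hd : d ≠ 0) (ε : ℂ) :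
    phi1 ε (aF d) = C ε * (aH1 d - C (ε ^ (d - 1)) * (y * z ^ d)) := by
  obtain ⟨e, rfl⟩ := Nat.exists_eq_add_one_of_ne_zero hd
  simp only [aF, aH1, map_sub, map_mul, map_pow, phi1_y, phi1_z, add_tsub_cancel_right]
  ring

lemma phi1_bF {d : ℕ} (hd : d ≠ 0) (ε : ℂ) :
    phi1 ε (bF d) = C ε * (bH1 d - C (ε ^ (d - 1)) * -(x * z ^ d)) := by
  obtain ⟨e, rfl⟩ := Nat.exists_eq_add_one_of_ne_zero hd
  simp only [bF, bH1, map_sub, map_mul, map_pow, phi1_x, phi1_z, add_tsub_cancel_right]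
  ring

lemma phi1_cF (d : ℕ) (ε : ℂ) : phi1 ε (cF d) = cH1 d := by
  simp only [cF, cH1, map_sub, map_mul, map_pow, phi1_x, phi1_y]

theorem degeneration_to_H1 (d n : ℕ) (hd : 2 ≤ d)
    (δ₁ δ₂ δ₃ : ℕ) (hδ₁ : δ₁ ≤ 1) (hδ₂ : δ₂ ≤ 1) (hδ₃ : δ₃ ≤ 1)
    (δ : Fin (d - 1) → ℕ) (hδ : ∀ k, δ k ≤ 1)
    (lam : Fin n → ℂ) (hlam : ∀ j, lam j ≠ 0) (hinj : Function.Injective lam)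
    -- `f₁ = x^{δ₁}y^{δ₂}z^{δ₃}·∏ₖ(y−ζᵏx)^{δ_{k+4}}·∏ⱼ R_{λⱼ}`
    (f₁ : P3)
    (hf₁ : f₁ = x ^ δ₁ * y ^ δ₂ * z ^ δ₃ *
      (∏ k : Fin (d - 1), (y - C (zeta d ^ (k : ℕ)) * x) ^ δ k) *
      ∏ j : Fin n, Rpoly d (lam j))
    -- `F₁^ε = x^{δ₁}y^{δ₂}z^{δ₃}·∏ₖ(y−ζᵏx)^{δ_{k+4}}·∏ⱼ P_{σⱼ(ε)}`, `σⱼ(ε) = λⱼ/ε^{d-1}`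
    (F₁ : ℂ → P3)
    (hF₁ : ∀ ε : ℂ, F₁ ε = x ^ δ₁ * y ^ δ₂ * z ^ δ₃ *
      (∏ k : Fin (d - 1), (y - C (zeta d ^ (k : ℕ)) * x) ^ δ k) *
      ∏ j : Fin n, Ppoly d (lam j / ε ^ (d - 1)))
    -- components in `dx`, `dy`, `dz` of the pullback `φ₁*(F₁^ε·Ω_Fᵈ)`,
    -- using `φ₁*dx = dx`, `φ₁*dy = dy`, `φ₁*dz = ε·dz`
    (comp₁ comp₂ comp₃ : ℂ → P3)
    (hcomp₁ : ∀ ε : ℂ, comp₁ ε = phi1 ε (F₁ ε * aF d))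
    (hcomp₂ : ∀ ε : ℂ, comp₂ ε = phi1 ε (F₁ ε * bF d))
    (hcomp₃ : ∀ ε : ℂ, comp₃ ε = C ε * phi1 ε (F₁ ε * cF d)) :
    -- after multiplying by `ε^{−(δ₃+1)}`, every coefficient tends to the corresponding
    -- coefficient of `f₁·Ω(H₁ᵈ)` as `ε → 0`
    ∀ m : Fin 3 →₀ ℕ,
      Tendsto (fun ε : ℂ => (ε ^ (δ₃ + 1))⁻¹ * coeff m (comp₁ ε)) (𝓝[≠] 0)
        (𝓝 (coeff m (f₁ * aH1 d))) ∧
      Tendsto (fun ε : ℂ => (ε ^ (δ₃ + 1))⁻¹ * coeff m (comp₂ ε)) (𝓝[≠] 0)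
        (𝓝 (coeff m (f₁ * bH1 d))) ∧
      Tendsto (fun ε : ℂ => (ε ^ (δ₃ + 1))⁻¹ * coeff m (comp₃ ε)) (𝓝[≠] 0)
        (𝓝 (coeff m (f₁ * cH1 d))) := by
  have hd0 : d ≠ 0 := by omega
  have he : d - 1 ≠ 0 := by omega
  set A : P3 := x ^ δ₁ * y ^ δ₂ * z ^ δ₃ *
    ∏ k : Fin (d - 1), (y - C (zeta d ^ (k : ℕ)) * x) ^ δ k with hA
  have hphiA : ∀ ε : ℂ, phi1 ε A = C (ε ^ δ₃) * A := by
    intro ε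
    simp only [hA, map_mul, map_prod, map_sub, map_pow, phi1_x, phi1_y, phi1_z, phi1_C]
    ring
  clear_value A
  obtain ⟨B, hB⟩ : ∃ B : MvPolynomial (Fin 3) ℂ[X], B = map Polynomial.C A *
    ∏ j : Fin n, perturb (d - 1) (Rpoly d (lam j)) ((y * z) ^ (d - 1)) := ⟨_, rfl⟩
  have hphiF : ∀ ε : ℂ, ε ≠ 0 →
      phi1 ε (F₁ ε) = C (ε ^ δ₃) * map (Polynomial.evalRingHom ε) B := by
    intro ε hε
    rw [hF₁, hB, map_mul, map_mul, hphiA, map_eval_map_C, map_prod, map_prod]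
    simp only [phi1_Ppoly _ _ hε, map_eval_perturb, mul_assoc]
  have hB0 : map (Polynomial.evalRingHom 0) B = f₁ := by
    rw [hB, map_mul, map_eval_map_C, map_prod, hf₁]
    simp only [map_eval_zero_perturb he]
  have key : ∀ (p q : P3) (f : ℂ → P3),
      (∀ ε, ε ≠ 0 → f ε = C ε * (phi1 ε (F₁ ε) * (p - C (ε ^ (d - 1)) * q))) →
      ∀ m, Tendsto (fun ε : ℂ => (ε ^ (δ₃ + 1))⁻¹ * coeff m (f ε)) (𝓝[≠] 0)
        (𝓝 (coeff m (f₁ * p))) := by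
    intro p q f hf m
    have h := tendsto_coeff_of_eq_pow_mul (B * perturb (d - 1) p q) (δ₃ + 1) f
      (fun ε hε => by
        rw [hf ε hε, hphiF ε hε, map_mul (MvPolynomial.map _), map_eval_perturb, pow_succ, C_mul]
        ring) m
    rwa [map_mul, hB0, map_eval_zero_perturb he] at h
  refine fun m => ⟨key _ (y * z ^ d) _ (fun ε _ => ?_) m, key _ (-(x * z ^ d)) _ (fun ε _ => ?_) m,
    key _ 0 _ (fun ε _ => ?_) m⟩
  · rw [hcomp₁, map_mul, phi1_aF hd0, mul_left_comm]
  · rw [hcomp₂, map_mul, phi1_bF hd0, mul_left_comm]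
  · rw [hcomp₃, map_mul, phi1_cF, mul_zero, sub_zero]

end Stmt10
end
end

section
/- Let d ≥ 2, n ∈ ℕ, δ₁, δ₂ ∈ {0,1}, and let μ₁, …, μ_n ∈ ℂ be pairwise distinct. Set Q_λ = yᵈ − x^{d-1}(y+λz), S_μ = xᵈ + (d−1)y^{d-1}(z+μx), f̄₁ = x^{δ₁}y^{δ₂}·∏_{j=1}^{n}S_{μ_j}, and for ε ∈ ℂ* set F̄₁^ε = x^{δ₂}y^{δ₁}·∏_{j=1}^{n}Q_{τ_j(ε)} with τ_j(ε) = −((d−1)μ_j·ε^{d-1} + 1)·ε. Let φ̄₁ be the polynomial map (x,y,z) ↦ (y, εx, x + (d−1)ε^{d-1}z). Then for every monomial xⁱyʲzᵏ, the function ε ↦ ε^{−(δ₁+(n+1)d)}·(coefficient of xⁱyʲzᵏ in each of the three components of φ̄₁*(F̄₁^ε·Ω(H₀ᵈ))) tends, as ε → 0, to the corresponding coefficient of the 1-form (1−d)·f̄₁·Ω(F₁ᵈ). -/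
open MvPolynomial Filter Topology

noncomputable section

namespace Stmt11

abbrev P3 : Type := MvPolynomial (Fin 3) ℂ

def x : P3 := X 0
def y : P3 := X 1
def z : P3 := X 2

/-- Coefficients of `Ω(H₀ᵈ)`. -/
def aH0 (d : ℕ) : P3 := C (1 - (d : ℂ)) * (y ^ d * z)
def bH0 (d : ℕ) : P3 := -(x ^ d * z) + C (d : ℂ) * (x * z * y ^ (d - 1))
def cH0 (d : ℕ) : P3 := x ^ d * y - x * y ^ d

/-- Coefficients of `Ω(F₁ᵈ)`. -/
def aF1 (d : ℕ) : P3 := y ^ d * z - x ^ d * y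
def bF1 (d : ℕ) : P3 := x ^ (d + 1)
def cF1 (d : ℕ) : P3 := -(x * y ^ d)

/-- `Q_λ = yᵈ − x^{d-1}(y + λz)`. -/
def Qpoly (d : ℕ) (lam : ℂ) : P3 := y ^ d - x ^ (d - 1) * (y + C lam * z)

/-- `S_μ = xᵈ + (d−1)y^{d-1}(z + μx)`. -/
def Spoly (d : ℕ) (mu : ℂ) : P3 :=
  x ^ d + C ((d : ℂ) - 1) * y ^ (d - 1) * (z + C mu * x)

/-- Substitution by the polynomial map `φ̄₁ : (x,y,z) ↦ (y, εx, x + (d−1)ε^{d-1}z)`. -/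
def phibar1 (d : ℕ) (ε : ℂ) : P3 →ₐ[ℂ] P3 :=
  aeval ![y, C ε * x, x + C (((d : ℂ) - 1) * ε ^ (d - 1)) * z]

/-- A family of polynomials all of whose coefficients depend continuously on the parameter. -/
def CoeffContinuous (P : ℂ → P3) : Prop := ∀ m, Continuous fun ε => coeff m (P ε)

namespace CoeffContinuous

lemma const (p : P3) : CoeffContinuous fun _ => p := fun _ => continuous_const

lemma add {P Q : ℂ → P3} (hP : CoeffContinuous P) (hQ : CoeffContinuous Q) :
    CoeffContinuous fun ε => P ε + Q ε := fun m => by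
  simp only [coeff_add]
  exact (hP m).add (hQ m)

lemma mul {P Q : ℂ → P3} (hP : CoeffContinuous P) (hQ : CoeffContinuous Q) :
    CoeffContinuous fun ε => P ε * Q ε := fun m => by
  simp only [coeff_mul]
  exact continuous_finsetSum _ fun i _ => (hP i.1).mul (hQ i.2)

lemma C_comp {f : ℂ → ℂ} (hf : Continuous f) : CoeffContinuous fun ε => C (f ε) := fun m => by
  simp only [coeff_C]
  split_ifs
  exacts [hf, continuous_const]

lemma prod {ι : Type*} (s : Finset ι) {P : ι → ℂ → P3} (hP : ∀ i, CoeffContinuous (P i)) :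
    CoeffContinuous fun ε => ∏ i ∈ s, P i ε := by
  classical
  induction s using Finset.induction_on with
  | empty => simpa using const 1
  | insert i s hi ih =>
    simp only [Finset.prod_insert hi]
    exact (hP i).mul ih

/-- If `A ε = ε ^ N • P ε` with `P` coefficientwise continuous, then the coefficients of
`ε ^ (-N) • A ε` tend to those of `P 0` as `ε → 0`. -/
lemma tendsto_coeff {P A : ℂ → P3} (hP : CoeffContinuous P) {N : ℕ}
    (hA : ∀ ε, A ε = C (ε ^ N) * P ε) {p : P3} (hp : P 0 = p) (m : Fin 3 →₀ ℕ) :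
    Tendsto (fun ε : ℂ => (ε ^ N)⁻¹ * coeff m (A ε)) (𝓝[≠] 0) (𝓝 (coeff m p)) := by
  subst hp
  refine (((hP m).tendsto 0).mono_left nhdsWithin_le_nhds).congr' ?_
  filter_upwards [self_mem_nhdsWithin] with ε hε
  rw [hA, coeff_C_mul, inv_mul_cancel_left₀ (pow_ne_zero N hε)]

end CoeffContinuous

@[simp] lemma phibar1_x (d : ℕ) (ε : ℂ) : phibar1 d ε x = y := by simp [phibar1, x]

@[simp] lemma phibar1_y (d : ℕ) (ε : ℂ) : phibar1 d ε y = C ε * x := by simp [phibar1, y]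

@[simp] lemma phibar1_z (d : ℕ) (ε : ℂ) :
    phibar1 d ε z = x + C (((d : ℂ) - 1) * ε ^ (d - 1)) * z := by simp [phibar1, z]

@[simp] lemma phibar1_C (d : ℕ) (ε a : ℂ) : phibar1 d ε (C a) = C a :=
  (phibar1 d ε).commutes a

/-- The perturbation of `S_μ` obtained from `φ̄₁*Q_τ` after division by `εᵈ`. -/
def SpolyPert (d : ℕ) (mu ε : ℂ) : P3 :=
  Spoly d mu + C (ε ^ (d - 1)) * (C (((d : ℂ) - 1) ^ 2 * mu) * y ^ (d - 1) * z)

lemma phibar1_Qpoly {d : ℕ} (hd : 1 ≤ d) (mu ε : ℂ) :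
    phibar1 d ε (Qpoly d (-((((d : ℂ) - 1) * mu * ε ^ (d - 1) + 1) * ε))) =
      C (ε ^ d) * SpolyPert d mu ε := by
  obtain ⟨k, rfl⟩ := Nat.exists_eq_add_of_le' hd
  simp [Qpoly, SpolyPert, Spoly]
  ring

/-- The perturbation of `f̄₁` obtained from `φ̄₁*F̄₁^ε` after division by `ε^(δ₁+nd)`. -/
def fPert {n : ℕ} (d δ₁ δ₂ : ℕ) (mu : Fin n → ℂ) (ε : ℂ) : P3 :=
  x ^ δ₁ * y ^ δ₂ * ∏ j, SpolyPert d (mu j) ε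

lemma coeffContinuous_fPert {n : ℕ} (d δ₁ δ₂ : ℕ) (mu : Fin n → ℂ) :
    CoeffContinuous (fPert d δ₁ δ₂ mu) :=
  (CoeffContinuous.const _).mul <| .prod _ fun _ =>
    (CoeffContinuous.const _).add <|
      (CoeffContinuous.C_comp (continuous_pow _)).mul (.const _)

lemma fPert_zero {n d : ℕ} (hd : 2 ≤ d) (δ₁ δ₂ : ℕ) (mu : Fin n → ℂ) :
    fPert d δ₁ δ₂ mu 0 = x ^ δ₁ * y ^ δ₂ * ∏ j, Spoly d (mu j) := by
  simp [fPert, SpolyPert, show d - 1 ≠ 0 by omega]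

lemma phibar1_F {n d : ℕ} (hd : 1 ≤ d) (δ₁ δ₂ : ℕ) (mu : Fin n → ℂ) (ε : ℂ) :
    phibar1 d ε (x ^ δ₂ * y ^ δ₁ *
      ∏ j : Fin n, Qpoly d (-((((d : ℂ) - 1) * mu j * ε ^ (d - 1) + 1) * ε))) =
      C (ε ^ (δ₁ + n * d)) * fPert d δ₁ δ₂ mu ε := by
  simp only [map_mul, map_prod, phibar1_Qpoly hd, Finset.prod_mul_distrib, fPert]
  simp
  ring

theorem degeneration_to_F1 (d n : ℕ) (hd : 2 ≤ d)
    (δ₁ δ₂ : ℕ) (hδ₁ : δ₁ ≤ 1) (hδ₂ : δ₂ ≤ 1)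
    (mu : Fin n → ℂ) (hinj : Function.Injective mu)
    -- `f̄₁ = x^{δ₁}y^{δ₂}·∏ⱼ S_{μⱼ}`
    (fbar₁ : P3)
    (hfbar₁ : fbar₁ = x ^ δ₁ * y ^ δ₂ * ∏ j : Fin n, Spoly d (mu j))
    -- `F̄₁^ε = x^{δ₂}y^{δ₁}·∏ⱼ Q_{τⱼ(ε)}`, `τⱼ(ε) = −((d−1)μⱼε^{d-1} + 1)·ε`
    (Fbar₁ : ℂ → P3)
    (hFbar₁ : ∀ ε : ℂ, Fbar₁ ε = x ^ δ₂ * y ^ δ₁ *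
      ∏ j : Fin n, Qpoly d (-((((d : ℂ) - 1) * mu j * ε ^ (d - 1) + 1) * ε)))
    -- components in `dx`, `dy`, `dz` of the pullback `φ̄₁*(F̄₁^ε·Ω(H₀ᵈ))`,
    -- using `φ̄₁*dx = dy`, `φ̄₁*dy = ε·dx`, `φ̄₁*dz = dx + (d−1)ε^{d-1}·dz`
    (comp₁ comp₂ comp₃ : ℂ → P3)
    (hcomp₁ : ∀ ε : ℂ, comp₁ ε =
      C ε * phibar1 d ε (Fbar₁ ε * bH0 d) + phibar1 d ε (Fbar₁ ε * cH0 d))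
    (hcomp₂ : ∀ ε : ℂ, comp₂ ε = phibar1 d ε (Fbar₁ ε * aH0 d))
    (hcomp₃ : ∀ ε : ℂ, comp₃ ε =
      C (((d : ℂ) - 1) * ε ^ (d - 1)) * phibar1 d ε (Fbar₁ ε * cH0 d)) :
    -- after multiplying by `ε^{−(δ₁+(n+1)d)}`, every coefficient tends to the
    -- corresponding coefficient of `(1−d)·f̄₁·Ω(F₁ᵈ)` as `ε → 0`
    ∀ m : Fin 3 →₀ ℕ,
      Tendsto (fun ε : ℂ => (ε ^ (δ₁ + (n + 1) * d))⁻¹ * coeff m (comp₁ ε)) (𝓝[≠] 0)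
        (𝓝 (coeff m (C (1 - (d : ℂ)) * fbar₁ * aF1 d))) ∧
      Tendsto (fun ε : ℂ => (ε ^ (δ₁ + (n + 1) * d))⁻¹ * coeff m (comp₂ ε)) (𝓝[≠] 0)
        (𝓝 (coeff m (C (1 - (d : ℂ)) * fbar₁ * bF1 d))) ∧
      Tendsto (fun ε : ℂ => (ε ^ (δ₁ + (n + 1) * d))⁻¹ * coeff m (comp₃ ε)) (𝓝[≠] 0)
        (𝓝 (coeff m (C (1 - (d : ℂ)) * fbar₁ * cF1 d))) := by
  have hd1 : 1 ≤ d := by omega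
  have hz : d - 1 ≠ 0 := by omega
  have hG := coeffContinuous_fPert d δ₁ δ₂ mu
  have hG0 := fPert_zero hd δ₁ δ₂ mu
  have hφ : ∀ ε, phibar1 d ε (Fbar₁ ε) = C (ε ^ (δ₁ + n * d)) * fPert d δ₁ δ₂ mu ε :=
    fun ε => by rw [hFbar₁, phibar1_F hd1]
  have key (p q : P3) (r : ℕ) : CoeffContinuous fun ε =>
      fPert d δ₁ δ₂ mu ε * (p + C (ε ^ r) * q) :=
    hG.mul <| (CoeffContinuous.const _).add <|
      (CoeffContinuous.C_comp (continuous_pow _)).mul (.const _)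
  intro m
  refine ⟨(key (C (1 - (d : ℂ)) * aF1 d)
      (C (d * ((d : ℂ) - 1)) * x ^ (d - 1) * y * z) (d - 1)).tendsto_coeff ?_ ?_ m,
    (key (C (1 - (d : ℂ)) * bF1 d)
      (C (1 - (d : ℂ)) * C ((d : ℂ) - 1) * x ^ d * z) (d - 1)).tendsto_coeff ?_ ?_ m,
    (key (C (1 - (d : ℂ)) * cF1 d)
      (C (1 - (d : ℂ)) * x ^ d * y) (d - 1)).tendsto_coeff ?_ ?_ m⟩
  · intro ε
    rw [hcomp₁, map_mul, map_mul, hφ]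
    obtain ⟨k, rfl⟩ := Nat.exists_eq_add_of_le' hd1
    simp [aF1, bH0, cH0]
    ring
  · simp only [hG0, hfbar₁, zero_pow hz, map_zero]
    ring
  · intro ε
    rw [hcomp₂, map_mul, hφ]
    obtain ⟨k, rfl⟩ := Nat.exists_eq_add_of_le' hd1
    simp [bF1, aH0]
    ring
  · simp only [hG0, hfbar₁, zero_pow hz, map_zero]
    ring
  · intro ε
    rw [hcomp₃, map_mul (phibar1 d ε), hφ]
    obtain ⟨k, rfl⟩ := Nat.exists_eq_add_of_le' hd1
    simp [cF1, cH0]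
    ring
  · simp only [hG0, hfbar₁, zero_pow hz, map_zero]
    ring

end Stmt11
end
end

section
/- For every (λ, μ) ∈ ℂ², the cubic curve of equation C_{λ,μ}(x,y,z) = μ(x³+y³+z³) − 3λxyz = 0 is invariant by the degree-4 Hesse pencil foliation F_H⁴: the polynomial C_{λ,μ} divides each of the three polynomials a·∂yC_{λ,μ} − b·∂xC_{λ,μ}, a·∂zC_{λ,μ} − c·∂xC_{λ,μ} and b·∂zC_{λ,μ} − c·∂yC_{λ,μ}, where a = yz(2x³−y³−z³), b = xz(2y³−x³−z³), c = xy(2z³−x³−y³). -/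
open MvPolynomial

noncomputable section

namespace Stmt13

abbrev P3 : Type := MvPolynomial (Fin 3) ℂ

def x : P3 := X 0
def y : P3 := X 1
def z : P3 := X 2

def Dx : P3 → P3 := pderiv (0 : Fin 3)
def Dy : P3 → P3 := pderiv (1 : Fin 3)
def Dz : P3 → P3 := pderiv (2 : Fin 3)

/-- `P` defines an invariant curve of the 1-form `a·dx + b·dy + c·dz`. -/
def IsInvariant (a b c P : P3) : Prop :=
  P ∣ (a * Dy P - b * Dx P) ∧ P ∣ (a * Dz P - c * Dx P) ∧ P ∣ (b * Dz P - c * Dy P)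

theorem C_three_mul (lam : ℂ) : (C (3 * lam) : P3) = 3 * C lam := by
  rw [C_mul]; rfl

theorem Dx_hesse_cubic (lam mu : ℂ) :
    Dx (C mu * (x ^ 3 + y ^ 3 + z ^ 3) - C (3 * lam) * (x * y * z)) =
      3 * C mu * x ^ 2 - 3 * C lam * (y * z) := by
  simp only [Dx, x, y, z, map_sub, map_add, Derivation.leibniz, Derivation.leibniz_pow, pderiv_C]
  simp [pderiv_X, -C_mul, -map_mul]
  rw [C_three_mul]
  ring

theorem Dy_hesse_cubic (lam mu : ℂ) :
    Dy (C mu * (x ^ 3 + y ^ 3 + z ^ 3) - C (3 * lam) * (x * y * z)) =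
      3 * C mu * y ^ 2 - 3 * C lam * (x * z) := by
  simp only [Dy, x, y, z, map_sub, map_add, Derivation.leibniz, Derivation.leibniz_pow, pderiv_C]
  simp [pderiv_X, -C_mul, -map_mul]
  rw [C_three_mul]
  ring

theorem Dz_hesse_cubic (lam mu : ℂ) :
    Dz (C mu * (x ^ 3 + y ^ 3 + z ^ 3) - C (3 * lam) * (x * y * z)) =
      3 * C mu * z ^ 2 - 3 * C lam * (x * y) := by
  simp only [Dz, x, y, z, map_sub, map_add, Derivation.leibniz, Derivation.leibniz_pow, pderiv_C]
  simp [pderiv_X, -C_mul, -map_mul]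
  rw [C_three_mul]
  ring

/-- For every `(λ, μ) ∈ ℂ²`, the cubic `C_{λ,μ} = μ(x³+y³+z³) − 3λxyz = 0` is invariant
by the degree-4 Hesse pencil foliation `F_H⁴`. -/
theorem hesse4_invariant_cubics (lam mu : ℂ) :
    IsInvariant
      (y * z * (2 * x ^ 3 - y ^ 3 - z ^ 3))
      (x * z * (2 * y ^ 3 - x ^ 3 - z ^ 3))
      (x * y * (2 * z ^ 3 - x ^ 3 - y ^ 3))
      (C mu * (x ^ 3 + y ^ 3 + z ^ 3) - C (3 * lam) * (x * y * z)) := by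
  unfold IsInvariant
  rw [Dx_hesse_cubic, Dy_hesse_cubic, Dz_hesse_cubic, C_three_mul]
  refine ⟨⟨3 * z * (x ^ 3 - y ^ 3), ?_⟩, ⟨3 * y * (x ^ 3 - z ^ 3), ?_⟩,
    ⟨3 * x * (y ^ 3 - z ^ 3), ?_⟩⟩ <;> ring

end Stmt13
end
end

section
/- A nonzero linear form L = u·x + v·y + w·z ∈ ℂ[x,y,z] defines an invariant line of the degree-4 Hesse pencil foliation F_H⁴ if and only if L is a nonzero scalar multiple of one of the following 12 linear forms (with j = exp(2πi/3)): x, y, z, x+y+z, j²x+jy+z, jx+j²y+z, jx+y+z, x+jy+z, x+y+jz, j²x+y+z, x+j²y+z, x+y+j²z. In particular F_H⁴ has exactly 12 = 3·4 distinct invariant lines. -/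
open MvPolynomial

noncomputable section

namespace Stmt14

abbrev P3 : Type := MvPolynomial (Fin 3) ℂ

def x : P3 := X 0
def y : P3 := X 1
def z : P3 := X 2

def Dx : P3 → P3 := pderiv (0 : Fin 3)
def Dy : P3 → P3 := pderiv (1 : Fin 3)
def Dz : P3 → P3 := pderiv (2 : Fin 3)

/-- `P` defines an invariant curve of the 1-form `a·dx + b·dy + c·dz`. -/
def IsInvariant (a b c P : P3) : Prop :=
  P ∣ (a * Dy P - b * Dx P) ∧ P ∣ (a * Dz P - c * Dx P) ∧ P ∣ (b * Dz P - c * Dy P)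

/-- Coefficients of the Hesse 1-form `Ω_H⁴`. -/
def aH : P3 := y * z * (2 * x ^ 3 - y ^ 3 - z ^ 3)
def bH : P3 := x * z * (2 * y ^ 3 - x ^ 3 - z ^ 3)
def cH : P3 := x * y * (2 * z ^ 3 - x ^ 3 - y ^ 3)

/-- `j = exp(2πi/3)`. -/
def j : ℂ := Complex.exp (2 * (Real.pi : ℂ) * Complex.I / 3)

/-- The 12 invariant lines of `F_H⁴`. -/
def hesseLines : List P3 :=
  [x, y, z,
   x + y + z, C (j ^ 2) * x + C j * y + z, C j * x + C (j ^ 2) * y + z,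
   C j * x + y + z, x + C j * y + z, x + y + C j * z,
   C (j ^ 2) * x + y + z, x + C (j ^ 2) * y + z, x + y + C (j ^ 2) * z]

theorem j_primitive : IsPrimitiveRoot j 3 := by
  simpa [j] using Complex.isPrimitiveRoot_exp 3 (by norm_num)

theorem one_add_j_add_j_sq : 1 + j + j ^ 2 = 0 := by
  have h := j_primitive.geom_sum_eq_zero (by norm_num)
  simpa [Finset.sum_range_succ] using h

theorem pow_three_eq_one_iff {a : ℂ} : a ^ 3 = 1 ↔ a = 1 ∨ a = j ∨ a = j ^ 2 := by
  have hj := one_add_j_add_j_sq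
  have hfac : a ^ 3 - 1 = (a - 1) * ((a - j) * (a - j ^ 2)) := by
    linear_combination (a - 1) * (a - j + 1) * hj
  rw [← sub_eq_zero, hfac]
  simp [sub_eq_zero]

/-- The linear form with coefficient vector `(p.1, p.2.1, p.2.2)`. -/
def linForm (p : ℂ × ℂ × ℂ) : P3 := C p.1 * x + C p.2.1 * y + C p.2.2 * z

theorem linForm_smul (t : ℂ) (p : ℂ × ℂ × ℂ) : linForm (t • p) = C t * linForm p := by
  simp only [linForm, Prod.smul_fst, Prod.smul_snd, smul_eq_mul, C_mul]
  ring

theorem linForm_injective : Function.Injective linForm := by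
  rintro ⟨u, v, w⟩ ⟨u', v', w'⟩ h
  have h0 := congrArg (eval ![1, 0, 0]) h
  have h1 := congrArg (eval ![0, 1, 0]) h
  have h2 := congrArg (eval ![0, 0, 1]) h
  simp [linForm, x, y, z] at h0 h1 h2
  simp [h0, h1, h2]

theorem linForm_ne_zero {p : ℂ × ℂ × ℂ} (hp : p ≠ 0) : linForm p ≠ 0 := by
  intro h
  exact hp (linForm_injective (h.trans (by simp [linForm])))

theorem Dx_linForm (p : ℂ × ℂ × ℂ) : Dx (linForm p) = C p.1 := by
  simp [Dx, linForm, x, y, z, pderiv_X]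

theorem Dy_linForm (p : ℂ × ℂ × ℂ) : Dy (linForm p) = C p.2.1 := by
  simp [Dy, linForm, x, y, z, pderiv_X]

theorem Dz_linForm (p : ℂ × ℂ × ℂ) : Dz (linForm p) = C p.2.2 := by
  simp [Dz, linForm, x, y, z, pderiv_X]

theorem isInvariant_linForm_smul {a b c : P3} (t : ℂ) {p : ℂ × ℂ × ℂ}
    (h : IsInvariant a b c (linForm p)) : IsInvariant a b c (linForm (t • p)) := by
  simp only [IsInvariant, Dx_linForm, Dy_linForm, Dz_linForm] at h ⊢
  simp only [linForm_smul, Prod.smul_fst, Prod.smul_snd, smul_eq_mul, C_mul,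
    mul_left_comm _ (C t), ← mul_sub]
  exact ⟨mul_dvd_mul_left _ h.1, mul_dvd_mul_left _ h.2.1, mul_dvd_mul_left _ h.2.2⟩

/-- The normalized coefficient vectors of the invariant lines of `F_H⁴`. -/
def hesseCoeffs : Finset (ℂ × ℂ × ℂ) :=
  {(1, 0, 0), (0, 1, 0), (0, 0, 1)} ∪
    Polynomial.nthRootsFinset 3 (1 : ℂ) ×ˢ Polynomial.nthRootsFinset 3 (1 : ℂ) ×ˢ {1}

theorem mem_hesseCoeffs {p : ℂ × ℂ × ℂ} :
    p ∈ hesseCoeffs ↔ p = (1, 0, 0) ∨ p = (0, 1, 0) ∨ p = (0, 0, 1) ∨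
      (p.1 ^ 3 = 1 ∧ p.2.1 ^ 3 = 1 ∧ p.2.2 = 1) := by
  obtain ⟨a, b, c⟩ := p
  simp only [hesseCoeffs, Finset.mem_union, Finset.mem_insert, Finset.mem_singleton,
    Finset.mem_product, Polynomial.mem_nthRootsFinset (by norm_num : 0 < 3), or_assoc]

theorem ne_zero_of_mem_hesseCoeffs {p : ℂ × ℂ × ℂ} (hp : p ∈ hesseCoeffs) : p ≠ 0 := by
  rintro rfl
  simp [mem_hesseCoeffs, Prod.ext_iff] at hp

theorem card_hesseCoeffs : hesseCoeffs.card = 12 := by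
  rw [hesseCoeffs, Finset.card_union_of_disjoint]
  · simp [j_primitive.card_nthRootsFinset]
  · simp [Finset.disjoint_left, Polynomial.mem_nthRootsFinset]

theorem eq_of_smul_eq_of_mem_hesseCoeffs {t : ℂ} {p q : ℂ × ℂ × ℂ}
    (hp : p ∈ hesseCoeffs) (hq : q ∈ hesseCoeffs) (h : t • p = q) : p = q := by
  obtain ⟨a, b, c⟩ := p
  obtain ⟨a', b', c'⟩ := q
  simp only [Prod.smul_mk, smul_eq_mul, Prod.mk.injEq] at h
  obtain ⟨rfl, rfl, rfl⟩ := h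
  simp only [mem_hesseCoeffs, Prod.mk.injEq] at hp hq
  rcases hp with ⟨rfl, rfl, rfl⟩ | ⟨rfl, rfl, rfl⟩ | ⟨rfl, rfl, rfl⟩ | ⟨ha, hb, rfl⟩
  · simp at hq; simp [hq]
  · simp at hq; simp [hq]
  · simp at hq; simp [hq]
  · have ha0 : a ≠ 0 := by rintro rfl; norm_num at ha
    have hb0 : b ≠ 0 := by rintro rfl; norm_num at hb
    have ht : t = 1 := by
      rcases hq with ⟨h1, h2, h3⟩ | ⟨h1, h2, h3⟩ | ⟨h1, h2, h3⟩ | ⟨-, -, h3⟩ <;> simp_all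
    simp [ht]

theorem isInvariant_of_mem_hesseCoeffs {p : ℂ × ℂ × ℂ} (hp : p ∈ hesseCoeffs) :
    IsInvariant aH bH cH (linForm p) := by
  simp only [IsInvariant, Dx_linForm, Dy_linForm, Dz_linForm]
  rcases mem_hesseCoeffs.1 hp with rfl | rfl | rfl | ⟨ha, hb, hc⟩
  · simp [linForm, bH, cH, mul_assoc]
  · simp [linForm, aH, cH, mul_assoc, mul_left_comm _ y]
  · simp [linForm, aH, bH, mul_assoc, mul_left_comm _ z]
  · obtain ⟨a, b, c⟩ := p
    simp only at ha hb hc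
    subst hc
    have hA : (C a : P3) ^ 3 = 1 := by rw [← C_pow, ha, C_1]
    have hB : (C b : P3) ^ 3 = 1 := by rw [← C_pow, hb, C_1]
    simp only [linForm, aH, bH, cH, C_1]
    generalize (C a : P3) = A at *
    generalize (C b : P3) = B at *
    refine ⟨⟨z * (A * x - B * y) * (z ^ 2 - z * (A * x + B * y) + (A * x + B * y) ^ 2), ?_⟩,
      ⟨y * (A * x - z) * ((B * y) ^ 2 - B * y * (A * x + z) + (A * x + z) ^ 2), ?_⟩,
      ⟨x * (B * y - z) * ((A * x) ^ 2 - A * x * (B * y + z) + (B * y + z) ^ 2), ?_⟩⟩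
    · linear_combination (-z * (A * x ^ 4 + 2 * x ^ 3 * B * y)) * hA +
        z * (B * y ^ 4 + 2 * A * x * y ^ 3) * hB
    · linear_combination (-y * (2 * z * x ^ 3 + A * x ^ 4)) * hA -
        y * (A * x * y ^ 3 - z * y ^ 3) * hB
    · linear_combination (-x * (2 * z * y ^ 3 + B * y ^ 4)) * hB -
        x * (B * y * x ^ 3 - z * x ^ 3) * hA

theorem eval_eq_zero_of_isInvariant {p : ℂ × ℂ × ℂ} (h : IsInvariant aH bH cH (linForm p))
    (r s t : ℂ) (hrst : p.1 * r + p.2.1 * s + p.2.2 * t = 0) :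
    s * t * (2 * r ^ 3 - s ^ 3 - t ^ 3) * p.2.1 - r * t * (2 * s ^ 3 - r ^ 3 - t ^ 3) * p.1 = 0 ∧
    s * t * (2 * r ^ 3 - s ^ 3 - t ^ 3) * p.2.2 - r * s * (2 * t ^ 3 - r ^ 3 - s ^ 3) * p.1 = 0 ∧
    r * t * (2 * s ^ 3 - r ^ 3 - t ^ 3) * p.2.2 -
      r * s * (2 * t ^ 3 - r ^ 3 - s ^ 3) * p.2.1 = 0 := by
  simp only [IsInvariant, Dx_linForm, Dy_linForm, Dz_linForm] at h
  have hL : eval ![r, s, t] (linForm p) = 0 := by simpa [linForm, x, y, z] using hrst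
  have key {Q : P3} (hQ : linForm p ∣ Q) : eval ![r, s, t] Q = 0 := by
    obtain ⟨R, rfl⟩ := hQ
    rw [map_mul, hL, zero_mul]
  simpa [aH, bH, cH, x, y, z] using And.intro (key h.1) (And.intro (key h.2.1) (key h.2.2))

theorem mem_hesseCoeffs_of_isInvariant {a b : ℂ}
    (h : IsInvariant aH bH cH (linForm (a, b, 1))) : (a, b, (1 : ℂ)) ∈ hesseCoeffs := by
  have e1 := (eval_eq_zero_of_isInvariant h 0 1 (-b) (by ring)).1
  have e2 := (eval_eq_zero_of_isInvariant h 1 0 (-a) (by ring)).1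
  have e3 := eval_eq_zero_of_isInvariant h 1 1 (-a - b) (by ring)
  simp only at e1 e2 e3
  have hb : b = 0 ∨ b ^ 3 = 1 := by
    have : b ^ 2 * (b ^ 3 - 1) = 0 := by linear_combination -e1
    simpa [sub_eq_zero] using this
  have ha : a = 0 ∨ a ^ 3 = 1 := by
    have : a ^ 2 * (a ^ 3 - 1) = 0 := by linear_combination e2
    simpa [sub_eq_zero] using this
  rw [mem_hesseCoeffs]
  rcases ha with rfl | ha <;> rcases hb with rfl | hb
  · simp
  · have : b = 0 := by linear_combination e3.2.2 / 2 - b / 2 * hb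
    simp [this] at hb
  · have : a = 0 := by linear_combination e3.2.1 / 2 - a / 2 * ha
    simp [this] at ha
  · simp [ha, hb]

theorem isInvariant_linForm_iff {p : ℂ × ℂ × ℂ} (hp : p ≠ 0) :
    IsInvariant aH bH cH (linForm p) ↔ ∃ t : ℂ, t ≠ 0 ∧ ∃ q ∈ hesseCoeffs, p = t • q := by
  constructor
  · intro h
    obtain ⟨u, v, w⟩ := p
    by_cases hw : w = 0
    · subst hw
      have e1 := (eval_eq_zero_of_isInvariant h v (-u) 0 (by ring))
      have e2 := (eval_eq_zero_of_isInvariant h v (-u) 1 (by ring))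
      simp only at e1 e2
      have hu : u = 0 ∨ v = 0 := by
        have h1 : u ^ 2 * v = 0 := by linear_combination (e2.2.1 - e1.2.1) / 2
        simpa using h1
      rcases hu with rfl | rfl
      · exact ⟨v, by simpa using hp, (0, 1, 0), by simp [mem_hesseCoeffs], by simp⟩
      · exact ⟨u, by simpa using hp, (1, 0, 0), by simp [mem_hesseCoeffs], by simp⟩
    · refine ⟨w, hw, (w⁻¹ * u, w⁻¹ * v, 1), mem_hesseCoeffs_of_isInvariant ?_, ?_⟩
      · simpa [hw] using isInvariant_linForm_smul w⁻¹ h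
      · simp [hw]
  · rintro ⟨t, -, q, hq, rfl⟩
    exact isInvariant_linForm_smul t (isInvariant_of_mem_hesseCoeffs hq)

theorem exists_mem_hesseLines_iff (L : P3) :
    (∃ t : ℂ, t ≠ 0 ∧ ∃ M ∈ hesseLines, L = C t * M) ↔
      ∃ t : ℂ, t ≠ 0 ∧ ∃ q ∈ hesseCoeffs, L = linForm (t • q) := by
  have hj3 : j ^ 3 = 1 := j_primitive.pow_eq_one
  have hj0 : j ≠ 0 := j_primitive.ne_zero (by norm_num)
  have hj6 : (j ^ 2) ^ 3 = 1 := by linear_combination (j ^ 3 + 1) * hj3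
  have hJ : (C j : P3) ^ 3 = 1 := by rw [← C_pow, hj3, C_1]
  constructor
  · rintro ⟨t, ht, M, hM, rfl⟩
    suffices h : ∃ s : ℂ, s ≠ 0 ∧ ∃ q ∈ hesseCoeffs, M = linForm (s • q) by
      obtain ⟨s, hs, q, hq, rfl⟩ := h
      exact ⟨t * s, mul_ne_zero ht hs, q, hq, by rw [mul_smul, linForm_smul t]⟩
    have of_mem {N : P3} (q : ℂ × ℂ × ℂ) (hq : q ∈ hesseCoeffs) (h : N = linForm q) :
        ∃ s : ℂ, s ≠ 0 ∧ ∃ q ∈ hesseCoeffs, N = linForm (s • q) :=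
      ⟨1, one_ne_zero, q, hq, by simpa using h⟩
    simp only [hesseLines, List.mem_cons, List.not_mem_nil, or_false] at hM
    rcases hM with rfl | rfl | rfl | rfl | rfl | rfl | rfl | rfl | rfl | rfl | rfl | rfl
    · exact of_mem (1, 0, 0) (by simp [mem_hesseCoeffs]) (by simp [linForm])
    · exact of_mem (0, 1, 0) (by simp [mem_hesseCoeffs]) (by simp [linForm])
    · exact of_mem (0, 0, 1) (by simp [mem_hesseCoeffs]) (by simp [linForm])
    · exact of_mem (1, 1, 1) (by simp [mem_hesseCoeffs]) (by simp [linForm])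
    · exact of_mem (j ^ 2, j, 1) (by simp [mem_hesseCoeffs, hj3, hj6]) (by simp [linForm])
    · exact of_mem (j, j ^ 2, 1) (by simp [mem_hesseCoeffs, hj3, hj6]) (by simp [linForm])
    · exact of_mem (j, 1, 1) (by simp [mem_hesseCoeffs, hj3]) (by simp [linForm])
    · exact of_mem (1, j, 1) (by simp [mem_hesseCoeffs, hj3]) (by simp [linForm])
    · refine ⟨j, hj0, (j ^ 2, j ^ 2, 1), by simp [mem_hesseCoeffs, hj6], ?_⟩
      rw [linForm_smul]
      simp only [linForm, C_pow, C_1]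
      linear_combination (-x - y) * hJ
    · exact of_mem (j ^ 2, 1, 1) (by simp [mem_hesseCoeffs, hj6]) (by simp [linForm])
    · exact of_mem (1, j ^ 2, 1) (by simp [mem_hesseCoeffs, hj6]) (by simp [linForm])
    · refine ⟨j ^ 2, pow_ne_zero 2 hj0, (j, j, 1), by simp [mem_hesseCoeffs, hj3], ?_⟩
      rw [linForm_smul]
      simp only [linForm, C_pow, C_1]
      linear_combination (-x - y) * hJ
  · rintro ⟨t, ht, q, hq, rfl⟩
    suffices h : ∃ s : ℂ, s ≠ 0 ∧ ∃ M ∈ hesseLines, linForm q = C s * M by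
      obtain ⟨s, hs, M, hM, h⟩ := h
      exact ⟨t * s, mul_ne_zero ht hs, M, hM, by rw [linForm_smul, h, C_mul, mul_assoc]⟩
    have of_mem {N : P3} (h : N ∈ hesseLines) : ∃ s : ℂ, s ≠ 0 ∧ ∃ M ∈ hesseLines, N = C s * M :=
      ⟨1, one_ne_zero, N, h, by simp⟩
    rcases mem_hesseCoeffs.1 hq with rfl | rfl | rfl | ⟨ha, hb, hc⟩
    · exact of_mem (by simp [linForm, hesseLines])
    · exact of_mem (by simp [linForm, hesseLines])
    · exact of_mem (by simp [linForm, hesseLines])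
    · obtain ⟨a, b, c⟩ := q
      simp only at ha hb hc
      subst hc
      rcases pow_three_eq_one_iff.1 ha with rfl | rfl | rfl <;>
        rcases pow_three_eq_one_iff.1 hb with rfl | rfl | rfl
      · exact of_mem (by simp [linForm, hesseLines])
      · exact of_mem (by simp [linForm, hesseLines])
      · exact of_mem (by simp [linForm, hesseLines])
      · exact of_mem (by simp [linForm, hesseLines])
      · refine ⟨j, hj0, x + y + C (j ^ 2) * z, by simp [hesseLines], ?_⟩
        simp only [linForm, C_pow, C_1]
        linear_combination -z * hJ
      · exact of_mem (by simp [linForm, hesseLines])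
      · exact of_mem (by simp [linForm, hesseLines])
      · exact of_mem (by simp [linForm, hesseLines])
      · refine ⟨j ^ 2, pow_ne_zero 2 hj0, x + y + C j * z, by simp [hesseLines], ?_⟩
        simp only [linForm, C_pow, C_1]
        linear_combination -z * hJ

theorem injOn_span_linForm :
    Set.InjOn (fun q => Submodule.span ℂ {linForm q}) (hesseCoeffs : Set (ℂ × ℂ × ℂ)) := by
  intro p hp q hq h
  have hmem : linForm q ∈ Submodule.span ℂ {linForm p} := by
    rw [show Submodule.span ℂ {linForm p} = Submodule.span ℂ {linForm q} from h]
    exact Submodule.mem_span_singleton_self _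
  obtain ⟨t, ht⟩ := Submodule.mem_span_singleton.1 hmem
  rw [smul_eq_C_mul, ← linForm_smul] at ht
  exact eq_of_smul_eq_of_mem_hesseCoeffs hp hq (linForm_injective ht)

theorem setOf_span_invariant_eq_image :
    {W : Submodule ℂ P3 | ∃ L : P3,
      (∃ u v w : ℂ, L = C u * x + C v * y + C w * z) ∧ L ≠ 0 ∧
      IsInvariant aH bH cH L ∧ W = Submodule.span ℂ {L}} =
    (fun q => Submodule.span ℂ {linForm q}) '' (hesseCoeffs : Set (ℂ × ℂ × ℂ)) := by
  ext W
  constructor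
  · rintro ⟨_, ⟨u, v, w, rfl⟩, hL, hinv, rfl⟩
    have hp : (u, v, w) ≠ (0 : ℂ × ℂ × ℂ) := by
      intro h
      simp only [Prod.mk_eq_zero] at h
      simp [h] at hL
    obtain ⟨t, ht, q, hq, h⟩ := (isInvariant_linForm_iff hp).1 hinv
    refine ⟨q, hq, ?_⟩
    change _ = Submodule.span ℂ {linForm (u, v, w)}
    rw [h, linForm_smul, ← smul_eq_C_mul]
    exact (Submodule.span_singleton_smul_eq (IsUnit.mk0 t ht) _).symm
  · rintro ⟨q, hq, rfl⟩
    exact ⟨linForm q, ⟨q.1, q.2.1, q.2.2, rfl⟩, linForm_ne_zero (ne_zero_of_mem_hesseCoeffs hq),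
      isInvariant_of_mem_hesseCoeffs hq, rfl⟩

/-- A nonzero linear form `L = u·x + v·y + w·z` defines an invariant line of the
degree-4 Hesse pencil foliation `F_H⁴` iff it is a nonzero scalar multiple of one of
the 12 listed linear forms; and `F_H⁴` has exactly `12 = 3·4` distinct invariant
lines. -/
theorem hesse4_invariant_lines :
    (∀ u v w : ℂ, C u * x + C v * y + C w * z ≠ 0 →
      (IsInvariant aH bH cH (C u * x + C v * y + C w * z) ↔
        ∃ t : ℂ, t ≠ 0 ∧ ∃ M ∈ hesseLines, C u * x + C v * y + C w * z = C t * M)) ∧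
    Set.ncard {W : Submodule ℂ P3 | ∃ L : P3,
      (∃ u v w : ℂ, L = C u * x + C v * y + C w * z) ∧ L ≠ 0 ∧
      IsInvariant aH bH cH L ∧ W = Submodule.span ℂ {L}} = 12 := by
  constructor
  · intro u v w hL
    have hp : (u, v, w) ≠ (0 : ℂ × ℂ × ℂ) := by
      intro h
      simp only [Prod.mk_eq_zero] at h
      simp [h] at hL
    refine (isInvariant_linForm_iff hp).trans (Iff.trans ?_ (exists_mem_hesseLines_iff _).symm)
    exact exists_congr fun t => and_congr_right fun _ => exists_congr fun q =>
      and_congr_right fun _ => linForm_injective.eq_iff.symm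
  · rw [setOf_span_invariant_eq_image, injOn_span_linForm.ncard_image, Set.ncard_coe_finset,
      card_hesseCoeffs]

end Stmt14
end
end

section
/- Let j = exp(2πi/3), let P = 248x⁶y⁶z⁶(x⁶+y⁶+z⁶) − 154x⁶y⁶z⁶(x³y³+x³z³+y³z³) − 52x³y³z³(x¹²y³+x¹²z³+x³y¹²+x³z¹²+y¹²z³+y³z¹²) + 14x³y³z³(x¹⁵+y¹⁵+z¹⁵) − 10x³y³z³(x⁹y⁶+x⁹z⁶+x⁶y⁹+x⁶z⁹+y⁹z⁶+y⁶z⁹) + 6(x¹²y¹²+x¹²z¹²+y¹²z¹²) + 4(x¹⁵y⁹+x¹⁵z⁹+x⁹y¹⁵+x⁹z¹⁵+y¹⁵z⁹+y⁹z¹⁵) + x¹⁸y⁶+x¹⁸z⁶+x⁶y¹⁸+x⁶z¹⁸+y¹⁸z⁶+y⁶z¹⁸, and let Q = xyz(x³−y³)(y³−z³)(z³−x³)(x³+y³+z³−3xyz)(x³+y³+z³−3jxyz)(x³+y³+z³−3j²xyz). Then the rational function P³/((x³−y³)(y³−z³)(z³−x³)Q³) is a rational first integral of the degree-7 Hesse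 foliation F_H⁷: with P̃ = P³ and Q̃ = (x³−y³)(y³−z³)(z³−x³)Q³, and a, b, c the coefficients of Ω_H⁷, the three polynomials a·(Q̃·∂yP̃ − P̃·∂yQ̃) − b·(Q̃·∂xP̃ − P̃·∂xQ̃), a·(Q̃·∂zP̃ − P̃·∂zQ̃) − c·(Q̃·∂xP̃ − P̃·∂xQ̃) and b·(Q̃·∂zP̃ − P̃·∂zQ̃) − c·(Q̃·∂yP̃ − P̃·∂yQ̃) vanish identically in ℂ[x,y,z]. -/
open MvPolynomial

noncomputable section

namespace Stmt15

abbrev P3 : Type := MvPolynomial (Fin 3) ℂ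

def x : P3 := X 0
def y : P3 := X 1
def z : P3 := X 2

def Dx : P3 → P3 := pderiv (0 : Fin 3)
def Dy : P3 → P3 := pderiv (1 : Fin 3)
def Dz : P3 → P3 := pderiv (2 : Fin 3)

/-- The pair `(P, Q)` gives a rational first integral `P/Q` of the 1-form
`a·dx + b·dy + c·dz`. -/
def IsRatFirstIntegral (a b c P Q : P3) : Prop :=
  a * (Q * Dy P - P * Dy Q) - b * (Q * Dx P - P * Dx Q) = 0 ∧
  a * (Q * Dz P - P * Dz Q) - c * (Q * Dx P - P * Dx Q) = 0 ∧
  b * (Q * Dz P - P * Dz Q) - c * (Q * Dy P - P * Dy Q) = 0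

/-- `j = exp(2πi/3)`. -/
def j : ℂ := Complex.exp (2 * (Real.pi : ℂ) * Complex.I / 3)

/-- Coefficients of the degree-7 Hesse 1-form `Ω_H⁷`. -/
def a7 : P3 := y * z * (y ^ 3 - z ^ 3) * (7 * x ^ 3 + y ^ 3 + z ^ 3)
def b7 : P3 := x * z * (z ^ 3 - x ^ 3) * (x ^ 3 + 7 * y ^ 3 + z ^ 3)
def c7 : P3 := x * y * (x ^ 3 - y ^ 3) * (x ^ 3 + y ^ 3 + 7 * z ^ 3)

/-- The degree-24 polynomial `P`. -/
def Pbig : P3 :=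
  248 * (x ^ 6 * y ^ 6 * z ^ 6) * (x ^ 6 + y ^ 6 + z ^ 6)
  - 154 * (x ^ 6 * y ^ 6 * z ^ 6) * (x ^ 3 * y ^ 3 + x ^ 3 * z ^ 3 + y ^ 3 * z ^ 3)
  - 52 * (x ^ 3 * y ^ 3 * z ^ 3) *
      (x ^ 12 * y ^ 3 + x ^ 12 * z ^ 3 + x ^ 3 * y ^ 12 + x ^ 3 * z ^ 12
        + y ^ 12 * z ^ 3 + y ^ 3 * z ^ 12)
  + 14 * (x ^ 3 * y ^ 3 * z ^ 3) * (x ^ 15 + y ^ 15 + z ^ 15)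
  - 10 * (x ^ 3 * y ^ 3 * z ^ 3) *
      (x ^ 9 * y ^ 6 + x ^ 9 * z ^ 6 + x ^ 6 * y ^ 9 + x ^ 6 * z ^ 9
        + y ^ 9 * z ^ 6 + y ^ 6 * z ^ 9)
  + 6 * (x ^ 12 * y ^ 12 + x ^ 12 * z ^ 12 + y ^ 12 * z ^ 12)
  + 4 * (x ^ 15 * y ^ 9 + x ^ 15 * z ^ 9 + x ^ 9 * y ^ 15 + x ^ 9 * z ^ 15
        + y ^ 15 * z ^ 9 + y ^ 9 * z ^ 15)
  + x ^ 18 * y ^ 6 + x ^ 18 * z ^ 6 + x ^ 6 * y ^ 18 + x ^ 6 * z ^ 18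
  + y ^ 18 * z ^ 6 + y ^ 6 * z ^ 18

/-- The degree-21 polynomial `Q` (the inflection divisor of `F_H⁷`). -/
def Qbig : P3 :=
  x * y * z * (x ^ 3 - y ^ 3) * (y ^ 3 - z ^ 3) * (z ^ 3 - x ^ 3)
    * (x ^ 3 + y ^ 3 + z ^ 3 - 3 * (x * y * z))
    * (x ^ 3 + y ^ 3 + z ^ 3 - C (3 * j) * (x * y * z))
    * (x ^ 3 + y ^ 3 + z ^ 3 - C (3 * j ^ 2) * (x * y * z))

section Darboux

variable {R A : Type*} [CommRing R] [CommRing A] [Algebra R A] (δ : Derivation R A A)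

/-- The product of two Darboux elements of `δ` is Darboux, and the cofactors add up. -/
theorem darboux_mul {f g k l : A} (hf : δ f = k * f) (hg : δ g = l * g) :
    δ (f * g) = (k + l) * (f * g) := by
  rw [Derivation.leibniz, smul_eq_mul, smul_eq_mul, hf, hg]
  ring

theorem darboux_pow {f k : A} (hf : δ f = k * f) (n : ℕ) :
    δ (f ^ n) = (n * k) * f ^ n := by
  induction n with
  | zero => simp
  | succ n ih =>
    rw [pow_succ, darboux_mul δ ih hf]
    push_cast
    ring

/-- The polynomial `Pbig` as a function of the cubes `u = x³`, `v = y³`, `w = z³`. -/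
def numerator (u v w : A) : A :=
  248 * (u ^ 2 * v ^ 2 * w ^ 2) * (u ^ 2 + v ^ 2 + w ^ 2)
  - 154 * (u ^ 2 * v ^ 2 * w ^ 2) * (u * v + u * w + v * w)
  - 52 * (u * v * w) *
      (u ^ 4 * v + u ^ 4 * w + u * v ^ 4 + u * w ^ 4 + v ^ 4 * w + v * w ^ 4)
  + 14 * (u * v * w) * (u ^ 5 + v ^ 5 + w ^ 5)
  - 10 * (u * v * w) *
      (u ^ 3 * v ^ 2 + u ^ 3 * w ^ 2 + u ^ 2 * v ^ 3 + u ^ 2 * w ^ 3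
        + v ^ 3 * w ^ 2 + v ^ 2 * w ^ 3)
  + 6 * (u ^ 4 * v ^ 4 + u ^ 4 * w ^ 4 + v ^ 4 * w ^ 4)
  + 4 * (u ^ 5 * v ^ 3 + u ^ 5 * w ^ 3 + u ^ 3 * v ^ 5 + u ^ 3 * w ^ 5
        + v ^ 5 * w ^ 3 + v ^ 3 * w ^ 5)
  + u ^ 6 * v ^ 2 + u ^ 6 * w ^ 2 + u ^ 2 * v ^ 6 + u ^ 2 * w ^ 6
  + v ^ 6 * w ^ 2 + v ^ 2 * w ^ 6

/-- The denominator `((x³−y³)(y³−z³)(z³−x³))⁴ (xyz)³ ((x³+y³+z³)³ − 27x³y³z³)³` of the first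
integral, as a function of the cubes `u = x³`, `v = y³`, `w = z³`. -/
def denominator (u v w : A) : A :=
  ((u - v) * (v - w) * (w - u)) ^ 4 * (u * v * w) * ((u + v + w) ^ 3 - 27 * (u * v * w)) ^ 3

theorem numerator_cyclic (u v w : A) : numerator v w u = numerator u v w := by
  unfold numerator
  ring

theorem denominator_cyclic (u v w : A) : denominator v w u = denominator u v w := by
  unfold denominator
  ring

variable {δ} {u v w z : A}

/-- `numerator` is a Darboux polynomial. -/
theorem derivation_numerator
    (hu : δ u = -3 * z * (w - u) * (u + 7 * v + w) * u)
    (hv : δ v = 3 * z * (v - w) * (7 * u + v + w) * v)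
    (hw : δ w = 0) :
    δ (numerator u v w) =
      (z * (18 * u ^ 2 + 18 * v ^ 2 + 156 * u * v - 6 * w ^ 2 - 12 * w * (u + v)))
        * numerator u v w := by
  have hn (n : ℕ) [n.AtLeastTwo] : δ (OfNat.ofNat n : A) = 0 := δ.map_natCast n
  simp only [numerator, map_add, map_sub, Derivation.leibniz, Derivation.leibniz_pow, hn,
    hu, hv, hw, smul_eq_mul, nsmul_eq_mul]
  push_cast
  ring

/-- `denominator` is a Darboux polynomial, with cofactor three times that of `numerator`. -/
theorem derivation_denominator
    (hu : δ u = -3 * z * (w - u) * (u + 7 * v + w) * u)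
    (hv : δ v = 3 * z * (v - w) * (7 * u + v + w) * v)
    (hw : δ w = 0) :
    δ (denominator u v w) =
      (3 * (z * (18 * u ^ 2 + 18 * v ^ 2 + 156 * u * v - 6 * w ^ 2 - 12 * w * (u + v))))
        * denominator u v w := by
  have huv : δ (u - v) = (3 * z * (u ^ 2 + 8 * u * v + v ^ 2 - w ^ 2)) * (u - v) := by
    rw [map_sub, hu, hv]
    ring
  have hvw : δ (v - w) = (3 * z * v * (7 * u + v + w)) * (v - w) := by
    rw [map_sub, hv, hw]
    ring
  have hwu : δ (w - u) = (3 * z * u * (u + 7 * v + w)) * (w - u) := by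
    rw [map_sub, hu, hw]
    ring
  have hw' : δ w = 0 * w := by rw [hw, zero_mul]
  have hE : δ ((u + v + w) ^ 3 - 27 * (u * v * w)) =
      (9 * z * (u ^ 2 + 6 * u * v + v ^ 2 - w * (u + v)))
        * ((u + v + w) ^ 3 - 27 * (u * v * w)) := by
    have h27 : δ (27 : A) = 0 := δ.map_natCast 27
    simp only [map_add, map_sub, Derivation.leibniz, Derivation.leibniz_pow, h27,
      hu, hv, hw, smul_eq_mul, nsmul_eq_mul]
    push_cast
    ring
  unfold denominator
  rw [darboux_mul δ (darboux_mul δ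
    (darboux_pow δ (darboux_mul δ (darboux_mul δ huv hvw) hwu) 4)
    (darboux_mul δ (darboux_mul δ hu hv) hw')) (darboux_pow δ hE 3)]
  push_cast
  ring

/-- The quotient `numerator ^ 3 / denominator` is annihilated by `δ`. -/
theorem derivation_quotient
    (hu : δ u = -3 * z * (w - u) * (u + 7 * v + w) * u)
    (hv : δ v = 3 * z * (v - w) * (7 * u + v + w) * v)
    (hw : δ w = 0) :
    denominator u v w * δ (numerator u v w ^ 3)
      - numerator u v w ^ 3 * δ (denominator u v w) = 0 := by
  rw [darboux_pow δ (derivation_numerator hu hv hw) 3, derivation_denominator hu hv hw]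
  push_cast
  ring

end Darboux

theorem isPrimitiveRoot_j : IsPrimitiveRoot j 3 := by
  simpa [j] using Complex.isPrimitiveRoot_exp 3 (by norm_num)

theorem Pbig_eq_numerator : Pbig = numerator (x ^ 3) (y ^ 3) (z ^ 3) := by
  unfold Pbig numerator
  ring

theorem Qbig_eq : Qbig = x * y * z * ((x ^ 3 - y ^ 3) * (y ^ 3 - z ^ 3) * (z ^ 3 - x ^ 3))
    * ((x ^ 3 + y ^ 3 + z ^ 3) ^ 3 - 27 * (x ^ 3 * y ^ 3 * z ^ 3)) := by
  have hj3 : (C j : P3) ^ 3 = 1 := by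
    rw [← C_pow, isPrimitiveRoot_j.pow_eq_one, C_1]
  have hj : 1 + (C j : P3) + C j ^ 2 = 0 := by
    have h := isPrimitiveRoot_j.geom_sum_eq_zero (by norm_num)
    simp only [Finset.sum_range_succ, Finset.sum_range_zero, pow_zero, pow_one, zero_add] at h
    rw [← C_pow, ← C_1, ← C_add, ← C_add, h, C_0]
  have hfac (s t : P3) : (s - 3 * t) * (s - C (3 * j) * t) * (s - C (3 * j ^ 2) * t)
      = s ^ 3 - 27 * t ^ 3 := by
    have h3 : (C (3 : ℂ) : P3) = 3 := map_ofNat C 3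
    rw [C_mul, C_mul, C_pow, h3]
    linear_combination (-3 * s ^ 2 * t + 9 * s * t ^ 2 * C j) * hj
      - 27 * t ^ 3 * hj3
  rw [Qbig, mul_assoc, mul_assoc, ← mul_assoc (_ - 3 * _), hfac]
  ring

theorem denominator_eq :
    (x ^ 3 - y ^ 3) * (y ^ 3 - z ^ 3) * (z ^ 3 - x ^ 3) * Qbig ^ 3
      = denominator (x ^ 3) (y ^ 3) (z ^ 3) := by
  rw [Qbig_eq, denominator]
  generalize (x ^ 3 + y ^ 3 + z ^ 3) ^ 3 - 27 * (x ^ 3 * y ^ 3 * z ^ 3) = e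
  generalize (x ^ 3 - y ^ 3) * (y ^ 3 - z ^ 3) * (z ^ 3 - x ^ 3) = d
  ring

/-- The rational function `P³/((x³−y³)(y³−z³)(z³−x³)Q³)` is a rational first integral
of the degree-7 Hesse foliation `F_H⁷`. -/
theorem hesse7_first_integral :
    IsRatFirstIntegral a7 b7 c7
      (Pbig ^ 3)
      ((x ^ 3 - y ^ 3) * (y ^ 3 - z ^ 3) * (z ^ 3 - x ^ 3) * Qbig ^ 3) := by
  rw [denominator_eq, Pbig_eq_numerator]
  have hxy := derivation_quotient (δ := a7 • pderiv 1 - b7 • pderiv 0)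
    (u := x ^ 3) (v := y ^ 3) (w := z ^ 3) (z := z)
    (by simp [x, y, z, a7, b7]; ring) (by simp [x, y, z, a7, b7]; ring)
    (by simp [z])
  have hzx := derivation_quotient (δ := c7 • pderiv 0 - a7 • pderiv 2)
    (u := z ^ 3) (v := x ^ 3) (w := y ^ 3) (z := y)
    (by simp [x, y, z, a7, c7]; ring) (by simp [x, y, z, a7, c7]; ring)
    (by simp [y])
  have hyz := derivation_quotient (δ := b7 • pderiv 2 - c7 • pderiv 1)
    (u := y ^ 3) (v := z ^ 3) (w := x ^ 3) (z := x)
    (by simp [x, y, z, b7, c7]; ring) (by simp [x, y, z, b7, c7]; ring)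
    (by simp [x])
  rw [← numerator_cyclic (z ^ 3), ← denominator_cyclic (z ^ 3)] at hzx
  rw [numerator_cyclic (x ^ 3), denominator_cyclic (x ^ 3)] at hyz
  simp only [Derivation.sub_apply, Derivation.smul_apply, smul_eq_mul] at hxy hzx hyz
  unfold IsRatFirstIntegral Dx Dy Dz
  generalize numerator (x ^ 3) (y ^ 3) (z ^ 3) ^ 3 = p at *
  generalize denominator (x ^ 3) (y ^ 3) (z ^ 3) = q at *
  refine ⟨?_, ?_, ?_⟩
  · linear_combination hxy
  · linear_combination -hzx
  · linear_combination hyz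

end Stmt15
end
end

section
/- A nonzero linear form L = u·x + v·y + w·z ∈ ℂ[x,y,z] defines an invariant line of the degree-7 Hesse foliation F_H⁷ if and only if L is a nonzero scalar multiple of one of the following 21 linear forms (with j = exp(2πi/3)): x, y, z, x+y+z, j²x+jy+z, jx+j²y+z, jx+y+z, x+jy+z, x+y+jz, j²x+y+z, x+j²y+z, x+y+j²z, y−x, y−jx, y−j²x, y−z, y−jz, y−j²z, x−z, x−jz, x−j²z. In particular F_H⁷ has exactly 21 = 3·7 distinct invariant lines. -/
open MvPolynomial

noncomputable section

namespace Stmt16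

abbrev P3 : Type := MvPolynomial (Fin 3) ℂ

def x : P3 := X 0
def y : P3 := X 1
def z : P3 := X 2

def Dx : P3 → P3 := pderiv (0 : Fin 3)
def Dy : P3 → P3 := pderiv (1 : Fin 3)
def Dz : P3 → P3 := pderiv (2 : Fin 3)

/-- `P` defines an invariant curve of the 1-form `a·dx + b·dy + c·dz`. -/
def IsInvariant (a b c P : P3) : Prop :=
  P ∣ (a * Dy P - b * Dx P) ∧ P ∣ (a * Dz P - c * Dx P) ∧ P ∣ (b * Dz P - c * Dy P)

/-- Coefficients of the degree-7 Hesse 1-form `Ω_H⁷`. -/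
def a7 : P3 := y * z * (y ^ 3 - z ^ 3) * (7 * x ^ 3 + y ^ 3 + z ^ 3)
def b7 : P3 := x * z * (z ^ 3 - x ^ 3) * (x ^ 3 + 7 * y ^ 3 + z ^ 3)
def c7 : P3 := x * y * (x ^ 3 - y ^ 3) * (x ^ 3 + y ^ 3 + 7 * z ^ 3)

/-- `j = exp(2πi/3)`. -/
def j : ℂ := Complex.exp (2 * (Real.pi : ℂ) * Complex.I / 3)

/-- The 21 invariant lines of `F_H⁷`. -/
def hesse7Lines : List P3 :=
  [x, y, z,
   x + y + z, C (j ^ 2) * x + C j * y + z, C j * x + C (j ^ 2) * y + z,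
   C j * x + y + z, x + C j * y + z, x + y + C j * z,
   C (j ^ 2) * x + y + z, x + C (j ^ 2) * y + z, x + y + C (j ^ 2) * z,
   y - x, y - C j * x, y - C (j ^ 2) * x,
   y - z, y - C j * z, y - C (j ^ 2) * z,
   x - z, x - C j * z, x - C (j ^ 2) * z]

/-- The linear form `u·x + v·y + w·z`. -/
def linForm (u v w : ℂ) : P3 := C u * x + C v * y + C w * z

/-- The algebraic condition on the coefficients of a linear form describing the invariant lines of
the degree-7 Hesse foliation. -/
def HesseCoeffs (u v w : ℂ) : Prop :=
  (v = 0 ∧ w = 0) ∨ (u = 0 ∧ w = 0) ∨ (u = 0 ∧ v = 0) ∨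
  (u = 0 ∧ v ^ 3 + w ^ 3 = 0) ∨ (v = 0 ∧ u ^ 3 + w ^ 3 = 0) ∨ (w = 0 ∧ u ^ 3 + v ^ 3 = 0) ∨
  (u ^ 3 = w ^ 3 ∧ v ^ 3 = w ^ 3)

lemma isInvariant_linForm_def (u v w : ℂ) (a b c : P3) :
    IsInvariant a b c (linForm u v w) ↔
      linForm u v w ∣ a * C v - b * C u ∧ linForm u v w ∣ a * C w - c * C u ∧
        linForm u v w ∣ b * C w - c * C v := by
  have hx : Dx (linForm u v w) = C u := by
    simp [Dx, linForm, x, y, z, pderiv_X, Derivation.leibniz]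
  have hy : Dy (linForm u v w) = C v := by
    simp [Dy, linForm, x, y, z, pderiv_X, Derivation.leibniz]
  have hz : Dz (linForm u v w) = C w := by
    simp [Dz, linForm, x, y, z, pderiv_X, Derivation.leibniz]
  rw [IsInvariant, hx, hy, hz]

lemma coeffs_of_isInvariant {u v w : ℂ} (h : IsInvariant a7 b7 c7 (linForm u v w)) :
    HesseCoeffs u v w := by
  rw [isInvariant_linForm_def] at h
  obtain ⟨h1, h2, h3⟩ := h
  have key : ∀ p q r : ℂ, u * p + v * q + w * r = 0 →
      (q * r * (q ^ 3 - r ^ 3) * (7 * p ^ 3 + q ^ 3 + r ^ 3)) * v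
        - (p * r * (r ^ 3 - p ^ 3) * (p ^ 3 + 7 * q ^ 3 + r ^ 3)) * u = 0 ∧
      (q * r * (q ^ 3 - r ^ 3) * (7 * p ^ 3 + q ^ 3 + r ^ 3)) * w
        - (p * q * (p ^ 3 - q ^ 3) * (p ^ 3 + q ^ 3 + 7 * r ^ 3)) * u = 0 ∧
      (p * r * (r ^ 3 - p ^ 3) * (p ^ 3 + 7 * q ^ 3 + r ^ 3)) * w
        - (p * q * (p ^ 3 - q ^ 3) * (p ^ 3 + q ^ 3 + 7 * r ^ 3)) * v = 0 := by
    intro p q r hp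
    have e : ∀ f : P3, linForm u v w ∣ f → eval ![p, q, r] f = 0 := by
      rintro f ⟨g, rfl⟩
      simp [linForm, x, y, z, hp]
    have e1 := e _ h1
    have e2 := e _ h2
    have e3 := e _ h3
    have h7 : ∀ s : Fin 3 → ℂ, eval s (7 : P3) = 7 := fun s => map_ofNat (eval s) 7
    simp only [a7, b7, c7, x, y, z, map_sub, map_mul, map_add, map_pow, eval_X, eval_C, h7,
      Matrix.cons_val] at e1 e2 e3
    exact ⟨e1, e2, e3⟩
  by_cases hu : u = 0
  · subst hu
    by_cases hv : v = 0
    · simp [HesseCoeffs, hv]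
    by_cases hw : w = 0
    · simp [HesseCoeffs, hw]
    have k0 := (key 0 w (-v) (by ring)).1
    have k1 := (key 1 w (-v) (by ring)).1
    right; right; right; left
    refine ⟨rfl, ?_⟩
    have : 7 * (w * v ^ 2) * (v ^ 3 + w ^ 3) = 0 := by linear_combination k0 - k1
    simpa [hv, hw] using this
  by_cases hv : v = 0
  · subst hv
    by_cases hw : w = 0
    · simp [HesseCoeffs, hw]
    have k0 := (key w 0 (-u) (by ring)).1
    have k1 := (key w 1 (-u) (by ring)).1
    right; right; right; right; left
    refine ⟨rfl, ?_⟩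
    have : 7 * (w * u ^ 2) * (u ^ 3 + w ^ 3) = 0 := by linear_combination k0 - k1
    simpa [hu, hw] using this
  by_cases hw : w = 0
  · subst hw
    have k0 := (key v (-u) 0 (by ring)).2.1
    have k1 := (key v (-u) 1 (by ring)).2.1
    right; right; right; right; right; left
    refine ⟨rfl, ?_⟩
    have : 7 * (v * u ^ 2) * (u ^ 3 + v ^ 3) = 0 := by linear_combination k1 - k0
    simpa [hu, hv] using this
  right; right; right; right; right; right
  have hroot : ∀ s : ℂ, s ≠ 0 → s * (1 - s ^ 3) * (1 + s ^ 3) = 0 → s ^ 3 = 1 ∨ s ^ 3 = -1 := by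
    intro s hs h
    rcases mul_eq_zero.1 h with h | h
    · left
      have := (mul_eq_zero.1 h).resolve_left hs
      linear_combination -this
    · right; linear_combination h
  obtain ⟨s, rfl⟩ : ∃ s, u = s * w := ⟨u / w, by field_simp⟩
  obtain ⟨t, rfl⟩ : ∃ t, v = t * w := ⟨v / w, by field_simp⟩
  have hs : s ≠ 0 := left_ne_zero_of_mul hu
  have ht : t ≠ 0 := left_ne_zero_of_mul hv
  have hs3 : s ^ 3 = 1 ∨ s ^ 3 = -1 := by
    apply hroot s hs
    have := (key 1 0 (-s) (by ring)).2.2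
    have h' : w * (s * (1 - s ^ 3) * (1 + s ^ 3)) = 0 := by linear_combination this
    exact (mul_eq_zero.1 h').resolve_left hw
  have ht3 : t ^ 3 = 1 ∨ t ^ 3 = -1 := by
    apply hroot t ht
    have := (key 0 1 (-t) (by ring)).2.1
    have h' : w * (t * (1 - t ^ 3) * (1 + t ^ 3)) = 0 := by linear_combination -this
    exact (mul_eq_zero.1 h').resolve_left hw
  have k := (key t s (-2 * s * t) (by ring)).2.1
  have hk : w * s ^ 2 * t * (-2 * (s ^ 3 + 8 * s ^ 3 * t ^ 3) * (7 * t ^ 3 + s ^ 3 - 8 * s ^ 3 * t ^ 3)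
      - (t ^ 3 - s ^ 3) * (t ^ 3 + s ^ 3 - 56 * s ^ 3 * t ^ 3)) = 0 := by
    linear_combination k
  have hne : w * s ^ 2 * t ≠ 0 := by positivity
  replace hk := (mul_eq_zero.1 hk).resolve_left hne
  rcases hs3 with h | h <;> rcases ht3 with h' | h' <;> rw [h, h'] at hk
  · exact ⟨by rw [mul_pow, h, one_mul], by rw [mul_pow, h', one_mul]⟩
  all_goals norm_num at hk

lemma dvd_of_forall_ringHom {L f : P3}
    (h : ∀ (R : Type) [CommRing R] (φ : P3 →+* R), φ L = 0 → φ f = 0) : L ∣ f := by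
  rw [← Ideal.mem_span_singleton, ← Ideal.Quotient.eq_zero_iff_mem]
  exact h _ _ (Ideal.Quotient.eq_zero_iff_mem.2 (Ideal.mem_span_singleton_self L))

lemma isInvariant_of_coeffs {u v w : ℂ} (h : HesseCoeffs u v w) :
    IsInvariant a7 b7 c7 (linForm u v w) := by
  rw [isInvariant_linForm_def]
  have hinv : ∀ s : ℂ, s = 0 ∨ ∃ i : P3, C s * i = 1 := fun s => by
    by_cases hs : s = 0
    · exact Or.inl hs
    · exact Or.inr ⟨C s⁻¹, by rw [← C_mul, mul_inv_cancel₀ hs, C_1]⟩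
  have hcube : ∀ {s t : ℂ}, s ^ 3 = t ^ 3 → (C s : P3) ^ 3 = C t ^ 3 := fun h => by
    rw [← C_pow, h, C_pow]
  have hcube' : ∀ {s t : ℂ}, s ^ 3 + t ^ 3 = 0 → (C s : P3) ^ 3 + C t ^ 3 = 0 := fun h => by
    rw [← C_pow, ← C_pow, ← C_add, h, C_0]
  refine ⟨?_, ?_, ?_⟩ <;>
  · apply dvd_of_forall_ringHom
    intro R _ φ
    have h7 : φ 7 = 7 := map_ofNat φ 7
    simp only [linForm, a7, b7, c7, map_sub, map_mul, map_add, map_pow, h7]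
    intro hL
    rcases h with ⟨rfl, rfl⟩ | ⟨rfl, rfl⟩ | ⟨rfl, rfl⟩ | ⟨rfl, h⟩ | ⟨rfl, h⟩ | ⟨rfl, h⟩ | ⟨h, h'⟩
    · simp only [map_zero] at hL ⊢
      grind only
    · simp only [map_zero] at hL ⊢
      grind only
    · simp only [map_zero] at hL ⊢
      grind only
    · have g := congrArg φ (hcube' h)
      simp only [map_add, map_pow, map_zero] at g hL ⊢
      rcases hinv w with rfl | ⟨i, hi⟩
      · obtain rfl : v = 0 := by simpa using h
        simp
      · have g' := congrArg φ hi
        simp only [map_mul, map_one] at g'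
        grind only
    · have g := congrArg φ (hcube' h)
      simp only [map_add, map_pow, map_zero] at g hL ⊢
      rcases hinv w with rfl | ⟨i, hi⟩
      · obtain rfl : u = 0 := by simpa using h
        simp
      · have g' := congrArg φ hi
        simp only [map_mul, map_one] at g'
        grind only
    · have g := congrArg φ (hcube' h)
      simp only [map_add, map_pow, map_zero] at g hL ⊢
      rcases hinv v with rfl | ⟨i, hi⟩
      · obtain rfl : u = 0 := by simpa using h
        simp
      · have g' := congrArg φ hi
        simp only [map_mul, map_one] at g'
        grind only
    · have g := congrArg φ (hcube h)
      have k := congrArg φ (hcube h')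
      simp only [map_pow] at g k
      rcases hinv w with rfl | ⟨i, hi⟩
      · obtain rfl : u = 0 := by simpa using h
        obtain rfl : v = 0 := by simpa using h'
        simp
      · have g' := congrArg φ hi
        simp only [map_mul, map_one] at g'
        grind only

lemma isInvariant_linForm_iff (u v w : ℂ) :
    IsInvariant a7 b7 c7 (linForm u v w) ↔ HesseCoeffs u v w :=
  ⟨coeffs_of_isInvariant, isInvariant_of_coeffs⟩

lemma j_sq_add : j ^ 2 + j + 1 = 0 := by
  have h : IsPrimitiveRoot j 3 := by
    have := Complex.isPrimitiveRoot_exp 3 (by norm_num)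
    simpa [j] using this
  have := h.geom_sum_eq_zero (by norm_num)
  simp [Finset.sum_range_succ] at this
  linear_combination this

lemma cube_eq_one_iff (a : ℂ) : a ^ 3 = 1 ↔ a = 1 ∨ a = j ∨ a = j ^ 2 := by
  have hj := j_sq_add
  have h : a ^ 3 - 1 = (a - 1) * ((a - j) * (a - j ^ 2)) := by
    linear_combination (a ^ 2 - a * j + j -1) * hj
  rw [← sub_eq_zero, h, mul_eq_zero, mul_eq_zero, sub_eq_zero, sub_eq_zero, sub_eq_zero]

lemma linForm_inj {u v w u' v' w' : ℂ} (h : linForm u v w = linForm u' v' w') :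
    u = u' ∧ v = v' ∧ w = w' := by
  have e := fun s => congrArg (eval s) h
  simp only [linForm, x, y, z, map_add, map_mul, eval_C, eval_X] at e
  have h1 := e ![1, 0, 0]
  have h2 := e ![0, 1, 0]
  have h3 := e ![0, 0, 1]
  simp at h1 h2 h3
  exact ⟨h1, h2, h3⟩

lemma C_mul_linForm (t u v w : ℂ) : C t * linForm u v w = linForm (t * u) (t * v) (t * w) := by
  simp only [linForm, map_mul]; ring

lemma linForm_zero : linForm 0 0 0 = 0 := by simp [linForm]

/-- The coefficients of the forms in `hesse7Lines`. -/
def hesse7Coeffs : List (ℂ × ℂ × ℂ) :=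
  [(1, 0, 0), (0, 1, 0), (0, 0, 1),
   (1, 1, 1), (j ^ 2, j, 1), (j, j ^ 2, 1),
   (j, 1, 1), (1, j, 1), (1, 1, j),
   (j ^ 2, 1, 1), (1, j ^ 2, 1), (1, 1, j ^ 2),
   (-1, 1, 0), (-j, 1, 0), (-j ^ 2, 1, 0),
   (0, 1, -1), (0, 1, -j), (0, 1, -j ^ 2),
   (1, 0, -1), (1, 0, -j), (1, 0, -j ^ 2)]

lemma hesse7Lines_eq_map :
    hesse7Lines = hesse7Coeffs.map fun p => linForm p.1 p.2.1 p.2.2 := by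
  simp [hesse7Lines, hesse7Coeffs, linForm, sub_eq_add_neg, add_comm]

lemma j_cube : j ^ 3 = 1 := by
  linear_combination (j - 1) * j_sq_add

lemma coeffs_of_mem {p : ℂ × ℂ × ℂ} (hp : p ∈ hesse7Coeffs) (t : ℂ) :
    HesseCoeffs (t * p.1) (t * p.2.1) (t * p.2.2) := by
  have hj := j_cube
  simp only [hesse7Coeffs, List.mem_cons, List.not_mem_nil, or_false] at hp
  rcases hp with rfl | rfl | rfl | rfl | rfl | rfl | rfl | rfl | rfl | rfl | rfl | rfl | rfl |
    rfl | rfl | rfl | rfl | rfl | rfl | rfl | rfl <;> simp only [HesseCoeffs] <;> grind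

lemma eq_mul_cube_root {a b : ℂ} (hb : b ≠ 0) (h : a ^ 3 = b ^ 3) :
    a = b ∨ a = b * j ∨ a = b * j ^ 2 := by
  have h1 : (a / b) ^ 3 = 1 := by rw [div_pow, h, div_self (pow_ne_zero 3 hb)]
  rw [cube_eq_one_iff, div_eq_iff hb, div_eq_iff hb, div_eq_iff hb, one_mul] at h1
  simpa only [mul_comm b] using h1

lemma exists_mem_of_coeffs {u v w : ℂ} (h : HesseCoeffs u v w) (h0 : ¬ (u = 0 ∧ v = 0 ∧ w = 0)) :
    ∃ t : ℂ, t ≠ 0 ∧ ∃ p ∈ hesse7Coeffs, u = t * p.1 ∧ v = t * p.2.1 ∧ w = t * p.2.2 := by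
  have hj := j_cube
  have main : ∀ t a b c : ℂ, (a, b, c) ∈ hesse7Coeffs → u = t * a → v = t * b → w = t * c →
      ∃ t : ℂ, t ≠ 0 ∧ ∃ p ∈ hesse7Coeffs, u = t * p.1 ∧ v = t * p.2.1 ∧ w = t * p.2.2 := by
    intro t a b c hm hu hv hw
    refine ⟨t, ?_, _, hm, hu, hv, hw⟩
    rintro rfl
    simp_all
  have neg : ∀ {a b : ℂ}, a ^ 3 + b ^ 3 = 0 → a ≠ 0 → b = a * -1 ∨ b = a * -j ∨ b = a * -j ^ 2 := by
    intro a b hab ha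
    have := eq_mul_cube_root (neg_ne_zero.2 ha) (show b ^ 3 = (-a) ^ 3 by linear_combination hab)
    simpa using this
  rcases h with ⟨rfl, rfl⟩ | ⟨rfl, rfl⟩ | ⟨rfl, rfl⟩ | ⟨rfl, h⟩ | ⟨rfl, h⟩ | ⟨rfl, h⟩ | ⟨h, h'⟩
  · exact main u 1 0 0 (by simp [hesse7Coeffs]) (by simp) (by simp) (by simp)
  · exact main v 0 1 0 (by simp [hesse7Coeffs]) (by simp) (by simp) (by simp)
  · exact main w 0 0 1 (by simp [hesse7Coeffs]) (by simp) (by simp) (by simp)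
  · have hv : v ≠ 0 := by rintro rfl; simp_all
    rcases neg h hv with e | e | e <;>
      exact main v 0 1 _ (by simp [hesse7Coeffs]) (by simp) (by simp) e
  · have hu : u ≠ 0 := by rintro rfl; simp_all
    rcases neg h hu with e | e | e <;>
      exact main u 1 0 _ (by simp [hesse7Coeffs]) (by simp) (by simp) e
  · have hv : v ≠ 0 := by rintro rfl; simp_all
    rw [add_comm] at h
    rcases neg h hv with e | e | e <;>
      exact main v _ 1 0 (by simp [hesse7Coeffs]) e (by simp) (by simp)
  · have hw : w ≠ 0 := by rintro rfl; simp_all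
    rcases eq_mul_cube_root hw h with rfl | e | e <;>
      rcases eq_mul_cube_root hw h' with rfl | e' | e'
    · exact main v 1 1 1 (by simp [hesse7Coeffs]) (by simp) (by simp) (by simp)
    · exact main _ 1 j 1 (by simp [hesse7Coeffs]) (by simp) e' (by simp)
    · exact main _ 1 (j ^ 2) 1 (by simp [hesse7Coeffs]) (by simp) e' (by simp)
    · exact main _ j 1 1 (by simp [hesse7Coeffs]) e (by simp) (by simp)
    · exact main u 1 1 (j ^ 2) (by simp [hesse7Coeffs]) (by simp) (by grind) (by grind)
    · exact main _ j (j ^ 2) 1 (by simp [hesse7Coeffs]) e e' (by simp)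
    · exact main _ (j ^ 2) 1 1 (by simp [hesse7Coeffs]) e (by simp) (by simp)
    · exact main _ (j ^ 2) j 1 (by simp [hesse7Coeffs]) e e' (by simp)
    · exact main u 1 1 j (by simp [hesse7Coeffs]) (by simp) (by grind) (by grind)

/-- The last nonzero entry of the triple is `1`. -/
def IsNormalized (p : ℂ × ℂ × ℂ) : Prop :=
  p.2.2 = 1 ∨ (p.2.2 = 0 ∧ p.2.1 = 1) ∨ (p.2.2 = 0 ∧ p.2.1 = 0 ∧ p.1 = 1)

lemma HesseCoeffs.mul_left {u v w : ℂ} (h : HesseCoeffs u v w) (t : ℂ) :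
    HesseCoeffs (t * u) (t * v) (t * w) := by
  unfold HesseCoeffs
  rcases h with ⟨rfl, rfl⟩ | ⟨rfl, rfl⟩ | ⟨rfl, rfl⟩ | ⟨rfl, h⟩ | ⟨rfl, h⟩ | ⟨rfl, h⟩ | ⟨h, h'⟩
  iterate 3 simp
  iterate 3 simp [mul_pow, ← mul_add, h]
  simp [mul_pow, h, h']

lemma exists_normalized {u v w : ℂ} (h0 : ¬ (u = 0 ∧ v = 0 ∧ w = 0)) :
    ∃ t : ℂ, t ≠ 0 ∧ IsNormalized (t * u, t * v, t * w) := by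
  unfold IsNormalized
  by_cases hw : w = 0
  · by_cases hv : v = 0
    · have hu : u ≠ 0 := fun hu => h0 ⟨hu, hv, hw⟩
      exact ⟨u⁻¹, inv_ne_zero hu, by simp [hu, hv, hw]⟩
    · exact ⟨v⁻¹, inv_ne_zero hv, by simp [hv, hw]⟩
  · exact ⟨w⁻¹, inv_ne_zero hw, by simp [hw]⟩

lemma injOn_span_linForm :
    Set.InjOn (fun p : ℂ × ℂ × ℂ => Submodule.span ℂ {linForm p.1 p.2.1 p.2.2})
      {p | IsNormalized p} := by
  rintro ⟨u, v, w⟩ hp ⟨u', v', w'⟩ hq h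
  have hmem : linForm u v w ∈ Submodule.span ℂ {linForm u' v' w'} := by
    rw [← show Submodule.span ℂ {linForm u v w} = Submodule.span ℂ {linForm u' v' w'} from h]
    exact Submodule.mem_span_singleton_self _
  obtain ⟨t, ht⟩ := Submodule.mem_span_singleton.1 hmem
  rw [smul_eq_C_mul, C_mul_linForm] at ht
  obtain ⟨rfl, rfl, rfl⟩ := linForm_inj ht
  simp only [IsNormalized, Set.mem_ofPred_eq] at hp hq
  have : t = 1 := by grind
  simp [this]

open Finset in
lemma ncard_normalized_hesseCoeffs :
    Set.ncard {p : ℂ × ℂ × ℂ | HesseCoeffs p.1 p.2.1 p.2.2 ∧ IsNormalized p} = 21 := by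
  classical
  let μ : Finset ℂ := Polynomial.nthRootsFinset 3 (1 : ℂ)
  have hμ : ∀ a, a ∈ μ ↔ a ^ 3 = 1 := fun a => Polynomial.mem_nthRootsFinset (by norm_num) 1
  have hcard : #μ = 3 := (Complex.isPrimitiveRoot_exp 3 (by norm_num)).card_nthRootsFinset
  let A := (μ ×ˢ μ).image fun p => (p.1, p.2, (1 : ℂ))
  let B := μ.image fun a => ((0 : ℂ), -a, (1 : ℂ))
  let D := μ.image fun a => (-a, (0 : ℂ), (1 : ℂ))
  let E := μ.image fun a => (-a, (1 : ℂ), (0 : ℂ))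
  let F : Finset (ℂ × ℂ × ℂ) := {(1, 0, 0), (0, 1, 0), (0, 0, 1)}
  have hA : #A = 9 := by
    rw [card_image_of_injective _ fun p q h => by simp at h; ext <;> simp [h], card_product, hcard]
  have hB : #B = 3 := by rw [card_image_of_injective _ fun p q h => by simpa using h, hcard]
  have hD : #D = 3 := by rw [card_image_of_injective _ fun p q h => by simpa using h, hcard]
  have hE : #E = 3 := by rw [card_image_of_injective _ fun p q h => by simpa using h, hcard]
  have hF : #F = 3 := by simp [F]
  have hunion : {p : ℂ × ℂ × ℂ | HesseCoeffs p.1 p.2.1 p.2.2 ∧ IsNormalized p} =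
      ((((A ∪ B) ∪ D) ∪ E) ∪ F : Finset (ℂ × ℂ × ℂ)) := by
    ext ⟨u, v, w⟩
    simp only [A, B, D, E, F, HesseCoeffs, IsNormalized, Set.mem_ofPred_eq, coe_union, Set.mem_union,
      mem_coe, mem_image, mem_product, mem_insert, mem_singleton, Prod.mk.injEq, hμ, Prod.exists]
    constructor
    · have hneg : ∀ a : ℂ, a ^ 3 + 1 = 0 → (-a) ^ 3 = 1 := fun a ha => by linear_combination -ha
      rintro ⟨h, rfl | ⟨rfl, rfl⟩ | ⟨rfl, rfl, rfl⟩⟩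
      · rcases h with h | h | ⟨rfl, rfl⟩ | ⟨rfl, h⟩ | ⟨rfl, h⟩ | h | ⟨h, h'⟩
        · simp at h
        · simp at h
        · simp
        · exact .inl (.inl (.inl (.inr ⟨-v, hneg v (by simpa using h), by simp⟩)))
        · exact .inl (.inl (.inr ⟨-u, hneg u (by simpa using h), by simp⟩))
        · simp at h
        · exact .inl (.inl (.inl (.inl ⟨u, v, by simp [h, h'], by simp⟩)))
      · rcases h with h | ⟨rfl, -⟩ | h | h | h | ⟨-, h⟩ | h
        · simp at h
        · simp
        · simp at h
        · simp at h
        · simp at h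
        · exact .inl (.inr ⟨-u, hneg u (by simpa using h), by simp⟩)
        · simp at h
      · simp
    · rintro ((((⟨a, b, ⟨ha, hb⟩, rfl, rfl, rfl⟩ | ⟨a, ha, rfl, rfl, rfl⟩) | ⟨a, ha, rfl, rfl, rfl⟩) |
        ⟨a, ha, rfl, rfl, rfl⟩) | ⟨rfl, rfl, rfl⟩ | ⟨rfl, rfl, rfl⟩ | ⟨rfl, rfl, rfl⟩) <;>
      simp [*, Odd.neg_pow (show Odd 3 by decide)]
  rw [hunion, Set.ncard_coe_finset, card_union_of_disjoint, card_union_of_disjoint,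
    card_union_of_disjoint, card_union_of_disjoint, hA, hB, hD, hE, hF]
  all_goals
    rw [disjoint_left]
    rintro ⟨u, v, w⟩
    simp only [A, B, D, E, F, mem_union,
      mem_image, mem_product, mem_insert, mem_singleton, Prod.mk.injEq, hμ, Prod.exists]
    grind

/-- A nonzero linear form `L = u·x + v·y + w·z` defines an invariant line of the
degree-7 Hesse foliation `F_H⁷` iff it is a nonzero scalar multiple of one of the 21
listed linear forms; and `F_H⁷` has exactly `21 = 3·7` distinct invariant lines. -/
theorem hesse7_invariant_lines :
    (∀ u v w : ℂ, C u * x + C v * y + C w * z ≠ 0 →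
      (IsInvariant a7 b7 c7 (C u * x + C v * y + C w * z) ↔
        ∃ t : ℂ, t ≠ 0 ∧ ∃ M ∈ hesse7Lines, C u * x + C v * y + C w * z = C t * M)) ∧
    Set.ncard {W : Submodule ℂ P3 | ∃ L : P3,
      (∃ u v w : ℂ, L = C u * x + C v * y + C w * z) ∧ L ≠ 0 ∧
      IsInvariant a7 b7 c7 L ∧ W = Submodule.span ℂ {L}} = 21 := by
  have hne : ∀ {u v w : ℂ}, linForm u v w ≠ 0 → ¬ (u = 0 ∧ v = 0 ∧ w = 0) := by
    rintro u v w h ⟨rfl, rfl, rfl⟩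
    exact h linForm_zero
  have hfold : ∀ u v w : ℂ, C u * x + C v * y + C w * z = linForm u v w := fun _ _ _ => rfl
  simp only [hfold]
  refine ⟨fun u v w h0 => ?_, ?_⟩
  · rw [isInvariant_linForm_iff, hesse7Lines_eq_map]
    simp only [List.mem_map, exists_exists_and_eq_and, C_mul_linForm]
    constructor
    · intro h
      obtain ⟨t, ht, p, hp, hu, hv, hw⟩ := exists_mem_of_coeffs h (hne h0)
      exact ⟨t, ht, p, hp, by rw [hu, hv, hw]⟩
    · rintro ⟨t, -, p, hp, h⟩
      obtain ⟨rfl, rfl, rfl⟩ := linForm_inj h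
      exact coeffs_of_mem hp t
  · rw [← ncard_normalized_hesseCoeffs,
      ← (injOn_span_linForm.mono fun p hp => hp.2).ncard_image]
    congr 1
    ext W
    constructor
    · rintro ⟨_, ⟨u, v, w, rfl⟩, h0, h, rfl⟩
      obtain ⟨t, ht, hn⟩ := exists_normalized (hne h0)
      rw [isInvariant_linForm_iff] at h
      refine ⟨_, ⟨h.mul_left t, hn⟩, ?_⟩
      simp only [← C_mul_linForm, ← smul_eq_C_mul]
      exact Submodule.span_singleton_smul_eq (IsUnit.mk0 t ht) _
    · rintro ⟨⟨u, v, w⟩, ⟨h, hn⟩, rfl⟩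
      refine ⟨_, ⟨u, v, w, rfl⟩, fun h0 => ?_, (isInvariant_linForm_iff u v w).2 h, rfl⟩
      obtain ⟨rfl, rfl, rfl⟩ := linForm_inj (h0.trans linForm_zero.symm)
      simp [IsNormalized] at hn

end Stmt16
end
end

section
/- Set φ = (1+√5)/2. Each of the following 15 linear forms defines an invariant line of the degree-5 Hilbert modular foliation F_H⁵: z, x−y, x+y, x−z, x+z, y−z, y+z, x−(√5−2)z, x+(√5−2)z, y−(√5−2)z, y+(√5−2)z, x+φy−(φ−1)z, x+φy+(φ−1)z, x+(φ−1)y−(φ−2)z, x+(φ−1)y+(φ−2)z; that is, each such linear form L divides each of the three polynomials a·∂yL − b·∂xL, a·∂zL − c·∂xL and b·∂zL − c·∂yL, where a, b, c are the coefficients of Ω_H⁵. -/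
open MvPolynomial

noncomputable section

namespace Stmt17

abbrev P3 : Type := MvPolynomial (Fin 3) ℂ

def x : P3 := X 0
def y : P3 := X 1
def z : P3 := X 2

def Dx : P3 → P3 := pderiv (0 : Fin 3)
def Dy : P3 → P3 := pderiv (1 : Fin 3)
def Dz : P3 → P3 := pderiv (2 : Fin 3)

/-- `P` defines an invariant curve of the 1-form `a·dx + b·dy + c·dz`. -/
def IsInvariant (a b c P : P3) : Prop :=
  P ∣ (a * Dy P - b * Dx P) ∧ P ∣ (a * Dz P - c * Dx P) ∧ P ∣ (b * Dz P - c * Dy P)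

/-- `√5` as a complex number. -/
def s5 : ℂ := (Real.sqrt 5 : ℝ)

/-- The golden ratio `φ = (1+√5)/2`. -/
def phi : ℂ := (1 + s5) / 2

/-- Coefficients of the 1-form `Ω_H⁵` defining the degree-5 Hilbert modular
foliation `F_H⁵`. -/
def a5 : P3 :=
  z * ((y ^ 2 - z ^ 2) * (y ^ 2 - C ((s5 - 2) ^ 2) * z ^ 2) * (y + C s5 * x))
def b5 : P3 :=
  -(z * ((x ^ 2 - z ^ 2) * (x ^ 2 - C ((s5 - 2) ^ 2) * z ^ 2) * (x + C s5 * y)))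
def c5 : P3 :=
  y * ((x ^ 2 - z ^ 2) * (x ^ 2 - C ((s5 - 2) ^ 2) * z ^ 2) * (x + C s5 * y))
  - x * ((y ^ 2 - z ^ 2) * (y ^ 2 - C ((s5 - 2) ^ 2) * z ^ 2) * (y + C s5 * x))

/-- The 15 linear forms. -/
def hilbertLines : List P3 :=
  [z, x - y, x + y, x - z, x + z, y - z, y + z,
   x - C (s5 - 2) * z, x + C (s5 - 2) * z,
   y - C (s5 - 2) * z, y + C (s5 - 2) * z,
   x + C phi * y - C (phi - 1) * z, x + C phi * y + C (phi - 1) * z,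
   x + C (phi - 1) * y - C (phi - 2) * z, x + C (phi - 1) * y + C (phi - 2) * z]

lemma phi_sq : phi ^ 2 = phi + 1 := by
  have h : s5 ^ 2 = 5 := by
    unfold s5
    exact_mod_cast Real.sq_sqrt (show (0 : ℝ) ≤ 5 by norm_num)
  unfold phi
  linear_combination h / 4

lemma s5_eq : s5 = 2 * phi - 1 := by
  unfold phi
  ring

lemma C_s5 : (C s5 : P3) = 2 * C phi - 1 := by
  rw [s5_eq, map_sub, map_mul, map_one, map_ofNat]

/-- The coefficients of `Ω_H⁵ ∧ dL` vanish at the point `(x, y, z)`, where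
`L = α x + β y + γ z`, `f` plays the role of the golden ratio and `2 f - 1` that of `√5`. -/
def VanishesAt {R : Type*} [CommRing R] (f α β γ x y z : R) : Prop :=
  let p := (y ^ 2 - z ^ 2) * (y ^ 2 - (2 * f - 1 - 2) ^ 2 * z ^ 2) * (y + (2 * f - 1) * x)
  let q := (x ^ 2 - z ^ 2) * (x ^ 2 - (2 * f - 1 - 2) ^ 2 * z ^ 2) * (x + (2 * f - 1) * y)
  z * p * β + z * q * α = 0 ∧ z * p * γ - (y * q - x * p) * α = 0 ∧
    z * q * γ + (y * q - x * p) * β = 0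

/-- A line is invariant once the coefficients of `Ω_H⁵ ∧ dL` vanish at every point of the line,
with coordinates in an arbitrary commutative ring. -/
lemma isInvariant_of_vanishesAt {L : P3} (α β γ : ℂ) (hL : L = C α * x + C β * y + C γ * z)
    (h : ∀ (R : Type) [CommRing R] (i : ℂ →+* R) (x y z : R), i phi ^ 2 = i phi + 1 →
      i α * x + i β * y + i γ * z = 0 → VanishesAt (i phi) (i α) (i β) (i γ) x y z) :
    IsInvariant a5 b5 c5 L := by
  have hx : Dx L = C α := by simp [hL, Dx, x, y, z, pderiv_X]
  have hy : Dy L = C β := by simp [hL, Dy, x, y, z, pderiv_X]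
  have hz : Dz L = C γ := by simp [hL, Dz, x, y, z, pderiv_X]
  have hL0 : Ideal.Quotient.mk (Ideal.span {L}) (C α * x + C β * y + C γ * z) = 0 := by
    rw [← hL, Ideal.Quotient.eq_zero_iff_mem]
    exact Ideal.mem_span_singleton_self L
  obtain ⟨h1, h2, h3⟩ := h _ ((Ideal.Quotient.mk (Ideal.span {L})).comp C) _ _ _
    (by rw [← map_pow, phi_sq, map_add, map_one]) (by simpa only [map_add, map_mul, RingHom.comp_apply] using hL0)
  rw [IsInvariant, hx, hy, hz, a5, b5, c5]
  refine ⟨?_, ?_, ?_⟩ <;> rw [← Ideal.mem_span_singleton, ← Ideal.Quotient.eq_zero_iff_mem] <;>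
    simp only [C_s5, map_sub, map_mul, map_add, map_neg, map_pow, map_one, map_ofNat,
      RingHom.comp_apply] at h1 h2 h3 ⊢
  · linear_combination h1
  · linear_combination h2
  · linear_combination -h3

/-- Each of the 15 listed linear forms defines an invariant line of the degree-5
Hilbert modular foliation `F_H⁵`. -/
theorem hilbert5_invariant_lines :
    ∀ L ∈ hilbertLines, IsInvariant a5 b5 c5 L := by
  intro L hL
  simp only [hilbertLines, List.mem_cons, List.not_mem_nil, or_false] at hL
  rcases hL with rfl | rfl | rfl | rfl | rfl | rfl | rfl | rfl |
    rfl | rfl | rfl | rfl | rfl | rfl | rfl <;> [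
     refine isInvariant_of_vanishesAt 0 0 1 ?_ ?_;
     refine isInvariant_of_vanishesAt 1 (-1) 0 ?_ ?_;
     refine isInvariant_of_vanishesAt 1 1 0 ?_ ?_;
     refine isInvariant_of_vanishesAt 1 0 (-1) ?_ ?_;
     refine isInvariant_of_vanishesAt 1 0 1 ?_ ?_;
     refine isInvariant_of_vanishesAt 0 1 (-1) ?_ ?_;
     refine isInvariant_of_vanishesAt 0 1 1 ?_ ?_;
     refine isInvariant_of_vanishesAt 1 0 (-(s5 - 2)) ?_ ?_;
     refine isInvariant_of_vanishesAt 1 0 (s5 - 2) ?_ ?_;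
     refine isInvariant_of_vanishesAt 0 1 (-(s5 - 2)) ?_ ?_;
     refine isInvariant_of_vanishesAt 0 1 (s5 - 2) ?_ ?_;
     refine isInvariant_of_vanishesAt 1 phi (-(phi - 1)) ?_ ?_;
     refine isInvariant_of_vanishesAt 1 phi (phi - 1) ?_ ?_;
     refine isInvariant_of_vanishesAt 1 (phi - 1) (-(phi - 2)) ?_ ?_;
     refine isInvariant_of_vanishesAt 1 (phi - 1) (phi - 2) ?_ ?_]
  all_goals first
    | intro R _ i x y z hf h0
      simp only [s5_eq, VanishesAt, map_neg, map_sub, map_mul, map_one, map_zero, map_ofNat] at h0 ⊢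
      grind
    | simp only [map_zero, map_one, map_neg]
      ring

end Stmt17
end
end

section
/- Let A, B ∈ ℂ[x,y] with A(0,0) = B(0,0) = 0, and suppose that the degree-1 homogeneous components of A and B are λ·x and λ·y respectively for some λ ∈ ℂ* (i.e. the origin is a radial singularity of the vector field X = A·∂x + B·∂y). Let P ∈ ℂ[x,y] be a squarefree (reduced) polynomial with P(0,0) = 0 such that P divides A·∂xP + B·∂yP (i.e. the algebraic curve {P = 0} is invariant by X). Then the origin is an ordinary multiple point of the curve {P = 0}: the lowest-degree nonzero homogeneous component of P is a product of pairwise non-proportional linear forms, equivalently this homogeneous component is squarefree. -/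
open MvPolynomial

noncomputable section

namespace Stmt18

abbrev P2 : Type := MvPolynomial (Fin 2) ℂ

/-- A homogeneous polynomial of degree `n` scales by `t ^ n`. -/
theorem aeval_mul_of_isHomogeneous {σ R S : Type*} [CommSemiring R] [CommSemiring S] [Algebra R S]
    {p : MvPolynomial σ R} {n : ℕ} (hp : p.IsHomogeneous n) (t : S) (v : σ → S) :
    aeval (fun i => t * v i) p = t ^ n * aeval v p := by
  rw [aeval_def, aeval_def, eval₂_eq, eval₂_eq, Finset.mul_sum]
  refine Finset.sum_congr rfl fun d hd => ?_
  have h := hp.degree_eq_sum_deg_support hd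
  simp only [mul_pow, Finset.prod_mul_distrib, Finset.prod_pow_eq_pow_sum]
  rw [h]
  ring

/-- The chain rule for a derivation applied to a polynomial expression. -/
theorem derivation_aeval_eq_sum {σ R S : Type*} [Fintype σ] [CommRing R] [CommRing S] [Algebra R S]
    (D : Derivation R S S) (v : σ → S) (p : MvPolynomial σ R) :
    D (aeval v p) = ∑ i, aeval v (pderiv i p) * D (v i) := by
  classical
  induction p using MvPolynomial.induction_on with
  | C a => simp
  | add p q hp hq => simp [hp, hq, add_mul, Finset.sum_add_distrib]
  | mul_X p i hp =>
    simp only [map_mul, Derivation.leibniz, aeval_X, hp, map_add, smul_eq_mul, pderiv_X,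
      Finset.mul_sum, add_mul, Finset.sum_add_distrib]
    simp [Pi.single_apply, mul_comm, mul_left_comm, apply_ite (aeval v), ite_mul, mul_ite]

theorem dvd_aeval_sub_aeval {σ R S : Type*} [CommRing R] [CommRing S] [Algebra R S]
    (d : S) (v w : σ → S) (h : ∀ i, d ∣ v i - w i) (p : MvPolynomial σ R) :
    d ∣ aeval v p - aeval w p := by
  induction p using MvPolynomial.induction_on with
  | C a => simp
  | add p q hp hq =>
    rw [map_add, map_add, add_sub_add_comm]; exact dvd_add hp hq
  | mul_X p i hp =>
    simp only [map_mul, aeval_X]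
    exact dvd_mul_sub_mul hp (h i)

/-- A causal first-order differential equation has a formal solution with given initial value. -/
theorem exists_powerSeries_derivative_eq {k : Type*} [Field k] [CharZero k]
    (T : PowerSeries k → PowerSeries k)
    (hT : ∀ m f g, (PowerSeries.X : PowerSeries k) ^ (m + 1) ∣ f - g →
      (PowerSeries.X : PowerSeries k) ^ (m + 1) ∣ T f - T g) (c : k) :
    ∃ f : PowerSeries k, PowerSeries.constantCoeff f = c ∧ PowerSeries.derivative k f = T f := by
  let s : ℕ → PowerSeries k := fun m => Nat.rec (PowerSeries.C c)
    (fun m f => f + PowerSeries.monomial (m + 1) (PowerSeries.coeff m (T f) / (m + 1))) m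
  have hs : ∀ m, s (m + 1) = s m +
    PowerSeries.monomial (m + 1) (PowerSeries.coeff m (T (s m)) / (m + 1)) := fun m => rfl
  have hstable : ∀ j d, PowerSeries.coeff j (s (j + d)) = PowerSeries.coeff j (s j) := by
    intro j d
    induction d with
    | zero => rfl
    | succ d ih =>
      rw [← add_assoc, hs, map_add, ih, PowerSeries.coeff_monomial, if_neg (by omega), add_zero]
  have htop : ∀ m j, m < j → PowerSeries.coeff j (s m) = 0 := by
    intro m
    induction m with
    | zero => intro j hj; simp [s, PowerSeries.coeff_C]; omega
    | succ m ih =>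
      intro j hj
      rw [hs, map_add, ih j (by omega), PowerSeries.coeff_monomial, if_neg (by omega), add_zero]
  refine ⟨PowerSeries.mk fun j => PowerSeries.coeff j (s j), by simp [s], ?_⟩
  ext m
  have h1 : (PowerSeries.X : PowerSeries k) ^ (m + 1) ∣
      (PowerSeries.mk fun j => PowerSeries.coeff j (s j)) - s m := by
    rw [PowerSeries.X_pow_dvd_iff]
    intro j hj
    obtain ⟨d, rfl⟩ := Nat.exists_eq_add_of_le (Nat.lt_succ_iff.mp hj)
    simp [hstable]
  have h2 := PowerSeries.X_pow_dvd_iff.mp (hT m _ _ h1) m (Nat.lt_succ_self m)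
  rw [map_sub, sub_eq_zero] at h2
  rw [h2, PowerSeries.coeff_derivative, PowerSeries.coeff_mk, hs, map_add, htop m _ (by omega),
    PowerSeries.coeff_monomial, if_pos rfl, zero_add]
  have : (m + 1 : k) ≠ 0 := by exact_mod_cast Nat.succ_ne_zero m
  field_simp

/-- The order `m` of a solution of `X a g' = h g` satisfies `h(0) = m a(0)`. -/
theorem constantCoeff_eq_of_X_mul_derivative_eq {k : Type*} [Field k]
    {a h u : PowerSeries k} {m : ℕ}
    (hu : PowerSeries.X * a * PowerSeries.derivative k (PowerSeries.X ^ m * u) =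
      h * (PowerSeries.X ^ m * u)) (hu0 : PowerSeries.constantCoeff u ≠ 0) :
    PowerSeries.constantCoeff h = m * PowerSeries.constantCoeff a := by
  have e : (PowerSeries.X : PowerSeries k) ^ m *
      (a * ((m : PowerSeries k) * u + PowerSeries.X * PowerSeries.derivative k u)) =
      PowerSeries.X ^ m * (h * u) := by
    rw [mul_left_comm _ h u, ← hu, Derivation.leibniz, Derivation.leibniz_pow]
    cases m with
    | zero => simp; ring
    | succ m => simp; ring
  have e2 := congrArg PowerSeries.constantCoeff
    (mul_left_cancel₀ (pow_ne_zero m PowerSeries.X_ne_zero) e)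
  simp only [map_mul, map_add, map_natCast, PowerSeries.constantCoeff_X, zero_mul, add_zero] at e2
  exact mul_right_cancel₀ hu0 (by linear_combination -e2)

/-- A power series solution of `X a g' = h g` with exponent `n` vanishes if its `n`-th coefficient
does. -/
theorem eq_zero_of_X_mul_derivative_eq {k : Type*} [Field k] [CharZero k]
    {a h g : PowerSeries k} {n : ℕ} (ha : PowerSeries.constantCoeff a ≠ 0)
    (hh : PowerSeries.constantCoeff h = n * PowerSeries.constantCoeff a)
    (hg : PowerSeries.X * a * PowerSeries.derivative k g = h * g)
    (hn : PowerSeries.coeff n g = 0) : g = 0 := by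
  have key : ∀ m : ℕ, (PowerSeries.X : PowerSeries k) ^ m ∣ g := by
    intro m
    induction m with
    | zero => simp
    | succ m ih =>
      obtain ⟨u, rfl⟩ := ih
      have hu : PowerSeries.constantCoeff u = 0 := by
        by_contra hu
        have hmn : m = n := by
          have h' := constantCoeff_eq_of_X_mul_derivative_eq hg hu
          rw [hh] at h'
          exact_mod_cast (mul_right_cancel₀ ha h').symm
        subst hmn
        exact hu (by simpa [PowerSeries.coeff_X_pow_mul'] using hn)
      rw [pow_succ]
      exact mul_dvd_mul_left _ (PowerSeries.X_dvd_iff.mpr hu)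
  ext m
  simpa using PowerSeries.X_pow_dvd_iff.mp (key (m + 1)) m (Nat.lt_succ_self m)

/-- A polynomial over a unique factorization domain of characteristic zero with a multiple root in
an extension domain is not squarefree. -/
theorem not_squarefree_of_multiple_root {R S : Type*} [CommRing R] [IsDomain R]
    [UniqueFactorizationMonoid R] [CharZero R] [CommRing S] [IsDomain S] (f : R →+* S)
    (hf : Function.Injective f) (y : S) (Q : Polynomial R)
    (h0 : Q.eval₂ f y = 0) (h1 : (Polynomial.derivative Q).eval₂ f y = 0) : ¬ Squarefree Q := by
  classical
  intro hQ
  let _ : NormalizedGCDMonoid R := Classical.choice inferInstance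
  let K := FractionRing R
  have hinj := IsFractionRing.injective R K
  have : CharZero K := charZero_of_injective_algebraMap hinj
  have hsK : Squarefree (Q.map (algebraMap R K)) := by
    have hq0 : Q.map (algebraMap R K) ≠ 0 := by
      rw [Ne, Polynomial.map_eq_zero_iff hinj]; exact hQ.ne_zero
    intro h hdvd
    obtain ⟨b, hbm, hb⟩ := IsLocalization.integerNormalization_spec (nonZeroDivisors R) h
    set N := IsLocalization.integerNormalization (nonZeroDivisors R) h
    have hb0 : algebraMap R K b ≠ 0 := by
      rw [Ne, map_eq_zero_iff _ hinj]; exact nonZeroDivisors.ne_zero hbm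
    rw [← algebraMap_smul K b h, Polynomial.smul_eq_C_mul] at hb
    have hh0 : h ≠ 0 := by
      rintro rfl
      exact hq0 (zero_dvd_iff.mp (by simpa using hdvd))
    have hN0 : algebraMap R K N.content ≠ 0 := by
      rw [Ne, map_eq_zero_iff _ hinj, Polynomial.content_eq_zero_iff]
      intro hN
      rw [hN, Polynomial.map_zero, eq_comm, mul_eq_zero, Polynomial.C_eq_zero] at hb
      exact hb.elim hb0 hh0
    rw [N.eq_C_content_mul_primPart, Polynomial.map_mul, Polynomial.map_C] at hb
    have hass : Associated (N.primPart.map (algebraMap R K)) h :=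
      (associated_unit_mul_left _ _ (Polynomial.isUnit_C.mpr hN0.isUnit)).symm.trans
        (hb ▸ associated_unit_mul_left _ _ (Polynomial.isUnit_C.mpr hb0.isUnit))
    have hdvd' : N.primPart * N.primPart ∣ Q := by
      rw [(N.isPrimitive_primPart.mul N.isPrimitive_primPart).dvd_iff_fraction_map_dvd_fraction_map
        K, Polynomial.map_mul]
      exact (hass.mul_mul hass).dvd.trans hdvd
    exact hass.isUnit ((hQ _ hdvd').map (Polynomial.mapRingHom (algebraMap R K)))
  have hsep := PerfectField.separable_iff_squarefree.mpr hsK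
  obtain ⟨u, v, huv⟩ := hsep
  let F : K →+* FractionRing S := IsFractionRing.map (K := K) (L := FractionRing S) hf
  have hF : F.comp (algebraMap R K) = (algebraMap S (FractionRing S)).comp f := by
    ext r; simp [F, IsFractionRing.map]
  have := congrArg (Polynomial.eval₂ F (algebraMap S _ y)) huv
  rw [Polynomial.derivative_map, Polynomial.eval₂_add, Polynomial.eval₂_mul, Polynomial.eval₂_mul,
    Polynomial.eval₂_map, Polynomial.eval₂_map, hF, ← Polynomial.hom_eval₂, ← Polynomial.hom_eval₂,
    h0, h1] at this
  simp at this

/-- The power series `Q(X v)` with its terms of degree less than `k` removed, divided by `X ^ k`. -/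
def blowupTail {σ R : Type*} [CommRing R] (k : ℕ) (Q : MvPolynomial σ R)
    (v : σ → PowerSeries R) : PowerSeries R :=
  ∑ d ∈ Finset.range (Q.totalDegree + 1),
    PowerSeries.X ^ d * aeval v (homogeneousComponent (k + d) Q)

theorem aeval_X_mul_eq {σ R : Type*} [CommRing R] (k : ℕ) (Q : MvPolynomial σ R)
    (v : σ → PowerSeries R) :
    aeval (fun i => PowerSeries.X * v i) Q =
      ∑ d ∈ Finset.range k, PowerSeries.X ^ d * aeval v (homogeneousComponent d Q) +
        PowerSeries.X ^ k * blowupTail k Q v := by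
  have h : Q = ∑ d ∈ Finset.range (k + (Q.totalDegree + 1)), homogeneousComponent d Q := by
    conv_lhs => rw [← sum_homogeneousComponent Q]
    refine Finset.sum_subset (Finset.range_mono (by omega)) fun d _ hd => ?_
    exact homogeneousComponent_eq_zero _ _ (by simpa using hd)
  conv_lhs => rw [h, map_sum]
  simp_rw [aeval_mul_of_isHomogeneous (homogeneousComponent_isHomogeneous _ Q)]
  rw [Finset.sum_range_add, blowupTail, Finset.mul_sum]
  simp_rw [pow_add, mul_assoc]

theorem dvd_blowupTail_sub {σ R : Type*} [CommRing R] (k : ℕ) (Q : MvPolynomial σ R)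
    (d : PowerSeries R) (v w : σ → PowerSeries R) (h : ∀ i, d ∣ v i - w i) :
    d ∣ blowupTail k Q v - blowupTail k Q w := by
  rw [blowupTail, blowupTail, ← Finset.sum_sub_distrib]
  refine Finset.dvd_sum fun e _ => ?_
  rw [← mul_sub]
  exact Dvd.dvd.mul_left (dvd_aeval_sub_aeval d v w h _) _

theorem constantCoeff_aeval {σ R : Type*} [CommRing R] (Q : MvPolynomial σ R)
    (v : σ → PowerSeries R) :
    PowerSeries.constantCoeff (aeval v Q) = eval (fun i => PowerSeries.constantCoeff (v i)) Q := by
  induction Q using MvPolynomial.induction_on with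
  | C a => simp
  | add p q hp hq => simp [hp, hq]
  | mul_X p i hp => simp [hp]

/-- Along a curve `X v` through the origin, a polynomial without terms of degree less than `n` has
`n`-th coefficient given by its homogeneous component of degree `n`. -/
theorem coeff_aeval_X_mul {σ R : Type*} [CommRing R] {n : ℕ} {Q : MvPolynomial σ R}
    (hQ : ∀ m < n, homogeneousComponent m Q = 0) (v : σ → PowerSeries R) :
    PowerSeries.coeff n (aeval (fun i => PowerSeries.X * v i) Q) =
      eval (fun i => PowerSeries.constantCoeff (v i)) (homogeneousComponent n Q) := by
  rw [aeval_X_mul_eq (n + 1), Finset.sum_range_succ, Finset.sum_eq_zero, zero_add, map_add, pow_succ,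
    mul_assoc, PowerSeries.coeff_X_pow_mul', PowerSeries.coeff_X_pow_mul']
  · simp
  · intro d hd
    rw [hQ d (Finset.mem_range.mp hd)]; simp

theorem homogeneousComponent_pderiv {σ R : Type*} [CommRing R] (i : σ) (n : ℕ)
    (p : MvPolynomial σ R) :
    homogeneousComponent n (pderiv i p) = pderiv i (homogeneousComponent (n + 1) p) := by
  classical
  ext m
  simp only [coeff_homogeneousComponent, coeff_pderiv, map_add, Finsupp.degree_single,
    add_left_inj, ite_mul, zero_mul]

theorem pderiv_pderiv_comm {σ R : Type*} [CommRing R] (i j : σ) (p : MvPolynomial σ R) :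
    pderiv i (pderiv j p) = pderiv j (pderiv i p) := by
  classical
  have h : ⁅(pderiv i : Derivation R (MvPolynomial σ R) (MvPolynomial σ R)),
      (pderiv j : Derivation R (MvPolynomial σ R) (MvPolynomial σ R))⁆ = 0 := by
    refine derivation_ext fun l => ?_
    simp [Derivation.commutator_apply, pderiv_X, Pi.single_apply, apply_ite (pderiv i),
      apply_ite (pderiv j)]
  have := congrArg (fun D => D p) h
  simpa [Derivation.commutator_apply, sub_eq_zero] using this

/-- A radial singularity has, in every direction `(1, c)`, an invariant formal curve
`x ↦ (x, x f(x))` with `f(0) = c`. -/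
theorem exists_formal_separatrix {k : Type*} [Field k] [CharZero k]
    (A B : MvPolynomial (Fin 2) k) {lam : k} (hlam : lam ≠ 0)
    (hA0 : coeff 0 A = 0) (hB0 : coeff 0 B = 0)
    (hA1 : homogeneousComponent 1 A = C lam * X 0)
    (hB1 : homogeneousComponent 1 B = C lam * X 1) (c : k) :
    ∃ f a : PowerSeries k, PowerSeries.constantCoeff f = c ∧ PowerSeries.constantCoeff a = lam ∧
      aeval (fun i => PowerSeries.X * ![1, f] i) A = PowerSeries.X * a ∧
      aeval (fun i => PowerSeries.X * ![1, f] i) B =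
        PowerSeries.X * a * PowerSeries.derivative k (PowerSeries.X * f) := by
  let T : PowerSeries k → PowerSeries k := fun f => PowerSeries.C lam⁻¹ *
    (blowupTail 2 B ![1, f] -
      blowupTail 2 A ![1, f] * (f + PowerSeries.X * PowerSeries.derivative k f))
  have hT : ∀ m f g, (PowerSeries.X : PowerSeries k) ^ (m + 1) ∣ f - g →
      (PowerSeries.X : PowerSeries k) ^ (m + 1) ∣ T f - T g := by
    intro m f g h
    have hv : ∀ i, (PowerSeries.X : PowerSeries k) ^ (m + 1) ∣ ![1, f] i - ![1, g] i := by
      intro i; fin_cases i <;> simp [h]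
    have hd : (PowerSeries.X : PowerSeries k) ^ (m + 1) ∣
        (f + PowerSeries.X * PowerSeries.derivative k f) -
          (g + PowerSeries.X * PowerSeries.derivative k g) := by
      rw [add_sub_add_comm, ← mul_sub, ← map_sub]
      refine dvd_add h ?_
      obtain ⟨u, hu⟩ := h
      rw [hu, Derivation.leibniz, Derivation.leibniz_pow]
      refine ⟨((m + 1 : ℕ) : PowerSeries k) * u + PowerSeries.X * PowerSeries.derivative k u, ?_⟩
      simp
      ring
    simp only [T]
    rw [← mul_sub, sub_sub_sub_comm]
    exact Dvd.dvd.mul_left (dvd_sub (dvd_blowupTail_sub _ _ _ _ _ hv)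
      (dvd_mul_sub_mul (dvd_blowupTail_sub _ _ _ _ _ hv) hd)) _
  obtain ⟨f, hf0, hf⟩ := exists_powerSeries_derivative_eq T hT c
  refine ⟨f, PowerSeries.C lam + PowerSeries.X * blowupTail 2 A ![1, f], hf0, by simp, ?_, ?_⟩
  · rw [aeval_X_mul_eq 2]
    simp [Finset.sum_range_succ, homogeneousComponent_zero, hA0, hA1]
    ring
  · rw [aeval_X_mul_eq 2]
    have hl : (PowerSeries.C lam : PowerSeries k) * PowerSeries.C lam⁻¹ = 1 := by
      rw [← map_mul, mul_inv_cancel₀ hlam, map_one]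
    have hf' : PowerSeries.C lam * PowerSeries.derivative k f = blowupTail 2 B ![1, f] -
        blowupTail 2 A ![1, f] * (f + PowerSeries.X * PowerSeries.derivative k f) := by
      conv_lhs => rw [hf, show T f = _ from rfl, ← mul_assoc, hl, one_mul]
    simp [Finset.sum_range_succ, homogeneousComponent_zero, hB0, hB1]
    linear_combination (-PowerSeries.X ^ 2) * hf'

/-- If `P(X, y)` and `(∂P/∂x₁)(X, y)` both vanish for some power series `y`, then `P` is not
squarefree. -/
theorem not_squarefree_of_aeval_eq_zero {k : Type*} [Field k] [CharZero k]
    (P : MvPolynomial (Fin 2) k) (y : PowerSeries k)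
    (h0 : aeval ![PowerSeries.X, y] P = 0) (h1 : aeval ![PowerSeries.X, y] (pderiv 1 P) = 0) :
    ¬ Squarefree P := by
  intro hP
  let e := Polynomial.Bivariate.equivMvPolynomial k
  obtain ⟨Q, rfl⟩ := e.surjective P
  have hQ : Squarefree Q := by
    intro h hh
    have := hP (e h) (by simpa using map_dvd e hh)
    simpa using this
  have he : ∀ p : Polynomial (Polynomial k), aeval ![PowerSeries.X, y] (e p) =
      p.eval₂ (Polynomial.coeToPowerSeries.ringHom) y := by
    intro p
    have : (aeval ![PowerSeries.X, y] : MvPolynomial (Fin 2) k →ₐ[k] _).toRingHom.comp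
        (e : _ →+* MvPolynomial (Fin 2) k) =
        Polynomial.eval₂RingHom (Polynomial.coeToPowerSeries.ringHom) y := by
      refine Polynomial.ringHom_ext' (Polynomial.ringHom_ext ?_ ?_) ?_
      · intro a; simp [e]
      · simp [e]
      · simp [e]
    exact congrArg (fun g => g p) this
  rw [he] at h0
  rw [Polynomial.Bivariate.pderiv_one_equivMvPolynomial, he] at h1
  exact not_squarefree_of_multiple_root _ (Polynomial.coe_injective k) y Q h0 h1 hQ

/-- Over an algebraically closed field, a non-unit polynomial in two variables has a zero other than
the origin. -/
theorem exists_ne_zero_eval_eq_zero {k : Type*} [Field k] [IsAlgClosed k]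
    {L : MvPolynomial (Fin 2) k} (hL : ¬ IsUnit L) : ∃ v : Fin 2 → k, v ≠ 0 ∧ eval v L = 0 := by
  by_contra! H
  have hX : ∀ i, X i ∈ (Ideal.span {L}).radical := by
    intro i
    rw [← vanishingIdeal_zeroLocus_eq_radical (K := k), mem_vanishingIdeal_iff]
    intro v hv
    have hv0 : v = 0 := by
      by_contra hv0
      exact H v hv0 (by simpa [aeval_eq_eval] using hv L (Ideal.mem_span_singleton_self L))
    simp [hv0]
  obtain ⟨m, hm⟩ := hX 0
  obtain ⟨n, hn⟩ := hX 1
  rw [Ideal.mem_span_singleton] at hm hn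
  have hrel : IsRelPrime (X 0 ^ m : MvPolynomial (Fin 2) k) (X 1 ^ n) := by
    refine IsRelPrime.pow ?_
    refine (Irreducible.isRelPrime_iff_not_dvd (MvPolynomial.X_prime (i := 0)).irreducible).mpr ?_
    rw [MvPolynomial.X_dvd_X]; simp
  exact hL (hrel hm hn)

/-- The tangent cone at a radial singularity of a reduced invariant curve has no multiple point with
nonzero first coordinate. -/
theorem eval_pderiv_ne_zero_of_radial {k : Type*} [Field k] [CharZero k]
    {A B : MvPolynomial (Fin 2) k} {lam : k} (hlam : lam ≠ 0)
    (hA0 : coeff 0 A = 0) (hB0 : coeff 0 B = 0)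
    (hA1 : homogeneousComponent 1 A = C lam * X 0)
    (hB1 : homogeneousComponent 1 B = C lam * X 1)
    {P : MvPolynomial (Fin 2) k} (hPsf : Squarefree P)
    (hPinv : P ∣ A * pderiv 0 P + B * pderiv 1 P) {n : ℕ}
    (hlow : ∀ m < n + 1, homogeneousComponent m P = 0) (hn : homogeneousComponent (n + 1) P ≠ 0)
    {v : Fin 2 → k} (hv : v 0 ≠ 0) (hPv : eval v (homogeneousComponent (n + 1) P) = 0) :
    eval v (pderiv 1 (homogeneousComponent (n + 1) P)) ≠ 0 := by
  intro hPv'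
  have scale : ∀ {p : MvPolynomial (Fin 2) k} {d : ℕ} {w : Fin 2 → k}, w 0 ≠ 0 →
      p.IsHomogeneous d → (eval ![1, w 1 / w 0] p = 0 ↔ eval w p = 0) := by
    intro p d w hw hp
    have h := aeval_mul_of_isHomogeneous hp (w 0) ![1, w 1 / w 0]
    have hw' : (fun i => w 0 * ![1, w 1 / w 0] i) = w := by
      ext i; fin_cases i
      · simp
      · simp [mul_div_cancel₀, hw]
    rw [hw', aeval_eq_eval, aeval_eq_eval] at h
    simp [h, hw]
  have hhom := homogeneousComponent_isHomogeneous (n + 1) P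
  obtain ⟨K, hK⟩ := hPinv
  have vec : ∀ f : PowerSeries k, (fun i => PowerSeries.constantCoeff (![1, f] i)) =
      ![1, PowerSeries.constantCoeff f] := by
    intro f; ext i; fin_cases i <;> simp
  -- the differential equation satisfied by `P` along a formal separatrix
  have ode : ∀ (f a : PowerSeries k),
      aeval (fun i => PowerSeries.X * ![1, f] i) A = PowerSeries.X * a →
      aeval (fun i => PowerSeries.X * ![1, f] i) B =
        PowerSeries.X * a * PowerSeries.derivative k (PowerSeries.X * f) →
      ∀ p, PowerSeries.X * a * PowerSeries.derivative k
          (aeval (fun i => PowerSeries.X * ![1, f] i) p) =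
        aeval (fun i => PowerSeries.X * ![1, f] i) (A * pderiv 0 p + B * pderiv 1 p) := by
    intro f a hA hB p
    rw [derivation_aeval_eq_sum, map_add, map_mul, map_mul, hA, hB, Fin.sum_univ_two]
    simp only [Matrix.cons_val_zero, Matrix.cons_val_one, mul_one, PowerSeries.derivative_X]
    ring
  have cst : ∀ (f : PowerSeries k) (p : MvPolynomial (Fin 2) k), PowerSeries.constantCoeff
      (aeval (fun i => PowerSeries.X * ![1, f] i) p) = constantCoeff p := by
    intro f p
    rw [constantCoeff_aeval]
    simp [eval_zero']
  have hK0 : constantCoeff K = ((n + 1 : ℕ) : k) * lam := by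
    obtain ⟨w, hw⟩ : ∃ w, eval w (X 0 * homogeneousComponent (n + 1) P) ≠ 0 := by
      by_contra! H
      exact mul_ne_zero (X_ne_zero 0) hn (MvPolynomial.funext fun x => by simp [H x])
    rw [map_mul, eval_X, mul_ne_zero_iff] at hw
    obtain ⟨f, a, hf, ha, hA, hB⟩ := exists_formal_separatrix A B hlam hA0 hB0 hA1 hB1 (w 1 / w 0)
    have h := ode f a hA hB P
    have hlead := coeff_aeval_X_mul hlow ![1, f]
    rw [hK, map_mul, mul_comm (aeval _ P)] at h
    have hPu := aeval_X_mul_eq (n + 1) P ![1, f]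
    rw [Finset.sum_eq_zero (fun d hd => by
      rw [hlow d (Finset.mem_range.mp hd)]; simp), zero_add] at hPu
    rw [hPu] at h hlead
    rw [vec, hf] at hlead
    have h' := constantCoeff_eq_of_X_mul_derivative_eq h (fun hu => hw.2 ((scale hw.1 hhom).mp
      (by rw [← hlead]; simpa [PowerSeries.coeff_X_pow_mul'] using hu)))
    rwa [cst, ha] at h'
  obtain ⟨f, a, hf, ha, hA, hB⟩ := exists_formal_separatrix A B hlam hA0 hB0 hA1 hB1 (v 1 / v 0)
  set γ : Fin 2 → PowerSeries k := fun i => PowerSeries.X * ![1, f] i with hγ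
  have hγ0 : ∀ p, PowerSeries.constantCoeff (aeval γ p) = constantCoeff p := cst f
  have hP : aeval γ P = 0 := by
    refine eq_zero_of_X_mul_derivative_eq (n := n + 1) (a := a) (h := aeval γ K) (by rwa [ha])
      (by rw [hγ0, hK0, ha]) ?_ ?_
    · rw [ode f a hA hB P, hK, map_mul, mul_comm]
    · rw [coeff_aeval_X_mul hlow, vec, hf, scale hv hhom, hPv]
  have hdP := derivation_aeval_eq_sum (PowerSeries.derivative k) γ P
  rw [hP, map_zero, Fin.sum_univ_two] at hdP
  have hγd0 : PowerSeries.derivative k (γ 0) = 1 := by simp [hγ]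
  rw [hγd0, mul_one] at hdP
  have hQ : aeval γ (pderiv 1 P) = 0 := by
    refine eq_zero_of_X_mul_derivative_eq (n := n) (a := a)
      (h := aeval γ K - aeval γ (pderiv 1 B) +
        aeval γ (pderiv 1 A) * PowerSeries.derivative k (γ 1)) (by rwa [ha]) ?_ ?_ ?_
    · have hlin : ∀ p : MvPolynomial (Fin 2) k, constantCoeff (pderiv 1 p) =
          constantCoeff (pderiv 1 (homogeneousComponent 1 p)) := by
        intro p
        rw [← homogeneousComponent_pderiv, homogeneousComponent_zero, constantCoeff_C]
        rfl
      simp only [map_add, map_sub, map_mul, hγ0, hK0, ha, hlin A, hlin B, hA1, hB1]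
      simp [pderiv_X]
      ring
    · rw [ode f a hA hB]
      have h := congrArg (fun p => aeval γ (pderiv 1 p)) hK
      simp only [map_add, pderiv_mul, map_mul, hP] at h
      have hcomm : pderiv 1 (pderiv 0 P) = pderiv 0 (pderiv 1 P) := pderiv_pderiv_comm 1 0 P
      rw [hcomm] at h
      simp only [map_add, map_mul]
      linear_combination h + aeval γ (pderiv 1 A) * hdP
    · rw [coeff_aeval_X_mul (fun m hm => ?_), homogeneousComponent_pderiv, vec, hf,
        scale hv hhom.pderiv, hPv']
      rw [homogeneousComponent_pderiv, hlow (m + 1) (by omega), map_zero]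
  have hγe : γ = ![PowerSeries.X, PowerSeries.X * f] := by
    ext1 i; fin_cases i <;> simp [hγ]
  rw [hγe] at hP hQ
  exact not_squarefree_of_aeval_eq_zero P _ hP hQ hPsf

/-- If the origin is a radial singularity of the vector field `X = A·∂x + B·∂y`
(i.e. `A`, `B` vanish at the origin and their degree-1 homogeneous components are
`λ·x` and `λ·y` for a common `λ ∈ ℂ*`), and if `{P = 0}` is a reduced invariant
algebraic curve through the origin (`P` squarefree, `P(0,0) = 0` and
`P ∣ A·∂xP + B·∂yP`), then the origin is an ordinary multiple point of `{P = 0}`: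
the lowest-degree nonzero homogeneous component of `P` is squarefree (equivalently,
a product of pairwise non-proportional linear forms). -/
theorem radial_singularity_ordinary_point
    (A B : P2) (lam : ℂ) (hlam : lam ≠ 0)
    (hA0 : coeff (0 : Fin 2 →₀ ℕ) A = 0) (hB0 : coeff (0 : Fin 2 →₀ ℕ) B = 0)
    (hA1 : homogeneousComponent 1 A = C lam * X 0)
    (hB1 : homogeneousComponent 1 B = C lam * X 1)
    (P : P2) (hPsf : Squarefree P) (hP0 : coeff (0 : Fin 2 →₀ ℕ) P = 0)
    (hPinv : P ∣ A * pderiv (0 : Fin 2) P + B * pderiv (1 : Fin 2) P) :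
    ∀ n : ℕ, (∀ m < n, homogeneousComponent m P = 0) →
      homogeneousComponent n P ≠ 0 → Squarefree (homogeneousComponent n P) := by
  intro n hlow hn L hL
  by_contra hLu
  obtain ⟨v, hv, hLv⟩ := exists_ne_zero_eval_eq_zero hLu
  cases n with
  | zero => exact hn (by rw [homogeneousComponent_zero, hP0, map_zero])
  | succ n =>
    obtain ⟨G, hG⟩ := hL
    have hPv : eval v (homogeneousComponent (n + 1) P) = 0 := by simp [hG, hLv]
    have hdv : ∀ i, eval v (pderiv i (homogeneousComponent (n + 1) P)) = 0 := by
      intro i; simp [hG, hLv]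
    by_cases hv0 : v 0 = 0
    · have hv1 : v 1 ≠ 0 := fun hv1 => hv (by ext i; fin_cases i <;> simp [hv0, hv1])
      let s : Fin 2 ≃ Fin 2 := Equiv.swap 0 1
      let e := renameEquiv ℂ s
      have hc : ∀ (m : ℕ) (p : P2),
          homogeneousComponent m (e p) = e (homogeneousComponent m p) := by
        intro m p; exact (rename_homogeneousComponent (φ := s) m p).symm
      have hd : ∀ (i : Fin 2) (p : MvPolynomial (Fin 2) ℂ), pderiv (s i) (e p) = e (pderiv i p) := by
        intro i p; exact pderiv_rename s.injective ..
      have h0 : ∀ p : MvPolynomial (Fin 2) ℂ, coeff 0 (e p) = coeff 0 p := by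
        intro p; exact constantCoeff_rename s p
      have he : ∀ p : MvPolynomial (Fin 2) ℂ, eval (v ∘ s) (e p) = eval v p := by
        intro p
        have : (v ∘ s) ∘ s = v := by ext i; simp [s]
        simp [e, eval_rename, this]
      have hs0 : s 0 = 1 := Equiv.swap_apply_left ..
      have hs1 : s 1 = 0 := Equiv.swap_apply_right ..
      have hd0 := hd 0
      have hd1 := hd 1
      rw [hs0] at hd0
      rw [hs1] at hd1
      refine eval_pderiv_ne_zero_of_radial (A := e B) (B := e A) (P := e P) (n := n) (v := v ∘ s)
        hlam (by rw [h0, hB0]) (by rw [h0, hA0]) (by rw [hc, hB1]; simp [e, hs1])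
        (by rw [hc, hA1]; simp [e, hs0]) ?_ ?_ (fun m hm => by rw [hc, hlow m hm, map_zero])
        (by rw [hc]; simpa using hn) (by simpa [hs0] using hv1) (by rw [hc, he, hPv])
        (by rw [hc, hd0, he, hdv])
      · intro h hh
        have := hPsf (e.symm h) (by simpa using map_dvd e.symm hh)
        simpa using this
      · rw [hd0, hd1, ← map_mul, ← map_mul, ← map_add, add_comm]
        exact map_dvd e hPinv
    · exact eval_pderiv_ne_zero_of_radial hlam hA0 hB0 hA1 hB1 hPsf hPinv hlow hn hv0 hPv (hdv 1)

end Stmt18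
end
end

section
/- Let d ≥ 2 and ζ = exp(2πi/(d−1)). A nonzero linear form L = u·x + v·y + w·z ∈ ℂ[x,y,z] defines an invariant line of the foliation H₀ᵈ (respectively of H₁ᵈ) if and only if L is a nonzero scalar multiple of one of the d+2 linear forms x, y, z, y − ζᵏx (0 ≤ k ≤ d−2); and L defines an invariant line of the foliation F₁ᵈ if and only if L is a nonzero scalar multiple of x or of y. In particular Inv(H₀ᵈ) = Inv(H₁ᵈ) consists of exactly d+2 lines and Inv(F₁ᵈ) consists of exactly 2 lines. -/
open MvPolynomial

noncomputable section

namespace Stmt19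

abbrev P3 : Type := MvPolynomial (Fin 3) ℂ

def x : P3 := X 0
def y : P3 := X 1
def z : P3 := X 2

def Dx : P3 → P3 := pderiv (0 : Fin 3)
def Dy : P3 → P3 := pderiv (1 : Fin 3)
def Dz : P3 → P3 := pderiv (2 : Fin 3)

/-- `P` defines an invariant curve of the 1-form `a·dx + b·dy + c·dz`. -/
def IsInvariant (a b c P : P3) : Prop :=
  P ∣ (a * Dy P - b * Dx P) ∧ P ∣ (a * Dz P - c * Dx P) ∧ P ∣ (b * Dz P - c * Dy P)

/-- Coefficients of `Ω(H₀ᵈ)`. -/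
def aH0 (d : ℕ) : P3 := C (1 - (d : ℂ)) * (y ^ d * z)
def bH0 (d : ℕ) : P3 := -(x ^ d * z) + C (d : ℂ) * (x * z * y ^ (d - 1))
def cH0 (d : ℕ) : P3 := x ^ d * y - x * y ^ d

/-- Coefficients of `Ω(H₁ᵈ)`. -/
def aH1 (d : ℕ) : P3 := y ^ d * z
def bH1 (d : ℕ) : P3 := -(x ^ d * z)
def cH1 (d : ℕ) : P3 := x ^ d * y - x * y ^ d

/-- Coefficients of `Ω(F₁ᵈ)`. -/
def aF1 (d : ℕ) : P3 := y ^ d * z - x ^ d * y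
def bF1 (d : ℕ) : P3 := x ^ (d + 1)
def cF1 (d : ℕ) : P3 := -(x * y ^ d)

/-- `ζ = exp(2πi/(d−1))`. -/
def zeta (d : ℕ) : ℂ := Complex.exp (2 * (Real.pi : ℂ) * Complex.I / ((d : ℂ) - 1))

/-- The classification of `L` up to scalar among `x`, `y`, `z`, `y − ζᵏx`,
`0 ≤ k ≤ d−2`. -/
def IsH0Line (d : ℕ) (L : P3) : Prop :=
  ∃ t : ℂ, t ≠ 0 ∧
    (L = C t * x ∨ L = C t * y ∨ L = C t * z ∨
      ∃ k : ℕ, k ≤ d - 2 ∧ L = C t * (y - C (zeta d ^ k) * x))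

/-! ### Invariance of linear forms -/

lemma IsInvariant.C_mul {a b c P : P3} (h : IsInvariant a b c P) (t : ℂ) :
    IsInvariant a b c (C t * P) := by
  obtain ⟨h₁, h₂, h₃⟩ := h
  have key : ∀ {f g p q : P3}, P ∣ f * p - g * q →
      C t * P ∣ f * (C t * p) - g * (C t * q) := by
    intro f g p q hP
    have e : f * (C t * p) - g * (C t * q) = C t * (f * p - g * q) := by ring
    exact e ▸ mul_dvd_mul_left _ hP
  simp only [IsInvariant, Dx, Dy, Dz, pderiv_C_mul] at *
  exact ⟨key h₁, key h₂, key h₃⟩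

lemma isInvariant_linearForm_iff (a b c : P3) (u v w : ℂ) :
    IsInvariant a b c (C u * x + C v * y + C w * z) ↔
      (C u * x + C v * y + C w * z ∣ a * C v - b * C u) ∧
      (C u * x + C v * y + C w * z ∣ a * C w - c * C u) ∧
      (C u * x + C v * y + C w * z ∣ b * C w - c * C v) := by
  simp [IsInvariant, Dx, Dy, Dz, x, y, z, pderiv_X]

/-- The coefficient vector of an invariant line is proportional to the 1-form along the line. -/
lemma IsInvariant.eval_eq {a b c : P3} {u v w : ℂ}
    (h : IsInvariant a b c (C u * x + C v * y + C w * z)) (p q r : ℂ)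
    (hp : u * p + v * q + w * r = 0) :
    eval ![p, q, r] a * v = eval ![p, q, r] b * u ∧
    eval ![p, q, r] a * w = eval ![p, q, r] c * u ∧
    eval ![p, q, r] b * w = eval ![p, q, r] c * v := by
  rw [isInvariant_linearForm_iff] at h
  have key : ∀ f : P3, C u * x + C v * y + C w * z ∣ f → eval ![p, q, r] f = 0 := by
    rintro _ ⟨g, rfl⟩
    simp [x, y, z, hp]
  have h₁ := key _ h.1
  have h₂ := key _ h.2.1
  have h₃ := key _ h.2.2
  simp only [map_sub, map_mul, eval_C, sub_eq_zero] at h₁ h₂ h₃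
  exact ⟨h₁, h₂, h₃⟩

lemma isInvariant_x_iff (a b c : P3) : IsInvariant a b c x ↔ x ∣ b ∧ x ∣ c := by
  have h := isInvariant_linearForm_iff a b c 1 0 0
  simpa using h

lemma isInvariant_y_iff (a b c : P3) : IsInvariant a b c y ↔ y ∣ a ∧ y ∣ c := by
  have h := isInvariant_linearForm_iff a b c 0 1 0
  simpa using h

lemma isInvariant_z_iff (a b c : P3) : IsInvariant a b c z ↔ z ∣ a ∧ z ∣ b := by
  have h := isInvariant_linearForm_iff a b c 0 0 1
  simpa using h

/-! ### The foliations `H₀ᵈ` and `H₁ᵈ` -/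

lemma zeta_isPrimitiveRoot {d : ℕ} (hd : 2 ≤ d) : IsPrimitiveRoot (zeta d) (d - 1) := by
  have h := Complex.isPrimitiveRoot_exp (d - 1) (by omega)
  rwa [Nat.cast_sub (by omega), Nat.cast_one] at h

/-- The pencil of 1-forms `α yᵈz dx + (β xzyᵈ⁻¹ - xᵈz) dy + (xᵈy - xyᵈ) dz`, `α + β = 1`,
contains both `Ω(H₀ᵈ)` and `Ω(H₁ᵈ)`. -/
lemma isInvariant_pencil_iff {d : ℕ} (hd : 2 ≤ d) {α β : ℂ} (hα : α ≠ 0) (hαβ : α + β = 1)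
    {u v w : ℂ} (hL : C u * x + C v * y + C w * z ≠ 0) :
    IsInvariant (C α * (y ^ d * z)) (-(x ^ d * z) + C β * (x * z * y ^ (d - 1)))
        (x ^ d * y - x * y ^ d) (C u * x + C v * y + C w * z) ↔
      IsH0Line d (C u * x + C v * y + C w * z) := by
  obtain ⟨n, rfl⟩ : ∃ n, d = n + 1 := ⟨d - 1, by omega⟩
  have hn : n ≠ 0 := by omega
  have hζ : IsPrimitiveRoot (zeta (n + 1)) n := zeta_isPrimitiveRoot hd
  rw [Nat.add_sub_cancel]
  constructor
  · intro h
    by_cases hw : w = 0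
    · subst hw
      have h₂ := (h.eval_eq v (-u) 1 (by ring)).2
      by_cases hv : v = 0
      · subst hv
        exact ⟨u, by rintro rfl; simp at hL, Or.inl (by simp)⟩
      · by_cases hu : u = 0
        · subst hu
          exact ⟨v, hv, Or.inr (Or.inl (by simp))⟩
        · simp [x, y, z, hu, hv] at h₂
          have hroot : (-u / v) ^ n = 1 := by
            rw [div_pow, div_eq_one_iff_eq (pow_ne_zero _ hv)]
            have h₃ : (u * v) * ((-u) ^ n - v ^ n) = 0 := by linear_combination h₂
            simpa [hu, hv, sub_eq_zero] using h₃
          have : NeZero n := ⟨hn⟩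
          obtain ⟨k, hk, hkr⟩ := hζ.eq_pow_of_pow_eq_one hroot
          refine ⟨v, hv, Or.inr (Or.inr (Or.inr ⟨k, by omega, ?_⟩))⟩
          have e : u = -(v * (-u / v)) := by field_simp
          rw [hkr]
          nth_rw 1 [e]
          simp only [map_neg, map_mul, map_zero]
          ring
    · have h₁ := (h.eval_eq 1 0 (-u / w) (by field_simp; ring)).2.2
      have h₂ := (h.eval_eq 0 1 (-v / w) (by field_simp; ring)).2.1
      simp [x, y, z, hn, hw, hα] at h₁ h₂
      subst h₁ h₂
      exact ⟨w, hw, Or.inr (Or.inr (Or.inl (by simp)))⟩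
  · rintro ⟨t, -, h | h | h | ⟨k, -, h⟩⟩ <;> rw [h] <;> apply IsInvariant.C_mul
    · rw [isInvariant_x_iff]
      exact ⟨⟨-(x ^ n * z) + C β * (z * y ^ n), by ring⟩, ⟨x ^ n * y - y ^ (n + 1), by ring⟩⟩
    · rw [isInvariant_y_iff]
      exact ⟨⟨C α * (y ^ n * z), by ring⟩, ⟨x ^ (n + 1) - x * y ^ n, by ring⟩⟩
    · rw [isInvariant_z_iff]
      exact ⟨⟨C α * y ^ (n + 1), by ring⟩, ⟨-x ^ (n + 1) + C β * (x * y ^ n), by ring⟩⟩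
    · have hroot : (C (zeta (n + 1) ^ k) : P3) ^ n = 1 := by
        rw [← map_pow, ← pow_mul, mul_comm, pow_mul, hζ.pow_eq_one, one_pow, map_one]
      generalize zeta (n + 1) ^ k = μ at *
      have hdvd : y - C μ * x ∣ y ^ n - x ^ n := by
        have h := sub_dvd_pow_sub_pow (R := P3) y (C μ * x) n
        rwa [mul_pow, hroot, one_mul] at h
      obtain ⟨g, hg⟩ := hdvd
      have hβ : (C β : P3) = 1 - C α := by
        rw [← C_1, ← C_sub, ← hαβ, add_sub_cancel_left]
      have hc : y - C μ * x ∣ x ^ (n + 1) * y - x * y ^ (n + 1) :=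
        ⟨-(x * y * g), by linear_combination -(x * y) * hg⟩
      have e : y - C μ * x = C (-μ) * x + C 1 * y + C 0 * z := by simp; ring
      rw [e, isInvariant_linearForm_iff, ← e]
      refine ⟨⟨C α * z * y ^ n + C μ * x * z * g, ?_⟩, ?_, ?_⟩
      · simp only [map_neg, map_one]
        linear_combination (C μ * x * z) * hg + C μ * x * z * y ^ n * hβ
      · simpa using hc.mul_right (C μ)
      · simpa using (dvd_sub_comm).1 hc

/-! ### The foliation `F₁ᵈ` -/

lemma isInvariant_F1_iff {d : ℕ} (hd : 2 ≤ d) {u v w : ℂ}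
    (hL : C u * x + C v * y + C w * z ≠ 0) :
    IsInvariant (aF1 d) (bF1 d) (cF1 d) (C u * x + C v * y + C w * z) ↔
      ∃ t : ℂ, t ≠ 0 ∧
        (C u * x + C v * y + C w * z = C t * x ∨
         C u * x + C v * y + C w * z = C t * y) := by
  have hd₀ : d ≠ 0 := by omega
  constructor
  · intro h
    by_cases hw : w = 0
    · subst hw
      have h₂ := (h.eval_eq v (-u) 1 (by ring)).2
      simp [aF1, bF1, cF1, x, y, z, hd₀] at h₂
      by_cases hv : v = 0
      · subst hv
        exact ⟨u, by rintro rfl; simp at hL, Or.inl (by simp)⟩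
      · obtain rfl : u = 0 := by simpa [hv] using h₂.2
        exact ⟨v, hv, Or.inr (by simp)⟩
    · have h₁ := (h.eval_eq 1 0 (-u / w) (by field_simp; ring)).2.2
      simp [bF1, cF1, x, y, hd₀, hw] at h₁
  · rintro ⟨t, -, h | h⟩ <;> rw [h] <;> apply IsInvariant.C_mul
    · rw [isInvariant_x_iff]
      exact ⟨⟨x ^ d, pow_succ' _ _⟩, ⟨-y ^ d, by rw [cF1]; ring⟩⟩
    · obtain ⟨n, rfl⟩ := Nat.exists_eq_add_one_of_ne_zero hd₀
      rw [isInvariant_y_iff]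
      exact ⟨⟨y ^ n * z - x ^ (n + 1), by rw [aF1]; ring⟩, ⟨-(x * y ^ n), by rw [cF1]; ring⟩⟩

/-! ### Counting the invariant lines -/

/-- The linear forms `x`, `y`, `z`, `y - ζᵏx`, in this order. -/
def lineForm (d : ℕ) : ℕ → P3
  | 0 => x
  | 1 => y
  | 2 => z
  | k + 3 => y - C (zeta d ^ k) * x

lemma isH0Line_iff {d : ℕ} (hd : 2 ≤ d) (L : P3) :
    IsH0Line d L ↔ ∃ t : ℂ, t ≠ 0 ∧ ∃ i < d + 2, L = C t * lineForm d i := by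
  refine exists_congr fun t => and_congr_right fun _ => ⟨?_, ?_⟩
  · rintro (h | h | h | ⟨k, hk, h⟩)
    · exact ⟨0, by omega, h⟩
    · exact ⟨1, by omega, h⟩
    · exact ⟨2, by omega, h⟩
    · exact ⟨k + 3, by omega, h⟩
  · rintro ⟨_ | _ | _ | k, hi, h⟩
    · exact Or.inl h
    · exact Or.inr (Or.inl h)
    · exact Or.inr (Or.inr (Or.inl h))
    · exact Or.inr (Or.inr (Or.inr ⟨k, by omega, h⟩))

lemma lineForm_eq_linearForm (d i : ℕ) :
    ∃ u v w : ℂ, lineForm d i = C u * x + C v * y + C w * z :=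
  match i with
  | 0 => ⟨1, 0, 0, by simp [lineForm]⟩
  | 1 => ⟨0, 1, 0, by simp [lineForm]⟩
  | 2 => ⟨0, 0, 1, by simp [lineForm]⟩
  | k + 3 => ⟨-zeta d ^ k, 1, 0, by simp [lineForm]; ring⟩

lemma lineForm_ne_zero (d i : ℕ) : lineForm d i ≠ 0 := by
  intro h
  have h₁ := congrArg (eval ![1, 0, 0]) h
  have h₂ := congrArg (eval ![0, 1, 0]) h
  have h₃ := congrArg (eval ![0, 0, 1]) h
  rcases i with _ | _ | _ | k <;> simp [lineForm, x, y, z] at h₁ h₂ h₃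

lemma span_lineForm_injOn {d : ℕ} (hd : 2 ≤ d) :
    Set.InjOn (fun i => Submodule.span ℂ {lineForm d i}) (Set.Iio (d + 2)) := by
  intro i hi j hj hij
  replace hij : Submodule.span ℂ {lineForm d i} = Submodule.span ℂ {lineForm d j} := hij
  have hmem : lineForm d i ∈ Submodule.span ℂ {lineForm d j} :=
    hij ▸ Submodule.mem_span_singleton_self (R := ℂ) (lineForm d i)
  obtain ⟨t, ht⟩ := Submodule.mem_span_singleton.1 hmem
  have hζ : zeta d ≠ 0 := (zeta_isPrimitiveRoot hd).ne_zero (by omega)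
  have h₁ := congrArg (eval ![1, 0, 0]) ht
  have h₂ := congrArg (eval ![0, 1, 0]) ht
  have h₃ := congrArg (eval ![0, 0, 1]) ht
  simp only [Set.mem_Iio] at hi hj
  rcases i with _ | _ | _ | k <;> rcases j with _ | _ | _ | l <;>
    simp [lineForm, x, y, z, hζ] at h₁ h₂ h₃ ⊢
  · simp [h₂] at h₁
  · simp [h₂] at h₁
  · rw [h₂, one_mul] at h₁
    exact (zeta_isPrimitiveRoot hd).pow_inj (by omega) (by omega) h₁.symm

lemma ncard_lines {d m : ℕ} (hd : 2 ≤ d) (hm : m ≤ d + 2) (p : P3 → Prop)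
    (hp : ∀ u v w : ℂ, C u * x + C v * y + C w * z ≠ 0 →
      (p (C u * x + C v * y + C w * z) ↔
        ∃ t : ℂ, t ≠ 0 ∧ ∃ i < m, C u * x + C v * y + C w * z = C t * lineForm d i)) :
    Set.ncard {W : Submodule ℂ P3 | ∃ L : P3,
      (∃ u v w : ℂ, L = C u * x + C v * y + C w * z) ∧ L ≠ 0 ∧
      p L ∧ W = Submodule.span ℂ {L}} = m := by
  have himage : {W : Submodule ℂ P3 | ∃ L : P3,
      (∃ u v w : ℂ, L = C u * x + C v * y + C w * z) ∧ L ≠ 0 ∧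
      p L ∧ W = Submodule.span ℂ {L}} =
      (fun i => Submodule.span ℂ {lineForm d i}) '' Set.Iio m := by
    ext W
    constructor
    · rintro ⟨L, ⟨u, v, w, rfl⟩, hL, hpL, rfl⟩
      obtain ⟨t, ht, i, hi, h⟩ := (hp u v w hL).1 hpL
      refine ⟨i, hi, ?_⟩
      rw [h, ← smul_eq_C_mul]
      exact (Submodule.span_singleton_smul_eq ht.isUnit _).symm
    · rintro ⟨i, hi, rfl⟩
      obtain ⟨u, v, w, h⟩ := lineForm_eq_linearForm d i
      have h₀ := lineForm_ne_zero d i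
      refine ⟨lineForm d i, ⟨u, v, w, h⟩, h₀, ?_, rfl⟩
      rw [h] at h₀ ⊢
      exact (hp u v w h₀).2 ⟨1, one_ne_zero, i, hi, by rw [h]; simp⟩
  rw [himage, ((span_lineForm_injOn hd).mono (Set.Iio_subset_Iio hm)).ncard_image]
  simp [Set.ncard_eq_toFinset_card']

/-- A nonzero linear form `L = u·x + v·y + w·z` defines an invariant line of `H₀ᵈ`
(resp. `H₁ᵈ`) iff it is a nonzero scalar multiple of one of the `d+2` forms `x`, `y`,
`z`, `y − ζᵏx` (`0 ≤ k ≤ d−2`), and an invariant line of `F₁ᵈ` iff it is a nonzero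
scalar multiple of `x` or `y`; in particular `Inv(H₀ᵈ) = Inv(H₁ᵈ)` consists of exactly
`d+2` lines and `Inv(F₁ᵈ)` of exactly `2` lines. -/
theorem H0_H1_F1_invariant_lines (d : ℕ) (hd : 2 ≤ d) :
    (∀ u v w : ℂ, C u * x + C v * y + C w * z ≠ 0 →
      (IsInvariant (aH0 d) (bH0 d) (cH0 d) (C u * x + C v * y + C w * z) ↔
        IsH0Line d (C u * x + C v * y + C w * z))) ∧
    (∀ u v w : ℂ, C u * x + C v * y + C w * z ≠ 0 →
      (IsInvariant (aH1 d) (bH1 d) (cH1 d) (C u * x + C v * y + C w * z) ↔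
        IsH0Line d (C u * x + C v * y + C w * z))) ∧
    (∀ u v w : ℂ, C u * x + C v * y + C w * z ≠ 0 →
      (IsInvariant (aF1 d) (bF1 d) (cF1 d) (C u * x + C v * y + C w * z) ↔
        ∃ t : ℂ, t ≠ 0 ∧
          (C u * x + C v * y + C w * z = C t * x ∨
           C u * x + C v * y + C w * z = C t * y))) ∧
    Set.ncard {W : Submodule ℂ P3 | ∃ L : P3,
      (∃ u v w : ℂ, L = C u * x + C v * y + C w * z) ∧ L ≠ 0 ∧
      IsInvariant (aH0 d) (bH0 d) (cH0 d) L ∧ W = Submodule.span ℂ {L}} = d + 2 ∧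
    Set.ncard {W : Submodule ℂ P3 | ∃ L : P3,
      (∃ u v w : ℂ, L = C u * x + C v * y + C w * z) ∧ L ≠ 0 ∧
      IsInvariant (aH1 d) (bH1 d) (cH1 d) L ∧ W = Submodule.span ℂ {L}} = d + 2 ∧
    Set.ncard {W : Submodule ℂ P3 | ∃ L : P3,
      (∃ u v w : ℂ, L = C u * x + C v * y + C w * z) ∧ L ≠ 0 ∧
      IsInvariant (aF1 d) (bF1 d) (cF1 d) L ∧ W = Submodule.span ℂ {L}} = 2 := by
  have hd₁ : (1 - (d : ℂ)) ≠ 0 := by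
    rw [sub_ne_zero, ne_comm, Nat.cast_ne_one]
    omega
  have h0 : ∀ u v w : ℂ, C u * x + C v * y + C w * z ≠ 0 →
      (IsInvariant (aH0 d) (bH0 d) (cH0 d) (C u * x + C v * y + C w * z) ↔
        IsH0Line d (C u * x + C v * y + C w * z)) := fun u v w hL =>
    isInvariant_pencil_iff hd hd₁ (sub_add_cancel _ _) hL
  have h1 : ∀ u v w : ℂ, C u * x + C v * y + C w * z ≠ 0 →
      (IsInvariant (aH1 d) (bH1 d) (cH1 d) (C u * x + C v * y + C w * z) ↔
        IsH0Line d (C u * x + C v * y + C w * z)) := fun u v w hL => by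
    simpa [aH1, bH1, cH1] using
      isInvariant_pencil_iff hd (one_ne_zero (α := ℂ)) (add_zero 1) hL
  refine ⟨h0, h1, fun u v w hL => isInvariant_F1_iff hd hL,
    ncard_lines hd le_rfl _ fun u v w hL => (h0 u v w hL).trans (isH0Line_iff hd _),
    ncard_lines hd le_rfl _ fun u v w hL => (h1 u v w hL).trans (isH0Line_iff hd _),
    ncard_lines hd (Nat.le_add_left 2 d) _ fun u v w hL => (isInvariant_F1_iff hd hL).trans ?_⟩
  simp only [Nat.exists_lt_succ_left, Nat.not_lt_zero, false_and, exists_false, or_false,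
    lineForm]

end Stmt19
end
end
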